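/- Let P be any family of subsets of 𝟚^ℤ (a 'property of limit sets'). Suppose there exists a non-surjective cellular automaton F₀ on 𝟚 with Ω_{F₀} ∈ P, and there exists a non-surjective cellular automaton F₁ on 𝟚 with Ω_{F₁} ∉ P. Then the problem, given a code (r, f) of a cellular automaton on 𝟚, of deciding whether Ω_{CA(r,f)} ∈ P, is undecidable: the predicate (r, f) ↦ (Ω_{CA(r,f)} ∈ P) on codes is not a computable predicate. -/

import Mathlib

/-- The configuration space of a one-dimensional cellular automaton over alphabet `B`. -/
abbrev Config (B : Type*) := ℤ → B

/-- The global map induced by the local rule `f` of radius `r`. -/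
def caMap {B : Type*} (r : ℕ) (f : (Fin (2 * r + 1) → B) → B) : Config B → Config B :=
  fun x i => f fun j => x (i - (r : ℤ) + ((j : ℕ) : ℤ))

/-- The limit set `Ω_F = ⋂_{j ∈ ℕ} F^j(B^ℤ)`. -/
def limitSet {B : Type*} (F : Config B → Config B) : Set (Config B) :=
  ⋂ j : ℕ, Set.range F^[j]

/-- `F` is a cellular automaton: it is induced by some local rule of some radius. -/
def IsCA {B : Type*} (F : Config B → Config B) : Prop :=
  ∃ (r : ℕ) (f : (Fin (2 * r + 1) → B) → B), F = caMap r f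

/-- A canonical effective encoding of boolean local rules: a rule on `2^n` input
words is identified with a table indexed by `Fin (2 ^ n)`. -/
instance rulePrimcodable (n : ℕ) : Primcodable ((Fin n → Bool) → Bool) :=
  Primcodable.ofEquiv (Fin (2 ^ n) → Bool)
    (Equiv.arrowCongr ((Equiv.arrowCongr (Equiv.refl (Fin n)) finTwoEquiv.symm).trans
      finFunctionFinEquiv) (Equiv.refl Bool))

/-- A code `(r, f)` of a cellular automaton on the two-letter alphabet `𝟚 = Bool`:
a radius `r` together with a local rule `f : 𝟚^{2r+1} → 𝟚`. -/
abbrev CACode := Σ r : ℕ, (Fin (2 * r + 1) → Bool) → Bool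



/-! ## Hierarchical structure: forced lemma -/

inductive Ty | zero | neg1 | neg2 | pos1 | pos2
  deriving DecidableEq

def Ty.swap : Ty → Ty
  | .zero => .zero
  | .neg1 => .pos1
  | .neg2 => .pos2
  | .pos1 => .neg1
  | .pos2 => .neg2

def DownC (G : ℤ → ℤ → Prop) : Prop := ∀ u v u' v', G u v → u' ≤ u → v' ≤ v → G u' v'

/-- divisibility of an element of `ZMod (p^3)` by `p`, `p^2`. -/
def dv1 (p : ℕ) (x : ZMod (p^3)) : Prop := (p : ZMod (p^3))^2 * x = 0
def dv2 (p : ℕ) (x : ZMod (p^3)) : Prop := (p : ZMod (p^3)) * x = 0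

/-- symmetric local facts at a cell, row half: what the type says about the row wire. -/
def rowFact (p : ℕ) (t : Ty) (k k' : ZMod (p^3)) (r r' : ℕ) (lm : Prop) : Prop :=
  match t with
  | .zero => ¬ dv1 p (k+1) ∧ lm ∧ k' = k+1 ∧ r' = 0
  | .neg1 => ¬ lm ∧ k' = k ∧ r' = r+1
  | .neg2 => k' = k ∧ r' = r
  | .pos1 => dv1 p (k+1) ∧ ¬ dv2 p (k+1) ∧ ¬ lm ∧ k' = k+1 ∧ r' = 0
  | .pos2 => dv2 p (k+1) ∧ (k+1 ≠ 0 → lm) ∧ k' = k+1 ∧ r' = 0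

structure FS (p : ℕ) (G : ℤ → ℤ → Prop) where
  ty : ℤ → ℤ → Ty
  k : ℤ → ℤ → ZMod (p^3)
  r : ℤ → ℤ → ℕ
  kc : ℤ → ℤ → ZMod (p^3)
  rc : ℤ → ℤ → ℕ
  lam : ℤ → Bool
  mu : ℤ → Bool
  x0 : ℤ
  y0 : ℤ
  hr : ∀ u v, r u v < p
  hrc : ∀ u v, rc u v < p
  row : ∀ u v, G u v → rowFact p (ty u v) (k (u-1) v) (k u v) (r (u-1) v) (r u v) (lam v = mu u)
  col : ∀ u v, G u v →
    rowFact p (ty u v).swap (kc u (v-1)) (kc u v) (rc u (v-1)) (rc u v) (mu u = lam v)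
  zrow : ∀ u v, G u v → ty u v = .neg1 ∨ ty u v = .neg2 → (p:ℤ) ∣ v - y0
  zcol : ∀ u v, G u v → ty u v = .pos1 ∨ ty u v = .pos2 → (p:ℤ) ∣ u - x0

def FS.swap {p : ℕ} {G : ℤ → ℤ → Prop} (S : FS p G) : FS p (fun u v => G v u) where
  ty := fun u v => (S.ty v u).swap
  k := fun u v => S.kc v u
  r := fun u v => S.rc v u
  kc := fun u v => S.k v u
  rc := fun u v => S.r v u
  lam := S.mu
  mu := S.lam
  x0 := S.y0
  y0 := S.x0
  hr := fun u v => S.hrc v u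
  hrc := fun u v => S.hr v u
  row := fun u v h => S.col v u h
  col := fun u v h => by
    have := S.row v u h
    have e : (S.ty v u).swap.swap = S.ty v u := by cases S.ty v u <;> rfl
    simpa [e] using this
  zrow := fun u v h h' => S.zcol v u h (by revert h'; cases S.ty v u <;> simp [Ty.swap])
  zcol := fun u v h h' => S.zrow v u h (by revert h'; cases S.ty v u <;> simp [Ty.swap])

def mg (p : ℕ) : ℕ → ℤ
  | 0 => 0
  | i+1 => mg p i + (p:ℤ)^i

theorem mg_mono (p : ℕ) {i j : ℕ} (h : i ≤ j) : mg p i ≤ mg p j := by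
  induction h with
  | refl => rfl
  | step _ ih => simp only [mg]; have : (0:ℤ) ≤ (p:ℤ)^(‹ℕ›) := by positivity
                 omega

theorem mg_nonneg (p i : ℕ) : 0 ≤ mg p i := mg_mono p (Nat.zero_le i)

def exR {p : ℕ} {G : ℤ → ℤ → Prop} (S : FS p G) (x y : ℤ) (i : ℕ) : Prop :=
  ∀ u v, G (u + mg p i) (v + mg p i) → (p:ℤ)^i ∣ u - x → (p:ℤ)^i ∣ v - y → ¬ (p:ℤ)^(i+1) ∣ v - y →
    (¬ (p:ℤ)^(i+1) ∣ u - x → S.ty u v = .zero) ∧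
    ((p:ℤ)^(i+1) ∣ u - x → ¬ (p:ℤ)^(i+2) ∣ u - x → S.ty u v = .pos1) ∧
    ((p:ℤ)^(i+2) ∣ u - x → S.ty u v = .pos2)

def goR {p : ℕ} {G : ℤ → ℤ → Prop} (S : FS p G) (x y : ℤ) (i : ℕ) : Prop :=
  ∀ u v, G (u + mg p i) (v + mg p i) → (p:ℤ)^i ∣ u - x → (p:ℤ)^i ∣ v - y → ¬ (p:ℤ)^(i+1) ∣ v - y →
    (¬ (p:ℤ)^(i+1) ∣ u - x → S.ty u v = .zero) ∧
    ((p:ℤ)^(i+1) ∣ u - x → S.ty u v = .pos1 ∨ S.ty u v = .pos2)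

def preR {p : ℕ} {G : ℤ → ℤ → Prop} (S : FS p G) (x y : ℤ) (i : ℕ) : Prop :=
  ∀ u v, G (u + mg p i) (v + mg p i) → (p:ℤ)^i ∣ u - x → (p:ℤ)^i ∣ v - y → ¬ (p:ℤ)^(i+1) ∣ v - y →
    S.ty u v ≠ .neg1 ∧ S.ty u v ≠ .neg2

/-- residue invariance -/
theorem dvd_shift {a x x' u : ℤ} (h : a ∣ x - x') : a ∣ u - x ↔ a ∣ u - x' := by
  have : u - x' = (u - x) + (x - x') := by ring
  rw [this]; exact (Int.dvd_add_left h).symm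

theorem exR_congr {p : ℕ} {G} {S : FS p G} {x y x' y' : ℤ} {i n : ℕ} (hi : i + 2 ≤ n)
    (hx : (p:ℤ)^n ∣ x - x') (hy : (p:ℤ)^n ∣ y - y') (h : exR S x y i) : exR S x' y' i := by
  intro u v hG
  have H := h u v hG
  have d : ∀ j, j ≤ n → (p:ℤ)^j ∣ (p:ℤ)^n := fun j hj => pow_dvd_pow _ hj
  rw [dvd_shift ((d i (by omega)).trans hx), dvd_shift ((d i (by omega)).trans hy),
    dvd_shift ((d (i+1) (by omega)).trans hx), dvd_shift ((d (i+1) (by omega)).trans hy),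
    dvd_shift ((d (i+2) (by omega)).trans hx)] at H
  exact H

theorem goR_congr {p : ℕ} {G} {S : FS p G} {x y x' y' : ℤ} {i n : ℕ} (hi : i + 1 ≤ n)
    (hx : (p:ℤ)^n ∣ x - x') (hy : (p:ℤ)^n ∣ y - y') (h : goR S x y i) : goR S x' y' i := by
  intro u v hG
  have H := h u v hG
  have d : ∀ j, j ≤ n → (p:ℤ)^j ∣ (p:ℤ)^n := fun j hj => pow_dvd_pow _ hj
  rw [dvd_shift ((d i (by omega)).trans hx), dvd_shift ((d i (by omega)).trans hy),
    dvd_shift ((d (i+1) (by omega)).trans hx), dvd_shift ((d (i+1) (by omega)).trans hy)] at H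
  exact H

theorem exR.go {p : ℕ} {G} {S : FS p G} {x y : ℤ} {i : ℕ} (h : exR S x y i) : goR S x y i := by
  intro u v hG h1 h2 h3
  obtain ⟨a, b, c⟩ := h u v hG h1 h2 h3
  refine ⟨a, fun h4 => ?_⟩
  by_cases h5 : (p:ℤ)^(i+2) ∣ u - x
  · exact Or.inr (c h5)
  · exact Or.inl (b h4 h5)

/-- swapped exactness at the column side, unfolded: columns see neg. -/
theorem exC_neg {p : ℕ} {G} {S : FS p G} {x y : ℤ} {i : ℕ} (h : exR S.swap y x i) {u v : ℤ}
    (hG : G (u + mg p i) (v + mg p i)) (h1 : (p:ℤ)^i ∣ u - x) (h1' : ¬ (p:ℤ)^(i+1) ∣ u - x)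
    (h2 : (p:ℤ)^(i+1) ∣ v - y) :
    (¬ (p:ℤ)^(i+2) ∣ v - y → S.ty u v = .neg1) ∧ ((p:ℤ)^(i+2) ∣ v - y → S.ty u v = .neg2) := by
  have h2' : (p:ℤ)^i ∣ v - y := (pow_dvd_pow _ (by omega)).trans h2
  obtain ⟨_, b, c⟩ := h v u hG h2' h1 h1'
  constructor
  · intro h3
    have := b h2 h3
    revert this; simp only [FS.swap]; cases S.ty u v <;> simp [Ty.swap]
  · intro h3
    have := c h3
    revert this; simp only [FS.swap]; cases S.ty u v <;> simp [Ty.swap]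

theorem exists_level (p : ℕ) (x u : ℤ) (i : ℕ) (h : ¬ (p:ℤ)^i ∣ u - x) :
    ∃ j < i, (p:ℤ)^j ∣ u - x ∧ ¬ (p:ℤ)^(j+1) ∣ u - x := by
  induction i with
  | zero => simp at h
  | succ i ih =>
    by_cases h' : (p:ℤ)^i ∣ u - x
    · exact ⟨i, by omega, h', h⟩
    · obtain ⟨j, hj, h2⟩ := ih h'; exact ⟨j, by omega, h2⟩

/-- no multiples strictly between -/
theorem not_dvd_between {a w u x : ℤ} (h1 : x + a * w < u) (h2 : u < x + a * (w+1)) :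
    ¬ a ∣ u - x := by
  rintro ⟨c, hc⟩
  have h1' : a * w < a * c := by linarith
  have h2' : a * c < a * (w+1) := by linarith
  rcases lt_trichotomy a 0 with ha | ha | ha
  · have h3 := (mul_lt_mul_left_of_neg ha).1 h1'
    have h4 := (mul_lt_mul_left_of_neg ha).1 h2'
    omega
  · subst ha; simp at h1'
  · have h3 := lt_of_mul_lt_mul_left h1' ha.le
    have h4 := lt_of_mul_lt_mul_left h2' ha.le
    omega

/-- along a segment where a quantity does not change -/
theorem seg_const {α : Type*} (f : ℤ → α) (a b : ℤ) (hab : a ≤ b)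
    (h : ∀ u, a < u → u ≤ b → f u = f (u-1)) : f b = f a := by
  have : ∀ n : ℕ, a + n ≤ b → f (a + n) = f a := by
    intro n
    induction n with
    | zero => simp
    | succ n ih =>
      intro hn
      push_cast at hn ⊢
      rw [h _ (by omega) (by omega), ← ih (by omega)]
      congr 1; ring
  have h2 := this (b-a).toNat (by omega)
  rw [show a + ((b-a).toNat : ℤ) = b by omega] at h2
  exact h2

section
variable {p : ℕ} {G : ℤ → ℤ → Prop} (S : FS p G)

/-- values just before the next multiple on a row of level ≥ i whose lower-level columns are neg2 -/
theorem k_seg (hD : DownC G) {x y : ℤ} {i : ℕ} (hp : 2 ≤ p)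
    (hlow : ∀ j < i, exR S.swap y x j) {w v : ℤ} (hv : (p:ℤ)^i ∣ v - y)
    (hG : G (x + (p:ℤ)^i * (w+1) - 1 + mg p i) (v + mg p i)) :
    S.k (x + (p:ℤ)^i*(w+1) - 1) v = S.k (x + (p:ℤ)^i*w) v := by
  have hpos : (0:ℤ) < (p:ℤ)^i := by positivity
  apply seg_const (fun u => S.k u v)
  · nlinarith
  · intro u h1 h2
    have nd := not_dvd_between h1 (lt_of_le_of_lt h2 (by linarith))
    obtain ⟨j, hj, h3, h4⟩ := exists_level p x u i nd
    have hm := mg_mono p hj.le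
    have hn := mg_nonneg p j
    have hd : (p:ℤ)^(j+1) ∣ v - y := (pow_dvd_pow _ (by omega)).trans hv
    have H := exC_neg (hlow j hj) (u := u) (v := v) (hD _ _ _ _ hG (by omega) (by omega)) h3 h4 hd
    have R := S.row u v (hD _ _ _ _ hG (by omega) (by omega))
    by_cases h5 : (p:ℤ)^(j+2) ∣ v - y
    · rw [H.2 h5] at R; exact R.1
    · rw [H.1 h5] at R; exact R.2.1

theorem r_seg (hD : DownC G) {x y : ℤ} {i : ℕ} (hp : 2 ≤ p)
    (hlow : ∀ j < i, exR S.swap y x j) {w v : ℤ} (hv : (p:ℤ)^(i+1) ∣ v - y)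
    (hG : G (x + (p:ℤ)^i * (w+1) - 1 + mg p i) (v + mg p i)) :
    S.r (x + (p:ℤ)^i*(w+1) - 1) v = S.r (x + (p:ℤ)^i*w) v := by
  have hpos : (0:ℤ) < (p:ℤ)^i := by positivity
  apply seg_const (fun u => S.r u v)
  · nlinarith
  · intro u h1 h2
    have nd := not_dvd_between h1 (lt_of_le_of_lt h2 (by linarith))
    obtain ⟨j, hj, h3, h4⟩ := exists_level p x u i nd
    have hm := mg_mono p hj.le
    have hn := mg_nonneg p j
    have hd : (p:ℤ)^(j+2) ∣ v - y := (pow_dvd_pow _ (by omega)).trans hv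
    have hd1 : (p:ℤ)^(j+1) ∣ v - y := (pow_dvd_pow _ (by omega)).trans hv
    have H := exC_neg (hlow j hj) (u := u) (v := v) (hD _ _ _ _ hG (by omega) (by omega)) h3 h4 hd1
    have R := S.row u v (hD _ _ _ _ hG (by omega) (by omega))
    rw [H.2 hd] at R; exact R.2

theorem dv1_cast (hp : 2 ≤ p) (n : ℤ) : dv1 p (n : ZMod (p^3)) ↔ (p:ℤ) ∣ n := by
  unfold dv1
  have : ((p : ZMod (p^3))^2 * (n : ZMod (p^3))) = (((p:ℤ)^2 * n : ℤ) : ZMod (p^3)) := by push_cast; ring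
  rw [this, ZMod.intCast_zmod_eq_zero_iff_dvd]
  have : ((p^3 : ℕ) : ℤ) = (p:ℤ)^2 * p := by push_cast; ring
  rw [this]
  exact mul_dvd_mul_iff_left (by positivity)

theorem dv2_cast (hp : 2 ≤ p) (n : ℤ) : dv2 p (n : ZMod (p^3)) ↔ (p:ℤ)^2 ∣ n := by
  unfold dv2
  have : ((p : ZMod (p^3)) * (n : ZMod (p^3))) = (((p:ℤ) * n : ℤ) : ZMod (p^3)) := by push_cast; ring
  rw [this, ZMod.intCast_zmod_eq_zero_iff_dvd]
  have : ((p^3 : ℕ) : ℤ) = (p:ℤ) * (p:ℤ)^2 := by push_cast; ring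
  rw [this]
  exact mul_dvd_mul_iff_left (by positivity)

/-- step relation gives an affine function -/
theorem affine_of_step {N : ℕ} (f : ℤ → ZMod N) (D : ℤ → Prop) (hN : N ≠ 0)
    (hD : ∀ w w', D w → w' ≤ w → D w') (h : ∀ w, D w → f w = f (w-1) + 1) :
    ∃ κ : ℤ, ∀ w, D w → f w = ((κ + w : ℤ) : ZMod N) := by
  have key : ∀ w w', w ≤ w' → D w' → f w' - (w' : ZMod N) = f w - (w : ZMod N) := by
    intro w w' hw hd
    apply seg_const (fun w => f w - (w : ZMod N)) _ _ hw
    intro u h1 h2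
    rw [h u (hD _ _ hd h2)]; push_cast; ring
  by_cases hne : ∃ w0, D w0
  · obtain ⟨w0, h0⟩ := hne
    obtain ⟨κ, hκ⟩ := ZMod.intCast_surjective (f w0 - (w0 : ZMod N))
    refine ⟨κ, fun w hw => ?_⟩
    push_cast; rw [hκ]
    rcases le_total w w0 with h1 | h1
    · rw [key w w0 h1 h0]; ring
    · rw [← key w0 w h1 hw]; ring
  · exact ⟨0, fun w hw => (hne ⟨w, hw⟩).elim⟩

def dom (p : ℕ) (G : ℤ → ℤ → Prop) (x v : ℤ) (i : ℕ) (w : ℤ) : Prop :=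
  G (x + (p:ℤ)^i * w + mg p i) (v + mg p i)

theorem dom_down (hD : DownC G) (x v : ℤ) (i : ℕ) (w w' : ℤ) (h : dom p G x v i w) (hw : w' ≤ w) :
    dom p G x v i w' := by
  apply hD _ _ _ _ h _ le_rfl
  have : (0:ℤ) ≤ (p:ℤ)^i := by positivity
  nlinarith

/-- k along a row of exact level i where no neg occurs at multiples -/
theorem k_affine (hD : DownC G) {x y : ℤ} {i : ℕ} (hp : 2 ≤ p)
    (hlow : ∀ j < i, exR S.swap y x j) (hpre : preR S x y i) {v : ℤ} (hv : (p:ℤ)^i ∣ v - y)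
    (hv' : ¬ (p:ℤ)^(i+1) ∣ v - y) :
    ∃ κ : ℤ, ∀ w, dom p G x v i w →
      S.k (x + (p:ℤ)^i * w) v = ((κ + w : ℤ) : ZMod (p^3)) ∧
      S.k (x + (p:ℤ)^i * w - 1) v + 1 = ((κ + w : ℤ) : ZMod (p^3)) := by
  have hstep : ∀ w, dom p G x v i w → S.k (x + (p:ℤ)^i * w) v = S.k (x + (p:ℤ)^i * w - 1) v + 1 := by
    intro w hw
    have hn := mg_nonneg p i
    have R := S.row (x + (p:ℤ)^i * w) v (hD _ _ _ _ hw (by omega) (by omega))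
    have P := hpre _ v hw (by simp) hv hv'
    revert R P
    cases S.ty (x + (p:ℤ)^i * w) v <;> simp [rowFact]
    · tauto
    · tauto
    · tauto
  have hseg : ∀ w, dom p G x v i w → S.k (x + (p:ℤ)^i * w - 1) v = S.k (x + (p:ℤ)^i * (w-1)) v := by
    intro w hw
    have := k_seg S hD hp hlow (w := w-1) hv (by
      rw [sub_add_cancel]; exact hD _ _ _ _ hw (by omega) le_rfl)
    rwa [sub_add_cancel] at this
  obtain ⟨κ, hκ⟩ := affine_of_step (fun w => S.k (x + (p:ℤ)^i * w) v) (dom p G x v i) (by positivity)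
    (fun w w' => dom_down hD x v i w w') (fun w hw => by rw [hstep w hw, hseg w hw])
  exact ⟨κ, fun w hw => ⟨hκ w hw, by rw [← hstep w hw]; exact hκ w hw⟩⟩

/-- low element of a residue class in a down-closed set -/
theorem low_class (a c m : ℤ) (hm : 0 < m) : ∃ w ≤ a, m ∣ w - c := by
  refine ⟨c + m * (-(|a| + |c|)), ?_, ⟨-(|a|+|c|), by ring⟩⟩
  have h1 := neg_abs_le a
  have h2 := le_abs_self c
  have h3 := abs_nonneg a
  have h4 := abs_nonneg c
  nlinarith

/-- affine with p-divisible constant -/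
theorem k_affine' (hD : DownC G) {x y : ℤ} {i : ℕ} (hp : 2 ≤ p)
    (hlow : ∀ j < i, exR S.swap y x j) (hpre : preR S x y i) {v : ℤ} (hv : (p:ℤ)^i ∣ v - y)
    (hv' : ¬ (p:ℤ)^(i+1) ∣ v - y)
    (hz : ∀ u, G (u + mg p i) (v + mg p i) → (p:ℤ)^i ∣ u - x → ¬ (p:ℤ)^(i+1) ∣ u - x →
      S.ty u v = .zero) :
    ∃ γ : ℤ, ∀ w, dom p G x v i w →
      S.k (x + (p:ℤ)^i * w) v = ((p * γ + w : ℤ) : ZMod (p^3)) ∧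
      S.k (x + (p:ℤ)^i * w - 1) v + 1 = ((p * γ + w : ℤ) : ZMod (p^3)) := by
  obtain ⟨κ, hκ⟩ := k_affine S hD hp hlow hpre hv hv'
  by_cases hne : ∃ w0, dom p G x v i w0
  · obtain ⟨w0, h0⟩ := hne
    obtain ⟨w, hw, hc⟩ := low_class w0 (-κ) p (by omega)
    rw [sub_neg_eq_add, add_comm] at hc
    have hdw := dom_down hD x v i w0 w h0 hw
    have hn := mg_nonneg p i
    have R := S.row (x + (p:ℤ)^i * w) v (hD _ _ _ _ hdw (by omega) (by omega))
    have : (p:ℤ) ∣ w := by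
      by_contra hpw
      rw [hz _ hdw (by simp) (by
        rw [add_sub_cancel_left, pow_succ, mul_dvd_mul_iff_left (by positivity)]; exact hpw)] at R
      apply R.1
      rw [(hκ w hdw).2, dv1_cast hp]; exact hc
    obtain ⟨γ, hγ⟩ : (p:ℤ) ∣ κ := (Int.dvd_add_left this).1 hc
    exact ⟨γ, fun w hw => by rw [← hγ]; exact hκ w hw⟩
  · exact ⟨0, fun w hw => (hne ⟨w, hw⟩).elim⟩

theorem swap_ty_zero {u v : ℤ} : S.swap.ty v u = .zero ↔ S.ty u v = .zero := by
  simp only [FS.swap]; cases S.ty u v <;> simp [Ty.swap]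

theorem zero_of_pre {x y : ℤ} {i : ℕ} (hpre : preR S x y i) (hpreC : preR S.swap y x i)
    {u v : ℤ} (hG : G (u + mg p i) (v + mg p i)) (h1 : (p:ℤ)^i ∣ u - x) (h2 : (p:ℤ)^i ∣ v - y)
    (h1' : ¬ (p:ℤ)^(i+1) ∣ u - x) (h2' : ¬ (p:ℤ)^(i+1) ∣ v - y) : S.ty u v = .zero := by
  have a := hpre u v hG h1 h2 h2'
  have b := hpreC v u hG h2 h1 h1'
  revert a b
  simp only [FS.swap]
  cases S.ty u v <;> simp [Ty.swap]

theorem goR_of_pre (hD : DownC G) {x y : ℤ} {i : ℕ} (hp : 2 ≤ p)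
    (hlow : ∀ j < i, exR S.swap y x j) (hpre : preR S x y i) (hpreC : preR S.swap y x i) :
    goR S x y i := by
  intro u v hG h1 h2 h2'
  refine ⟨fun h1' => zero_of_pre S hpre hpreC hG h1 h2 h1' h2', fun h1' => ?_⟩
  obtain ⟨γ, hγ⟩ := k_affine' S hD hp hlow hpre h2 h2'
    (fun u hG h1 h1' => zero_of_pre S hpre hpreC hG h1 h2 h1' h2')
  obtain ⟨w, hw⟩ := h1'
  have e : u = x + (p:ℤ)^i * (p * w) := by rw [pow_succ, mul_assoc] at hw; linarith
  have hd : dom p G x v i (p * w) := by unfold dom; rw [← e]; exact hG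
  have K := (hγ _ hd).2
  have hn := mg_nonneg p i
  have R := S.row u v (hD _ _ _ _ hG (by omega) (by omega))
  have P := hpre u v hG h1 h2 h2'
  rw [← e] at K
  have : dv1 p (S.k (u-1) v + 1) := by
    rw [K, dv1_cast hp]; exact ⟨γ + w, by ring⟩
  revert R P
  cases S.ty u v <;> simp [rowFact, this]

end


section
variable {p : ℕ} {G : ℤ → ℤ → Prop} (S : FS p G)

theorem goR.pre {S : FS p G} {x y : ℤ} {i : ℕ} (h : goR S x y i) : preR S x y i := by
  intro u v hG h1 h2 h2'
  obtain ⟨a, b⟩ := h u v hG h1 h2 h2'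
  by_cases h3 : (p:ℤ)^(i+1) ∣ u - x
  · rcases b h3 with h | h <;> simp [h]
  · simp [a h3]

theorem low_exact (hp : 2 ≤ p) (x a : ℤ) (i : ℕ) :
    ∃ u ≤ a, (p:ℤ)^i ∣ u - x ∧ ¬ (p:ℤ)^(i+1) ∣ u - x := by
  obtain ⟨u, hu, hd⟩ := low_class a (x + (p:ℤ)^i) ((p:ℤ)^(i+1)) (by positivity)
  have h1 : (p:ℤ)^i ∣ u - (x + (p:ℤ)^i) := (pow_dvd_pow _ (by omega)).trans hd
  refine ⟨u, hu, ?_, ?_⟩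
  · have := dvd_add h1 (dvd_refl ((p:ℤ)^i))
    rwa [show u - (x + (p:ℤ)^i) + (p:ℤ)^i = u - x by ring] at this
  · intro h2
    have h3 := dvd_sub h2 hd
    rw [show u - x - (u - (x + (p:ℤ)^i)) = (p:ℤ)^i * 1 by ring, pow_succ,
      mul_dvd_mul_iff_left (by positivity)] at h3
    have := Int.le_of_dvd one_pos h3
    omega

theorem cross_eq (hD : DownC G) {x y : ℤ} {i : ℕ} (hp : 2 ≤ p) (hgo : goR S x y i)
    {u v u0 v0 : ℤ} (hr : G (u0 + mg p i) (v + mg p i)) (hc : G (u + mg p i) (v0 + mg p i))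
    (h1 : (p:ℤ)^i ∣ u - x) (h1' : ¬ (p:ℤ)^(i+1) ∣ u - x)
    (h2 : (p:ℤ)^i ∣ v - y) (h2' : ¬ (p:ℤ)^(i+1) ∣ v - y) : S.lam v = S.mu u := by
  obtain ⟨u2, hu2, a1, a2⟩ := low_exact hp x u0 i
  obtain ⟨v2, hv2, b1, b2⟩ := low_exact hp y (min v v0) i
  have hn := mg_nonneg p i
  have hv2' : v2 ≤ v := hv2.trans (min_le_left _ _)
  have hv2'' : v2 ≤ v0 := hv2.trans (min_le_right _ _)
  have z : ∀ u v, G (u + mg p i) (v + mg p i) → (p:ℤ)^i ∣ u - x → ¬ (p:ℤ)^(i+1) ∣ u - x →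
      (p:ℤ)^i ∣ v - y → ¬ (p:ℤ)^(i+1) ∣ v - y → S.lam v = S.mu u := by
    intro u v hG h1 h1' h2 h2'
    have t := (hgo u v hG h1 h2 h2').1 h1'
    have R := S.row u v (hD _ _ _ _ hG (by omega) (by omega))
    rw [t] at R
    exact R.2.1
  rw [z u2 v (hD _ _ _ _ hr (by omega) (by omega)) a1 a2 h2 h2',
    ← z u2 v2 (hD _ _ _ _ hr (by omega) (by omega)) a1 a2 b1 b2,
    z u v2 (hD _ _ _ _ hc (by omega) (by omega)) h1 h1' b1 b2]

theorem lam_eq (hD : DownC G) {x y : ℤ} {i : ℕ} (hp : 2 ≤ p) (hgo : goR S x y i)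
    {v v' u0 u0' : ℤ} (hr : G (u0 + mg p i) (v + mg p i)) (hr' : G (u0' + mg p i) (v' + mg p i))
    (h1 : (p:ℤ)^i ∣ v' - y) (h1' : ¬ (p:ℤ)^(i+1) ∣ v' - y)
    (h2 : (p:ℤ)^i ∣ v - y) (h2' : ¬ (p:ℤ)^(i+1) ∣ v - y) : S.lam v = S.lam v' := by
  obtain ⟨u2, hu2, a1, a2⟩ := low_exact hp x u0 i
  have hc : G (u2 + mg p i) (v + mg p i) := hD _ _ _ _ hr (by omega) (by omega)
  rw [cross_eq S hD hp hgo hr hc a1 a2 h2 h2', cross_eq S hD hp hgo hr' hc a1 a2 h1 h1']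

theorem refine_x (hD : DownC G) {x y : ℤ} {i : ℕ} (hp : 2 ≤ p)
    (hlow : ∀ j < i, exR S.swap y x j) (hgo : goR S x y i) :
    ∃ x', (p:ℤ)^(i+1) ∣ x - x' ∧ exR S x' y i := by
  have hp0 : (0:ℤ) < p := by omega
  have hn := mg_nonneg p i
  have hγ : ∀ v, (p:ℤ)^i ∣ v - y → ¬ (p:ℤ)^(i+1) ∣ v - y → ∃ γ : ℤ, ∀ w, dom p G x v i w →
      S.k (x + (p:ℤ)^i * w - 1) v + 1 = ((p * γ + w : ℤ) : ZMod (p^3)) := by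
    intro v h2 h2'
    obtain ⟨γ, h⟩ := k_affine' S hD hp hlow hgo.pre h2 h2'
      (fun u hG h1 h1' => (hgo u v hG h1 h2 h2').1 h1')
    exact ⟨γ, fun w hw => (h w hw).2⟩
  choose! γ hγ using hγ
  -- classification at holes
  have hole : ∀ v j, (p:ℤ)^i ∣ v - y → ¬ (p:ℤ)^(i+1) ∣ v - y → dom p G x v i (p * j) →
      S.k (x + (p:ℤ)^i * (p * j) - 1) v + 1 = ((p * (γ v + j) : ℤ) : ZMod (p^3)) ∧
      (¬ (p:ℤ) ∣ γ v + j → S.ty (x + (p:ℤ)^i * (p * j)) v = .pos1) ∧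
      ((p:ℤ) ∣ γ v + j → S.ty (x + (p:ℤ)^i * (p * j)) v = .pos2) := by
    intro v j h2 h2' hd
    have K : S.k (x + (p:ℤ)^i * (p * j) - 1) v + 1 = ((p * (γ v + j) : ℤ) : ZMod (p^3)) := by
      rw [hγ v h2 h2' _ hd]; congr 1; ring
    have T := (hgo _ v hd (by simp) h2 h2').2 (by
      rw [add_sub_cancel_left, pow_succ]; exact ⟨j, by ring⟩)
    have R := S.row (x + (p:ℤ)^i * (p * j)) v (hD _ _ _ _ hd (by omega) (by omega))
    have d : dv2 p (S.k (x + (p:ℤ)^i * (p * j) - 1) v + 1) ↔ (p:ℤ) ∣ γ v + j := by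
      rw [K, dv2_cast hp, pow_two, mul_dvd_mul_iff_left hp0.ne']
    refine ⟨K, fun h => ?_, fun h => ?_⟩
    · rcases T with T | T
      · exact T
      · rw [T] at R; exact (h (d.1 R.1)).elim
    · rcases T with T | T
      · rw [T] at R; exact (R.2.1 (d.2 h)).elim
      · exact T
  have ncard : ∀ v u0 v' u0', G (u0 + mg p i) (v + mg p i) → G (u0' + mg p i) (v' + mg p i) →
      (p:ℤ)^i ∣ v - y → ¬ (p:ℤ)^(i+1) ∣ v - y → (p:ℤ)^i ∣ v' - y → ¬ (p:ℤ)^(i+1) ∣ v' - y →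
      (p:ℤ) ∣ γ v - γ v' := by
    intro v u0 v' u0' hg hg' h2 h2' h3 h3'
    by_contra hne
    obtain ⟨j, hj, hjc⟩ := low_class (min 0 (min (u0 - x) (u0' - x))) (p - γ v') ((p:ℤ)^2) (by positivity)
    have hle : x + (p:ℤ)^i * (p * j) ≤ x + min 0 (min (u0 - x) (u0' - x)) := by
      have h0 : j ≤ 0 := hj.trans (min_le_left _ _)
      have : (1:ℤ) ≤ (p:ℤ)^i * p := by
        have : (0:ℤ) < (p:ℤ)^i * p := by positivity
        omega
      nlinarith
    have hd : dom p G x v i (p * j) := by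
      apply hD _ _ _ _ hg _ le_rfl
      have := min_le_right 0 (min (u0 - x) (u0' - x))
      have := min_le_left (u0 - x) (u0' - x)
      omega
    have hd' : dom p G x v' i (p * j) := by
      apply hD _ _ _ _ hg' _ le_rfl
      have := min_le_right 0 (min (u0 - x) (u0' - x))
      have := min_le_right (u0 - x) (u0' - x)
      omega
    obtain ⟨c, hc⟩ := hjc
    have e1 : γ v' + j = p * (1 + p * c) := by linear_combination hc
    have T' := (hole v' j h3 h3' hd').2.2 ⟨_, e1⟩
    have T := (hole v j h2 h2' hd).2.1 (by
      intro h
      apply hne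
      have := dvd_sub h (Dvd.intro _ e1.symm)
      rwa [show γ v + j - (γ v' + j) = γ v - γ v' by ring] at this)
    have R := S.row (x + (p:ℤ)^i * (p * j)) v (hD _ _ _ _ hd (by omega) (by omega))
    have R' := S.row (x + (p:ℤ)^i * (p * j)) v' (hD _ _ _ _ hd' (by omega) (by omega))
    rw [T] at R; rw [T'] at R'
    have l' := R'.2.1 (by
      rw [(hole v' j h3 h3' hd').1, e1, Ne, ZMod.intCast_zmod_eq_zero_iff_dvd]
      rintro ⟨m, hm⟩
      have : (p:ℤ)^2 * (1 + p * c) = (p:ℤ)^2 * (p * m) := by push_cast at hm; linear_combination hm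
      have := mul_left_cancel₀ (by positivity) this
      have : (p:ℤ) ∣ 1 := ⟨m - c, by linear_combination this⟩
      have := Int.le_of_dvd one_pos this
      omega)
    exact R.2.2.1 ((lam_eq S hD hp hgo hg hg' h3 h3' h2 h2').trans l')
  obtain ⟨g, hg⟩ : ∃ g, ∀ v u0, G (u0 + mg p i) (v + mg p i) → (p:ℤ)^i ∣ v - y →
      ¬ (p:ℤ)^(i+1) ∣ v - y → (p:ℤ) ∣ γ v - g := by
    by_cases hne : ∃ v u0, G (u0 + mg p i) (v + mg p i) ∧ (p:ℤ)^i ∣ v - y ∧ ¬ (p:ℤ)^(i+1) ∣ v - y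
    · obtain ⟨v', u0', a, b, c⟩ := hne
      exact ⟨γ v', fun v u0 h1 h2 h3 => ncard v u0 v' u0' h1 a h2 h3 b c⟩
    · exact ⟨0, fun v u0 h1 h2 h3 => (hne ⟨v, u0, h1, h2, h3⟩).elim⟩
  have hxx : (p:ℤ)^(i+1) ∣ x - (x - (p:ℤ)^(i+1) * g) := ⟨g, by ring⟩
  refine ⟨x - (p:ℤ)^(i+1) * g, hxx, ?_⟩
  intro u v hG h1 h2 h2'
  have G1 := goR_congr (n := i+1) le_rfl hxx (show (p:ℤ)^(i+1) ∣ y - y by simp) hgo u v hG h1 h2 h2'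
  have key : (p:ℤ)^(i+1) ∣ u - (x - (p:ℤ)^(i+1) * g) → ∃ j, u = x + (p:ℤ)^i * (p * j) ∧
      ((p:ℤ)^(i+2) ∣ u - (x - (p:ℤ)^(i+1) * g) ↔ (p:ℤ) ∣ γ v + j) := by
    rintro ⟨c, hc⟩
    refine ⟨c - g, by rw [pow_succ] at hc; linear_combination hc, ?_⟩
    rw [hc, show i + 2 = (i+1) + 1 by ring, pow_succ _ (i+1), mul_dvd_mul_iff_left (by positivity)]
    rw [show γ v + (c - g) = c + (γ v - g) by ring]
    exact (Int.dvd_add_left (hg v u hG h2 h2')).symm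
  refine ⟨G1.1, fun h3 h4 => ?_, fun h4 => ?_⟩
  · obtain ⟨j, rfl, hj⟩ := key h3
    exact (hole v j h2 h2' hG).2.1 (fun h => h4 (hj.2 h))
  · have h3 := (pow_dvd_pow (p:ℤ) (show i+1 ≤ i+2 by omega)).trans h4
    obtain ⟨j, rfl, hj⟩ := key h3
    exact (hole v j h2 h2' hG).2.2 (hj.1 h4)

/-- rows of exact level i+1 see no neg -/
theorem pre_succ (hD : DownC G) {x y : ℤ} {i : ℕ} (hp : 2 ≤ p)
    (hlow : ∀ j < i+1, exR S.swap y x j) : preR S x y (i+1) := by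
  intro u v hG h1 h2 h2'
  obtain ⟨w, hw⟩ := h1
  have hq : (0:ℤ) < (p:ℤ)^i := by positivity
  have hn := mg_nonneg p i
  have hi2 : (p:ℤ)^i ∣ v - y := (pow_dvd_pow _ (by omega)).trans h2
  have hm : mg p (i+1) = mg p i + (p:ℤ)^i := rfl
  have eu : u = x + (p:ℤ)^i * (p * w) := by rw [pow_succ] at hw; linear_combination hw
  -- r seg at index W
  have seg : ∀ W : ℤ, W ≤ p * w + 1 → S.r (x + (p:ℤ)^i * W - 1) v = S.r (x + (p:ℤ)^i * (W-1)) v := by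
    intro W hW
    have := r_seg S hD hp (fun j hj => hlow j (by omega)) (w := W-1) h2 (by
      rw [sub_add_cancel]
      apply hD _ _ _ _ hG _ (by omega)
      nlinarith)
    rwa [sub_add_cancel] at this
  have n1 : ∀ W : ℤ, W ≤ p * w + 1 → ¬ (p:ℤ) ∣ W →
      S.r (x + (p:ℤ)^i * W) v = S.r (x + (p:ℤ)^i * (W-1)) v + 1 := by
    intro W hW hpW
    have g : G (x + (p:ℤ)^i * W + mg p i) (v + mg p i) := by
      apply hD _ _ _ _ hG _ (by omega)
      nlinarith
    have T := (exC_neg (hlow i (by omega)) g (by simp) (by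
      rw [add_sub_cancel_left, pow_succ, mul_dvd_mul_iff_left hq.ne']; exact hpW) h2).1 h2'
    have R := S.row (x + (p:ℤ)^i * W) v (hD _ _ _ _ g (by omega) (by omega))
    rw [T] at R
    rw [R.2.2, seg W hW]
  have cnt : ∀ s : ℕ, s < p → S.r (x + (p:ℤ)^i * (p * (w-1) + s)) v = S.r (x + (p:ℤ)^i * (p * (w-1))) v + s := by
    intro s
    induction s with
    | zero => simp
    | succ s ih =>
      intro hs
      rw [n1 _ (by push_cast; nlinarith) (by
        rw [Int.dvd_add_right (Dvd.intro _ rfl)]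
        intro h; have := Int.le_of_dvd (by positivity) h; push_cast at this; omega)]
      rw [show ((p:ℤ) * (w-1) + ((s+1:ℕ):ℤ) - 1) = p * (w-1) + s by push_cast; ring, ih (by omega)]
      omega
  have last := cnt (p-1) (by omega)
  have b1 := S.hr (x + (p:ℤ)^i * (p * (w-1) + (p-1:ℕ))) v
  have before : S.r (u - 1) v = p - 1 := by
    rw [eu, seg _ (by omega), show ((p:ℤ) * w - 1) = p * (w-1) + (p-1:ℕ) by
      rw [Nat.cast_sub (by omega)]; push_cast; ring]
    omega
  have R := S.row u v (hD _ _ _ _ hG (by omega) (by omega))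
  have b2 := S.hr u v
  constructor
  · intro h
    rw [h] at R
    have := R.2.2
    omega
  · intro h
    rw [h] at R
    have h3 := R.2
    have h4 := n1 (p * w + 1) le_rfl (by
      rw [Int.dvd_add_right (Dvd.intro _ rfl)]
      intro h; have := Int.le_of_dvd (by positivity) h; omega)
    rw [add_sub_cancel_right, ← eu] at h4
    have b3 := S.hr (x + (p:ℤ)^i * (p * w + 1)) v
    omega

theorem pre_zero {x y : ℤ} (hy : (p:ℤ) ∣ y - S.y0) : preR S x y 0 := by
  intro u v hG h1 h2 h2'
  have hG' : G u v := by simpa [mg] using hG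
  have := S.zrow u v hG'
  rw [zero_add, pow_one, dvd_shift hy] at h2'
  constructor <;> intro h <;> exact h2' (this (by simp [h]))

theorem DownC.swap (hD : DownC G) : DownC (fun u v => G v u) :=
  fun _ _ _ _ h a b => hD _ _ _ _ h b a

theorem exR.ss {S : FS p G} {x y : ℤ} {i : ℕ} (h : exR S x y i) : exR S.swap.swap x y i := by
  have e : ∀ u v, S.swap.swap.ty u v = S.ty u v := by
    intro u v; simp only [FS.swap]; cases S.ty u v <;> rfl
  intro u v
  rw [e]; exact h u v

theorem preR.ss {S : FS p G} {x y : ℤ} {i : ℕ} (h : preR S x y i) : preR S.swap.swap x y i := by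
  have e : ∀ u v, S.swap.swap.ty u v = S.ty u v := by
    intro u v; simp only [FS.swap]; cases S.ty u v <;> rfl
  intro u v
  rw [e]; exact h u v

/-- The forced lemma. -/
theorem forced (hD : DownC G) (hp : 2 ≤ p) (n : ℕ) :
    ∃ x y : ℤ, ((p:ℤ) ∣ x - S.x0 ∧ (p:ℤ) ∣ y - S.y0) ∧
      ∀ i < n, exR S x y i ∧ exR S.swap y x i := by
  induction n with
  | zero => exact ⟨S.x0, S.y0, by simp, by simp⟩
  | succ n ih =>
    obtain ⟨x, y, ⟨hx, hy⟩, ih⟩ := ih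
    have pR : preR S x y n := by
      cases n with
      | zero => exact pre_zero S hy
      | succ n => exact pre_succ S hD hp (fun j hj => (ih j hj).2)
    have pC : preR S.swap y x n := by
      cases n with
      | zero => exact pre_zero S.swap hx
      | succ n => exact pre_succ S.swap hD.swap hp (fun j hj => (ih j hj).1.ss)
    have gR := goR_of_pre S hD hp (fun j hj => (ih j hj).2) pR pC
    have gC := goR_of_pre S.swap hD.swap hp (fun j hj => (ih j hj).1.ss) pC pR.ss
    obtain ⟨x', hx', eR⟩ := refine_x S hD hp (fun j hj => (ih j hj).2) gR
    obtain ⟨y', hy', eC⟩ := refine_x S.swap hD.swap hp (fun j hj => (ih j hj).1.ss) gC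
    have sub : ∀ {a b c : ℤ}, (p:ℤ)^(n+1) ∣ a - b → (p:ℤ) ∣ a - c → (p:ℤ) ∣ b - c := by
      intro a b c h1 h2
      have := dvd_sub h2 ((dvd_pow_self (p:ℤ) (Nat.succ_ne_zero n)).trans h1)
      rwa [show a - c - (a - b) = b - c by ring] at this
    refine ⟨x', y', ⟨sub hx' hx, sub hy' hy⟩, fun i hi => ?_⟩
    rcases Nat.lt_succ_iff_lt_or_eq.1 hi with h | rfl
    · exact ⟨exR_congr (n := n+1) (by omega) hx' hy' (ih i h).1,
        exR_congr (n := n+1) (by omega) hy' hx' (ih i h).2⟩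
    · have c1 : ∀ {S : FS p G}, exR S x' y i → exR S x' y' i := by
        intro S h u v hG
        have H := h u v hG
        rwa [dvd_shift ((pow_dvd_pow (p:ℤ) (show i ≤ i+1 by omega)).trans hy'), dvd_shift hy'] at H
      have c2 : exR S.swap y' x i → exR S.swap y' x' i := by
        intro h u v hG
        have H := h u v hG
        rwa [dvd_shift ((pow_dvd_pow (p:ℤ) (show i ≤ i+1 by omega)).trans hx'), dvd_shift hx'] at H
      exact ⟨c1 eR, c2 eC⟩


theorem pin (hD : DownC G) (hp : 2 ≤ p) {x y : ℤ} {i : ℕ}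
    (hex : ∀ j ≤ i + 3, exR S x y j ∧ exR S.swap y x j) {v : ℤ}
    (h2 : (p:ℤ)^i ∣ v - y) (h2' : ¬ (p:ℤ)^(i+1) ∣ v - y) (w : ℤ) (hw : dom p G x v i w) :
    S.k (x + (p:ℤ)^i * w) v = (w : ZMod (p^3)) ∧
      S.k (x + (p:ℤ)^i * w - 1) v + 1 = (w : ZMod (p^3)) := by
  have hp0 : (0:ℤ) < p := by omega
  have hq : (0:ℤ) < (p:ℤ)^i := by positivity
  have hn := mg_nonneg p i
  have go : ∀ j ≤ i+3, goR S x y j := fun j hj => (hex j hj).1.go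
  have hgo := go i (by omega)
  obtain ⟨γ, hγ⟩ := k_affine' S hD hp (fun j hj => (hex j (by omega)).2) hgo.pre h2 h2'
      (fun u hG h1 h1' => (hgo u v hG h1 h2 h2').1 h1')
  have hm : ∀ j ≤ i+3, mg p j ≤ mg p (i+3) := fun j hj => mg_mono p hj
  have hn3 := mg_nonneg p (i+3)
  -- low rows and columns
  obtain ⟨U, V, hUV⟩ : ∃ U V, G (U + mg p (i+3)) (V + mg p (i+3)) ∧
      U ≤ x + (p:ℤ)^i * w := ⟨x + (p:ℤ)^i * w - mg p (i+3), v - mg p (i+3), by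
        refine ⟨hD _ _ _ _ hw (by omega) (by omega), by omega⟩⟩
  obtain ⟨hUV, hUx⟩ := hUV
  have gg : ∀ j ≤ i+3, ∀ u ≤ U, ∀ v ≤ V, G (u + mg p j) (v + mg p j) := by
    intro j hj u hu v hv
    have := hm j hj
    exact hD _ _ _ _ hUV (by omega) (by omega)
  have g0 : ∀ j ≤ i+3, ∀ u ≤ U, ∀ v ≤ V, G u v := by
    intro j hj u hu v hv
    exact hD _ _ _ _ hUV (by omega) (by omega)
  choose u hu u1 u2 using fun j => low_exact hp x U j
  choose r hr r1 r2 using fun j => low_exact hp y V j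
  have ez : ∀ j ≤ i+3, S.lam (r j) = S.mu (u j) := by
    intro j hj
    have R := S.row (u j) (r j) (g0 j hj _ (hu j) _ (hr j))
    rw [((hex j hj).1 _ _ (gg j hj _ (hu j) _ (hr j)) (u1 j) (r1 j) (r2 j)).1 (u2 j)] at R
    exact R.2.1
  have en : ∀ j ≤ i+2, S.lam (r j) ≠ S.mu (u (j+1)) := by
    intro j hj
    have R := S.row (u (j+1)) (r j) (g0 j (by omega) _ (hu _) _ (hr j))
    rw [((hex j (by omega)).1 _ _ (gg j (by omega) _ (hu _) _ (hr j))
      ((pow_dvd_pow _ (by omega)).trans (u1 (j+1))) (r1 j) (r2 j)).2.1 (u1 (j+1)) (u2 (j+1))] at R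
    exact R.2.2.1
  have lv : S.lam v = S.lam (r i) :=
    lam_eq S hD hp hgo hw (gg i (by omega) _ (hu i) _ (hr i)) (r1 i) (r2 i) h2 h2'
  have ne : S.lam v ≠ S.mu (u (i+3)) := by
    have a := en i (by omega); have b := en (i+1) (by omega); have c := en (i+2) (by omega)
    have d := ez (i+1) (by omega); have e := ez (i+2) (by omega)
    rw [lv]
    revert a b c d e
    cases S.lam (r i) <;> cases S.mu (u (i+1)) <;> cases S.lam (r (i+1)) <;> cases S.mu (u (i+2)) <;>
      cases S.lam (r (i+2)) <;> simp_all
  obtain ⟨c, hc⟩ := u1 (i+3)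
  have ec : u (i+3) = x + (p:ℤ)^i * ((p:ℤ)^3 * c) := by rw [pow_add] at hc; linear_combination hc
  have hdc : dom p G x v i ((p:ℤ)^3 * c) := by
    have := hu (i+3)
    unfold dom
    rw [← ec]
    exact hD _ _ _ _ hw (by omega) le_rfl
  have T := ((hex i (by omega)).1 _ v hdc (by simp) h2 h2').2.2 (by
    rw [add_sub_cancel_left, pow_add]
    exact ⟨p * c, by ring⟩)
  have R := S.row _ v (hD _ _ _ _ hdc (show x + (p:ℤ)^i * ((p:ℤ)^3 * c) ≤ _ by omega)
    (show v ≤ _ by omega))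
  rw [T] at R
  have k0 : S.k (x + (p:ℤ)^i * ((p:ℤ)^3 * c) - 1) v + 1 = 0 := by
    by_contra h
    have := R.2.1 h
    rw [← ec] at this
    exact ne this
  rw [(hγ _ hdc).2, ZMod.intCast_zmod_eq_zero_iff_dvd] at k0
  have : ((p * γ : ℤ) : ZMod (p^3)) = 0 := by
    rw [ZMod.intCast_zmod_eq_zero_iff_dvd]
    rw [Int.dvd_add_left ⟨c, by push_cast; ring⟩] at k0
    exact k0
  have H := hγ w hw
  rw [Int.cast_add, this, zero_add] at H
  exact H

end


/-! ## Concrete wires, local rule, canonical solution -/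

structure Wire (p : ℕ) where
  k : ZMod (p^3)
  r : Fin p
  c : ZMod p
  lam : Bool

theorem Wire.finite (p : ℕ) [NeZero p] : Finite (Wire p) := by
  have : NeZero (p^3) := ⟨pow_ne_zero _ (NeZero.ne p)⟩
  let f : Wire p → ZMod (p^3) × Fin p × ZMod p × Bool := fun w => (w.k, w.r, w.c, w.lam)
  apply Finite.of_injective f
  rintro ⟨a, b, c, d⟩ ⟨a', b', c', d'⟩ h
  simp only [f, Prod.mk.injEq] at h
  obtain ⟨rfl, rfl, rfl, rfl⟩ := h
  rfl

section
variable {p : ℕ}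

def sW (w : Wire p) : Prop := w.c = 0 ∧ w.r.val ≠ p - 1
def oneW (w : Wire p) : Prop := ¬ sW w ∧ ¬ dv1 p (w.k+1)
def twoW (w : Wire p) : Prop := ¬ sW w ∧ dv1 p (w.k+1) ∧ ¬ dv2 p (w.k+1)
def thrW (w : Wire p) : Prop := ¬ sW w ∧ dv2 p (w.k+1)

/-- local conditions for the type `t` at a cell; `D = true` means `neg`. -/
def cellOK (t : Ty) (a b : Wire p) (D : Bool) : Prop :=
  match t with
  | .zero => oneW a ∧ oneW b ∧ a.lam = b.lam
  | .neg1 => sW a ∧ twoW b ∧ a.lam ≠ b.lam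
  | .neg2 => thrW b ∧ (¬ thrW a ∨ D = true) ∧ a.c = 0 ∧ (b.k + 1 ≠ 0 → a.lam = b.lam)
  | .pos1 => sW b ∧ twoW a ∧ a.lam ≠ b.lam
  | .pos2 => thrW a ∧ (¬ thrW b ∨ D = false) ∧ b.c = 0 ∧ (a.k + 1 ≠ 0 → a.lam = b.lam)

theorem dv2_dv1 {x : ZMod (p^3)} (h : dv2 p x) : dv1 p x := by
  unfold dv1 dv2 at *; rw [pow_two, mul_assoc, h, mul_zero]

theorem cellOK_unique {t t' : Ty} {a b : Wire p} {D : Bool} (h : cellOK t a b D)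
    (h' : cellOK t' a b D) : t = t' := by
  have e1 := @dv2_dv1 p (a.k+1)
  have e2 := @dv2_dv1 p (b.k+1)
  cases t <;> cases t' <;> first | rfl | (exfalso; simp only [cellOK, oneW, twoW, thrW] at h h'; cases D <;> simp at h h' <;> tauto)

def updR [NeZero p] (t : Ty) (a : Wire p) : Wire p :=
  match t with
  | .neg1 => { a with r := a.r + 1 }
  | .neg2 => a
  | _ => { a with k := a.k + 1, r := 0 }

def updD (t : Ty) (D : Bool) : Bool :=
  match t with
  | .zero => D
  | .neg1 => false
  | .neg2 => false
  | _ => true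

@[simp] theorem updR_c [NeZero p] (t : Ty) (a : Wire p) : (updR t a).c = a.c := by cases t <;> rfl
@[simp] theorem updR_lam [NeZero p] (t : Ty) (a : Wire p) : (updR t a).lam = a.lam := by cases t <;> rfl

theorem fin_succ_val [NeZero p] (hp : 2 ≤ p) {r : Fin p} (h : r.val ≠ p - 1) : (r + 1).val = r.val + 1 := by
  rw [Fin.val_add]
  have : ((1 : Fin p) : ℕ) = 1 := by
    rw [Fin.val_one']; exact Nat.mod_eq_of_lt (by omega)
  rw [this]; exact Nat.mod_eq_of_lt (by have := r.isLt; omega)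

theorem rowFact_of_cellOK [NeZero p] (hp : 2 ≤ p) {t : Ty} {a b : Wire p} {D : Bool}
    (h : cellOK t a b D) :
    rowFact p t a.k (updR t a).k a.r.val (updR t a).r.val (a.lam = b.lam) ∧
    rowFact p t.swap b.k (updR t.swap b).k b.r.val (updR t.swap b).r.val (b.lam = a.lam) := by
  cases t <;> simp only [cellOK, rowFact, Ty.swap, updR, oneW, twoW, thrW] at *
  · simp [h]
  · simp [h, fin_succ_val hp h.1.2, Ne.symm h.2.2]
  · simp only [h, true_and, and_true, Fin.val_zero]; intro h1; exact (h.2.2.2 h1).symm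
  · simp [h, fin_succ_val hp h.1.2, Ne.symm h.2.2]
  · simp only [h, true_and, and_true, Fin.val_zero]; exact h.2.2.2

/-- linear residues along a down-closed region -/
theorem lin_res {G : ℤ → ℤ → Prop} (hD : DownC G) (f : ℤ → ℤ → ZMod p)
    (h1 : ∀ u v, G u v → f u v = f u (v-1)) (h2 : ∀ u v, G u v → f (u-1) v + 1 = f u (v-1)) :
    ∃ x0 : ℤ, ∀ u v, G u v → f u v = ((u - x0 : ℤ) : ZMod p) := by
  by_cases hne : ∃ U V, G U V
  · obtain ⟨U, V, hUV⟩ := hne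
    obtain ⟨c, hc⟩ := ZMod.intCast_surjective (f U V)
    refine ⟨U - c, fun u v hG => ?_⟩
    have colc : ∀ u v v', G u v → v' ≤ v → f u v = f u v' := by
      intro u v v' hG hv
      exact seg_const (fun v => f u v) v' v hv (fun w _ hw => h1 u w (hD _ _ _ _ hG le_rfl hw))
    have rowc : ∀ u u' v, G u v → u' ≤ u → f u v - u = f u' v - u' := by
      intro u u' v hG hu
      refine seg_const (fun u => f u v - (u : ZMod p)) u' u hu (fun w _ hw => ?_)
      have g := hD _ _ _ _ hG hw le_rfl
      rw [h1 w v g, ← h2 w v g]; push_cast; ring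
    have e1 := colc u v (min v V) hG (min_le_left _ _)
    have e2 := colc U V (min v V) hUV (min_le_right _ _)
    have g1 := hD _ _ _ _ hG le_rfl (min_le_left v V)
    have g2 := hD _ _ _ _ hUV le_rfl (min_le_right v V)
    have key : f u v - u = f U V - U := by
      rw [e1, e2]
      rcases le_total u U with h | h
      · exact (rowc U u _ g2 h).symm
      · exact rowc u U _ g1 h
    push_cast
    rw [hc]; linear_combination key
  · exact ⟨0, fun u v hG => (hne ⟨u, v, hG⟩).elim⟩

/-- building the forced system -/
theorem exists_FS [NeZero p] (hp : 2 ≤ p) {G : ℤ → ℤ → Prop} (hD : DownC G)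
    (ty : ℤ → ℤ → Ty) (R C : ℤ → ℤ → Wire p) (D : ℤ → ℤ → Bool)
    (hok : ∀ u v, G u v → cellOK (ty u v) (R (u-1) v) (C u (v-1)) (D u v))
    (hR : ∀ u v, G u v → R u v = updR (ty u v) (R (u-1) v))
    (hC : ∀ u v, G u v → C u v = updR (ty u v).swap (C u (v-1)))
    (hc : ∀ u v, G u v → (C (u-1) v).c + 1 = (C u (v-1)).c)
    (hr : ∀ u v, G u v → (R u (v-1)).c + 1 = (R (u-1) v).c) :
    ∃ S : FS p G, S.ty = ty ∧ (∀ u v, S.k u v = (R u v).k) ∧ (∀ u v, S.kc u v = (C u v).k) ∧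
      (∀ u v, G u v → (C u v).c = ((u - S.x0 : ℤ) : ZMod p)) ∧
      (∀ u v, G u v → (R u v).c = ((v - S.y0 : ℤ) : ZMod p)) := by
  obtain ⟨x0, hx0⟩ := lin_res hD (fun u v => (C u v).c)
    (fun u v h => by rw [hC u v h, updR_c]) hc
  obtain ⟨y0, hy0⟩ := lin_res hD.swap (fun v u => (R u v).c)
    (fun v u h => by rw [hR u v h, updR_c]) (fun v u h => hr u v h)
  have lamE : ∃ lam : ℤ → Bool, ∀ u v, G u v → (R (u-1) v).lam = lam v := by
    classical
    refine ⟨fun v => if h : ∃ u, G u v then (R (Classical.choose h) v).lam else true, fun u v hG => ?_⟩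
    have h : ∃ u, G u v := ⟨u, hG⟩
    simp only [h, dite_true]
    have key : ∀ u u', G u v → u' ≤ u → (R u v).lam = (R u' v).lam := fun u u' hG hu =>
      seg_const (fun u => (R u v).lam) u' u hu
        (fun w _ hw => by rw [hR w v (hD _ _ _ _ hG hw le_rfl), updR_lam])
    have e1 : (R (u-1) v).lam = (R u v).lam := by rw [hR u v hG, updR_lam]
    rw [e1]
    rcases le_total u (Classical.choose h) with h' | h'
    · exact (key _ _ (Classical.choose_spec h) h').symm
    · exact key _ _ hG h'
  have muE : ∃ mu : ℤ → Bool, ∀ u v, G u v → (C u (v-1)).lam = mu u := by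
    classical
    refine ⟨fun u => if h : ∃ v, G u v then (C u (Classical.choose h)).lam else true, fun u v hG => ?_⟩
    have h : ∃ v, G u v := ⟨v, hG⟩
    simp only [h, dite_true]
    have key : ∀ v v', G u v → v' ≤ v → (C u v).lam = (C u v').lam := fun v v' hG hv =>
      seg_const (fun v => (C u v).lam) v' v hv
        (fun w _ hw => by rw [hC u w (hD _ _ _ _ hG le_rfl hw), updR_lam])
    have e1 : (C u (v-1)).lam = (C u v).lam := by rw [hC u v hG, updR_lam]
    rw [e1]
    rcases le_total v (Classical.choose h) with h' | h'
    · exact (key _ _ (Classical.choose_spec h) h').symm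
    · exact key _ _ hG h'
  obtain ⟨lam, hlam⟩ := lamE
  obtain ⟨mu, hmu⟩ := muE
  refine ⟨{ ty := ty, k := fun u v => (R u v).k, r := fun u v => (R u v).r.val,
            kc := fun u v => (C u v).k, rc := fun u v => (C u v).r.val, lam := lam, mu := mu,
            x0 := x0, y0 := y0, hr := fun u v => (R u v).r.isLt, hrc := fun u v => (C u v).r.isLt,
            row := ?_, col := ?_, zrow := ?_, zcol := ?_ }, rfl, fun _ _ => rfl, fun _ _ => rfl,
            hx0, fun u v h => hy0 v u h⟩
  · intro u v hG
    have := (rowFact_of_cellOK hp (hok u v hG)).1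
    rwa [← hR u v hG, hlam u v hG, hmu u v hG] at this
  · intro u v hG
    have := (rowFact_of_cellOK hp (hok u v hG)).2
    rwa [← hC u v hG, hlam u v hG, hmu u v hG] at this
  · intro u v hG h
    have h0 := hy0 v u hG
    rw [hR u v hG, updR_c] at h0
    have : (R (u-1) v).c = 0 := by
      have := hok u v hG
      rcases h with h | h <;> rw [h] at this
      · exact this.1.1
      · exact this.2.2.1
    rw [this] at h0
    exact (ZMod.intCast_zmod_eq_zero_iff_dvd _ _).1 h0.symm
  · intro u v hG h
    have h0 := hx0 u v hG
    rw [hC u v hG, updR_c] at h0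
    have : (C u (v-1)).c = 0 := by
      have := hok u v hG
      rcases h with h | h <;> rw [h] at this
      · exact this.1.1
      · exact this.2.2.1
    rw [this] at h0
    exact (ZMod.intCast_zmod_eq_zero_iff_dvd _ _).1 h0.symm

end


section
variable {p : ℕ} [hpf : Fact p.Prime]

def lvl (p : ℕ) (v : ℤ) : ℕ := padicValInt p v

theorem lvl_dvd {v : ℤ} (hv : v ≠ 0) (n : ℕ) : (p:ℤ)^n ∣ v ↔ n ≤ lvl p v := by
  rw [padicValInt_dvd_iff]; simp [hv, lvl]

theorem lvl_eq {v : ℤ} {n : ℕ} (h1 : (p:ℤ)^n ∣ v) (h2 : ¬ (p:ℤ)^(n+1) ∣ v) : lvl p v = n := by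
  have hv : v ≠ 0 := by rintro rfl; simp at h2
  rw [lvl_dvd hv] at h1 h2; omega

theorem ediv_sub_one_of_dvd {q u : ℤ} (hq : 0 < q) (h : q ∣ u) : (u-1)/q = u/q - 1 := by
  obtain ⟨c, rfl⟩ := h
  rw [Int.mul_ediv_cancel_left _ hq.ne']
  refine Int.ediv_eq_iff_of_pos hq |>.2 ⟨by nlinarith, by nlinarith⟩

theorem ediv_sub_one_of_not_dvd {q u : ℤ} (hq : 0 < q) (h : ¬ q ∣ u) : (u-1)/q = u/q := by
  have h1 := Int.emod_add_mul_ediv u q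
  have h2 := Int.emod_nonneg u hq.ne'
  have h3 := Int.emod_lt_of_pos u hq
  have h4 : u % q ≠ 0 := fun h' => h (Int.dvd_of_emod_eq_zero h')
  have h5 : 1 ≤ u % q := by omega
  refine Int.ediv_eq_iff_of_pos hq |>.2 ⟨by nlinarith, by nlinarith⟩

theorem ppos : (0:ℤ) < p := by exact_mod_cast hpf.out.pos

def resFin (p : ℕ) [hpf : Fact p.Prime] (n : ℤ) : Fin p :=
  ⟨(n % p).toNat, by
    have h1 := Int.emod_nonneg n (ppos (p := p)).ne'
    have h2 := Int.emod_lt_of_pos n (ppos (p := p))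
    omega⟩

/-- canonical wire of line `v` after position `u` -/
def cw (p : ℕ) [hpf : Fact p.Prime] (u v : ℤ) : Wire p where
  k := ((u / (p:ℤ)^(lvl p v) : ℤ) : ZMod (p^3))
  r := if lvl p v = 0 then ⟨0, hpf.out.pos⟩ else resFin p (u / (p:ℤ)^(lvl p v - 1))
  c := (v : ZMod p)
  lam := decide (lvl p v % 2 = 1)

def cty (a b : ℕ) : Ty :=
  if a = b then .zero else if a + 1 = b then .neg1 else if a < b then .neg2
  else if b + 1 = a then .pos1 else .pos2

theorem cty_swap (a b : ℕ) : (cty a b).swap = cty b a := by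
  unfold cty
  rcases lt_trichotomy a b with h | rfl | h
  · by_cases h1 : a + 1 = b
    · subst h1
      have : ¬ a + 1 + 1 = a := by omega
      simp [Ty.swap, this]
    · have : ¬ b + 1 = a := by omega
      have : ¬ b = a := by omega
      have : ¬ a = b := by omega
      have : ¬ b < a := by omega
      simp [*, Ty.swap]
  · simp [Ty.swap]
  · by_cases h1 : b + 1 = a
    · subst h1
      have : ¬ b + 1 + 1 = b := by omega
      simp [Ty.swap, this]
    · have : ¬ a + 1 = b := by omega
      have : ¬ b = a := by omega
      have : ¬ a = b := by omega
      have : ¬ a < b := by omega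
      simp [*, Ty.swap]

theorem hqpos (n : ℕ) : (0:ℤ) < (p:ℤ)^n := pow_pos ppos n

theorem cw_c {u v : ℤ} (hv : v ≠ 0) : (cw p u v).c = 0 ↔ lvl p v ≠ 0 := by
  simp only [cw]
  rw [ZMod.intCast_zmod_eq_zero_iff_dvd]
  have := lvl_dvd (p := p) hv 1
  rw [pow_one] at this
  rw [this]; omega

theorem emod_sub_one {q n : ℤ} (hq : 1 < q) (h : n % q ≠ 0) : (n-1) % q = n % q - 1 := by
  have h2 := Int.emod_nonneg n (show q ≠ 0 by omega)
  have h3 := Int.emod_lt_of_pos n (show 0 < q by omega)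
  rw [Int.sub_emod, Int.emod_eq_of_lt (a := 1) (by omega) hq]
  exact Int.emod_eq_of_lt (by omega) (by omega)

theorem emod_sub_one' {q n : ℤ} (hq : 1 < q) (h : n % q = 0) : (n-1) % q = q - 1 := by
  rw [Int.sub_emod, h, Int.emod_eq_of_lt (a := 1) (by omega) hq, zero_sub]
  rw [← Int.add_emod_right, Int.emod_eq_of_lt] <;> omega

theorem one_lt_p : (1:ℤ) < p := by exact_mod_cast hpf.out.one_lt

theorem ediv_emod_ne {u : ℤ} {n : ℕ} (h1 : (p:ℤ)^n ∣ u) : (u / (p:ℤ)^n) % p = 0 ↔ (p:ℤ)^(n+1) ∣ u := by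
  obtain ⟨c, rfl⟩ := h1
  rw [Int.mul_ediv_cancel_left _ (hqpos n).ne', ← Int.dvd_iff_emod_eq_zero, pow_succ,
    mul_dvd_mul_iff_left (hqpos n).ne']

/-- row facts below the level -/
theorem cw_lt {u v : ℤ} (hu : u ≠ 0) (h : lvl p u + 1 < lvl p v) : cw p (u-1) v = cw p u v := by
  have n0 : lvl p v ≠ 0 := by omega
  unfold cw
  rw [ediv_sub_one_of_not_dvd (hqpos _) (by rw [lvl_dvd hu]; omega),
    ediv_sub_one_of_not_dvd (hqpos _) (by rw [lvl_dvd hu]; omega)]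

theorem cw_eq1 {u v : ℤ} (hu : u ≠ 0) (h : lvl p u + 1 = lvl p v) :
    sW (cw p (u-1) v) ∧ cw p u v = updR .neg1 (cw p (u-1) v) := by
  have n0 : lvl p v ≠ 0 := by omega
  have hv : v ≠ 0 := by rintro rfl; simp [lvl] at n0
  have e : lvl p v - 1 = lvl p u := by omega
  have d : (p:ℤ)^(lvl p u) ∣ u := (lvl_dvd hu _).2 le_rfl
  have m : (u / (p:ℤ)^(lvl p u)) % p ≠ 0 := by
    rw [Ne, ediv_emod_ne d, lvl_dvd hu]; omega
  have h2 := Int.emod_nonneg (u / (p:ℤ)^(lvl p u)) (ppos (p := p)).ne'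
  have h3 := Int.emod_lt_of_pos (u / (p:ℤ)^(lvl p u)) (ppos (p := p))
  have r1 : (cw p (u-1) v).r.val = ((u / (p:ℤ)^(lvl p u)) % p - 1).toNat := by
    simp only [cw, n0, if_false, e, resFin]
    rw [ediv_sub_one_of_dvd (hqpos _) d, emod_sub_one one_lt_p m]
  have r2 : (cw p u v).r.val = ((u / (p:ℤ)^(lvl p u)) % p).toNat := by
    simp only [cw, n0, if_false, e, resFin]
  have s : (cw p (u-1) v).r.val ≠ p - 1 := by rw [r1]; omega
  refine ⟨⟨(cw_c hv).2 n0, s⟩, ?_⟩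
  have r3 : (cw p u v).r = (cw p (u-1) v).r + 1 := by
    apply Fin.ext
    rw [fin_succ_val hpf.out.two_le s, r1, r2]; omega
  have k3 : (cw p u v).k = (cw p (u-1) v).k := by
    simp only [cw]
    rw [ediv_sub_one_of_not_dvd (hqpos _) (by rw [lvl_dvd hu]; omega)]
  unfold updR
  calc cw p u v = ⟨(cw p u v).k, (cw p u v).r, (cw p u v).c, (cw p u v).lam⟩ := rfl
    _ = _ := by rw [r3, k3]; rfl

theorem cw_ge {u v : ℤ} (hu : u ≠ 0) (hv0 : v ≠ 0) (h : lvl p v ≤ lvl p u) :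
    ¬ sW (cw p (u-1) v) ∧ cw p u v = updR .zero (cw p (u-1) v) ∧
    (dv1 p ((cw p (u-1) v).k + 1) ↔ lvl p v + 1 ≤ lvl p u) ∧
    (dv2 p ((cw p (u-1) v).k + 1) ↔ lvl p v + 2 ≤ lvl p u) ∧
    ((cw p (u-1) v).k + 1 = 0 ↔ lvl p v + 3 ≤ lvl p u) ∧
    (cw p (u-1) v).k + 1 = ((u / (p:ℤ)^(lvl p v) : ℤ) : ZMod (p^3)) := by
  have d : (p:ℤ)^(lvl p v) ∣ u := (lvl_dvd hu _).2 h
  have k1 : (cw p (u-1) v).k + 1 = ((u / (p:ℤ)^(lvl p v) : ℤ) : ZMod (p^3)) := by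
    simp only [cw]
    rw [ediv_sub_one_of_dvd (hqpos _) d]; push_cast; ring
  have key : ∀ n : ℕ, (p:ℤ)^n ∣ u / (p:ℤ)^(lvl p v) ↔ lvl p v + n ≤ lvl p u := by
    intro n
    rw [← lvl_dvd hu, pow_add]
    exact Int.dvd_div_iff_mul_dvd d
  refine ⟨?_, ?_, ?_, ?_, ?_, k1⟩
  · rintro ⟨hc, hr⟩
    have n0 := (cw_c hv0).1 hc
    apply hr
    have d' : (p:ℤ)^(lvl p v - 1) ∣ u := (pow_dvd_pow _ (by omega)).trans d
    simp only [cw, n0, if_false, resFin]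
    rw [ediv_sub_one_of_dvd (hqpos _) d', emod_sub_one' one_lt_p ((ediv_emod_ne d').2 (by
      rw [show lvl p v - 1 + 1 = lvl p v by omega]; exact d))]
    have := one_lt_p (p := p)
    omega
  · have k3 : (cw p u v).k = (cw p (u-1) v).k + 1 := by rw [k1]; rfl
    have r3 : (cw p u v).r = 0 := by
      apply Fin.ext
      simp only [cw]
      split_ifs with n0
      · simp
      · have d' : (p:ℤ)^(lvl p v - 1) ∣ u := (pow_dvd_pow _ (by omega)).trans d
        simp only [resFin]
        rw [((ediv_emod_ne d').2 (by
          rw [show lvl p v - 1 + 1 = lvl p v by omega]; exact d))]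
        simp
    unfold updR
    calc cw p u v = ⟨(cw p u v).k, (cw p u v).r, (cw p u v).c, (cw p u v).lam⟩ := rfl
      _ = _ := by rw [r3, k3]; rfl
  · rw [k1, dv1_cast hpf.out.two_le, ← key 1, pow_one]
  · rw [k1, dv2_cast hpf.out.two_le, ← key 2]
  · rw [k1, ZMod.intCast_zmod_eq_zero_iff_dvd, ← key 3]; push_cast; rfl

/-- canonical diagonal bit (true = neg) -/
def cD (p : ℕ) (u v : ℤ) : Bool :=
  decide ((u / (p:ℤ)^(lvl p (u-v))) % p < ((u-v) / (p:ℤ)^(lvl p (u-v))) % p)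

theorem cD_lt {u v : ℤ} (hu : u ≠ 0) (hv : v ≠ 0) (h : lvl p u < lvl p v) :
    cD p (u-1) (v-1) = true ∧ cD p u v = false := by
  have du : (p:ℤ)^(lvl p u) ∣ u := (lvl_dvd hu _).2 le_rfl
  have du' : ¬ (p:ℤ)^(lvl p u + 1) ∣ u := by rw [lvl_dvd hu]; omega
  have dv' : (p:ℤ)^(lvl p u + 1) ∣ v := (lvl_dvd hv _).2 h
  have dv : (p:ℤ)^(lvl p u) ∣ v := (lvl_dvd hv _).2 h.le
  have e : lvl p (u-v) = lvl p u := lvl_eq (dvd_sub du dv) (by rwa [dvd_sub_left dv'])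
  have m : (u / (p:ℤ)^(lvl p u)) % p ≠ 0 := by rwa [Ne, ediv_emod_ne du]
  have m2 : (v / (p:ℤ)^(lvl p u)) % p = 0 := by rwa [ediv_emod_ne dv]
  have q : ((u-v) / (p:ℤ)^(lvl p u)) % p = (u / (p:ℤ)^(lvl p u)) % p := by
    rw [Int.sub_ediv_of_dvd _ dv, Int.sub_emod, m2, sub_zero, Int.emod_emod]
  unfold cD
  rw [show u - 1 - (v-1) = u - v by ring, e, q]
  constructor
  · rw [ediv_sub_one_of_dvd (hqpos _) du, emod_sub_one one_lt_p m]; simp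
  · simp

theorem cD_gt {u v : ℤ} (hu : u ≠ 0) (hv : v ≠ 0) (h : lvl p v < lvl p u) :
    cD p (u-1) (v-1) = false ∧ cD p u v = true := by
  have dv : (p:ℤ)^(lvl p v) ∣ v := (lvl_dvd hv _).2 le_rfl
  have dv' : ¬ (p:ℤ)^(lvl p v + 1) ∣ v := by rw [lvl_dvd hv]; omega
  have du' : (p:ℤ)^(lvl p v + 1) ∣ u := (lvl_dvd hu _).2 h
  have du : (p:ℤ)^(lvl p v) ∣ u := (lvl_dvd hu _).2 h.le
  have nd : ¬ (p:ℤ)^(lvl p v + 1) ∣ (u-v) := by rwa [dvd_sub_right du']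
  have e : lvl p (u-v) = lvl p v := lvl_eq (dvd_sub du dv) nd
  have m2 : (u / (p:ℤ)^(lvl p v)) % p = 0 := by rwa [ediv_emod_ne du]
  have m : ((u-v) / (p:ℤ)^(lvl p v)) % p ≠ 0 := by rwa [Ne, ediv_emod_ne (dvd_sub du dv)]
  have h2 := Int.emod_nonneg ((u-v) / (p:ℤ)^(lvl p v)) (ppos (p := p)).ne'
  have h3 := Int.emod_lt_of_pos ((u-v) / (p:ℤ)^(lvl p v)) (ppos (p := p))
  unfold cD
  rw [show u - 1 - (v-1) = u - v by ring, e]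
  constructor
  · rw [ediv_sub_one_of_dvd (hqpos _) du, emod_sub_one' one_lt_p m2]; simp; omega
  · rw [m2]; simp; omega

theorem cD_eq {u v : ℤ} (hu : u ≠ 0) (hv : v ≠ 0) (huv : u - v ≠ 0) (h : lvl p u = lvl p v) :
    cD p (u-1) (v-1) = cD p u v := by
  have du : (p:ℤ)^(lvl p u) ∣ u := (lvl_dvd hu _).2 le_rfl
  have du' : ¬ (p:ℤ)^(lvl p u + 1) ∣ u := by rw [lvl_dvd hu]; omega
  have dv : (p:ℤ)^(lvl p u) ∣ v := (lvl_dvd hv _).2 h.le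
  have dv' : ¬ (p:ℤ)^(lvl p u + 1) ∣ v := by rw [lvl_dvd hv]; omega
  have c1 : lvl p u ≤ lvl p (u-v) := (lvl_dvd huv _).1 (dvd_sub du dv)
  unfold cD
  rw [show u - 1 - (v-1) = u - v by ring]
  rcases c1.eq_or_lt with c2 | c2
  · rw [← c2]
    have m : (u / (p:ℤ)^(lvl p u)) % p ≠ 0 := by rwa [Ne, ediv_emod_ne du]
    have m2 : (v / (p:ℤ)^(lvl p u)) % p ≠ 0 := by rwa [Ne, ediv_emod_ne dv]
    rw [ediv_sub_one_of_dvd (hqpos _) du, emod_sub_one one_lt_p m, Int.sub_ediv_of_dvd _ dv]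
    have h2 := Int.emod_nonneg (u / (p:ℤ)^(lvl p u)) (ppos (p := p)).ne'
    have h3 := Int.emod_lt_of_pos (u / (p:ℤ)^(lvl p u)) (ppos (p := p))
    have : (u / (p:ℤ)^(lvl p u) - v / (p:ℤ)^(lvl p u)) % p ≠ (u / (p:ℤ)^(lvl p u)) % p := by
      intro h'
      apply m2
      have := Int.emod_emod_of_dvd (u / (p:ℤ)^(lvl p u)) (dvd_refl (p:ℤ))
      have := Int.ModEq.dvd h'
      rw [← Int.dvd_iff_emod_eq_zero]
      rwa [sub_sub_cancel] at this
    simp only [decide_eq_decide]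
    omega
  · rw [ediv_sub_one_of_not_dvd (hqpos _) (by rw [lvl_dvd hu]; omega)]

theorem cw_lam (u v : ℤ) : (cw p u v).lam = decide (lvl p v % 2 = 1) := rfl

/-- the canonical solution satisfies the local rule -/
theorem canon {u v : ℤ} (hu : u ≠ 0) (hv : v ≠ 0) (huv : u - v ≠ 0) :
    cellOK (cty (lvl p u) (lvl p v)) (cw p (u-1) v) (cw p (v-1) u) (cD p (u-1) (v-1)) ∧
    cw p u v = updR (cty (lvl p u) (lvl p v)) (cw p (u-1) v) ∧
    cw p v u = updR (cty (lvl p u) (lvl p v)).swap (cw p (v-1) u) ∧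
    cD p u v = updD (cty (lvl p u) (lvl p v)) (cD p (u-1) (v-1)) := by
  rcases lt_trichotomy (lvl p u) (lvl p v) with h | h | h
  · obtain ⟨a1, a2, a3, a4, a5, -⟩ := cw_ge (p := p) hv hu h.le
    obtain ⟨D1, D2⟩ := cD_lt hu hv h
    by_cases h1 : lvl p u + 1 = lvl p v
    · obtain ⟨s, e⟩ := cw_eq1 hu h1
      have t : cty (lvl p u) (lvl p v) = .neg1 := by simp [cty, h.ne, h1]
      rw [t]
      refine ⟨⟨s, ⟨a1, a3.2 (by omega), fun h' => by have := a4.1 h'; omega⟩, ?_⟩, e, a2, D2⟩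
      simp only [cw_lam, ne_eq, decide_eq_decide]; omega
    · have e := cw_lt (p := p) hu (show lvl p u + 1 < lvl p v by omega)
      have t : cty (lvl p u) (lvl p v) = .neg2 := by simp [cty, h.ne, h1, h]
      rw [t]
      refine ⟨⟨⟨a1, a4.2 (by omega)⟩, Or.inr D1, (cw_c hv).2 (by omega), fun h' => ?_⟩, e.symm, a2, D2⟩
      rw [Ne, a5] at h'
      simp only [cw_lam, decide_eq_decide]; omega
  · obtain ⟨a1, a2, a3, a4, a5, -⟩ := cw_ge (p := p) hv hu h.le
    obtain ⟨b1, b2, b3, b4, b5, -⟩ := cw_ge (p := p) hu hv h.ge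
    have t : cty (lvl p u) (lvl p v) = .zero := by simp [cty, h]
    rw [t]
    refine ⟨⟨⟨b1, fun h' => by have := b3.1 h'; omega⟩, ⟨a1, fun h' => by have := a3.1 h'; omega⟩, ?_⟩,
      b2, a2, (cD_eq hu hv huv h).symm⟩
    simp only [cw_lam, h]
  · obtain ⟨a1, a2, a3, a4, a5, -⟩ := cw_ge (p := p) hu hv h.le
    obtain ⟨D1, D2⟩ := cD_gt hu hv h
    by_cases h1 : lvl p v + 1 = lvl p u
    · obtain ⟨s, e⟩ := cw_eq1 hv h1
      have t : cty (lvl p u) (lvl p v) = .pos1 := by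
        have : ¬ lvl p u = lvl p v := by omega
        have : ¬ lvl p u + 1 = lvl p v := by omega
        have : ¬ lvl p u < lvl p v := by omega
        simp [cty, *]
      rw [t]
      refine ⟨⟨s, ⟨a1, a3.2 (by omega), fun h' => by have := a4.1 h'; omega⟩, ?_⟩, a2, e, D2⟩
      simp only [cw_lam, ne_eq, decide_eq_decide]; omega
    · have e := cw_lt (p := p) hv (show lvl p v + 1 < lvl p u by omega)
      have t : cty (lvl p u) (lvl p v) = .pos2 := by
        have : ¬ lvl p u = lvl p v := by omega
        have : ¬ lvl p u + 1 = lvl p v := by omega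
        have : ¬ lvl p u < lvl p v := by omega
        simp [cty, *]
      rw [t]
      refine ⟨⟨⟨a1, a4.2 (by omega)⟩, Or.inr D1, (cw_c hu).2 (by omega), fun h' => ?_⟩, a2, e.symm, D2⟩
      rw [Ne, a5] at h'
      simp only [cw_lam, decide_eq_decide]; omega

end


/-! ## The fuse -/

structure FU {G : ℤ → ℤ → Prop} (S : FS 2 G) where
  fh : ℤ → ℤ → Bool
  fv : ℤ → ℤ → Bool
  d0 : ℤ → ℤ → Bool
  d1 : ℤ → ℤ → Bool
  pass : ∀ u v, G u v → S.ty u v ≠ .zero → fh u v = fh (u-1) v ∧ fv u v = fv u (v-1) ∧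
    d0 u v = d0 (u-1) (v-1) ∧ d1 u v = d1 (u-1) (v-1)
  e1 : ∀ u v, G u v → S.ty u v = .zero → 2 * (S.k (u-1) v + 1 - (S.kc u (v-1) + 1)) = 4 →
    fh u v = (fh (u-1) v || fv u (v-1)) ∧ fv u v = (fh (u-1) v || fv u (v-1)) ∧
    d0 u v = (fh (u-1) v || fv u (v-1)) ∧ d1 u v = d0 (u-1) (v-1)
  e2 : ∀ u v, G u v → S.ty u v = .zero → (S.k (u-1) v + 1 - (S.kc u (v-1) + 1)) = 4 →
    fh (u-1) v = fv u (v-1) ∧ fh u v = d1 (u-1) (v-1) ∧ fv u v = d1 (u-1) (v-1) ∧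
    d0 u v = d0 (u-1) (v-1) ∧ d1 u v = d1 (u-1) (v-1)
  e3 : ∀ u v, G u v → S.ty u v = .zero → (S.k (u-1) v + 1 - (S.kc u (v-1) + 1)) = 0 →
    fh (u-1) v = fv u (v-1) ∧ fh u v = false ∧ fv u v = false ∧
    d0 u v = d0 (u-1) (v-1) ∧ d1 u v = d1 (u-1) (v-1)

theorem zm8_a : ∀ x y : ZMod (2^3), 2 * (x - y) = 4 → 2 * (y - x) = 4 := by decide
theorem zm8_b : ∀ x y : ZMod (2^3), (x - y) = 4 → (y - x) = 4 := by decide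
theorem zm8_c : ∀ x y : ZMod (2^3), (x - y) = 0 → (y - x) = 0 := by decide

def FU.swap {G : ℤ → ℤ → Prop} {S : FS 2 G} (F : FU S) : FU S.swap where
  fh := fun u v => F.fv v u
  fv := fun u v => F.fh v u
  d0 := fun u v => F.d0 v u
  d1 := fun u v => F.d1 v u
  pass := fun u v h h' => by
    obtain ⟨a, b, c, d⟩ := F.pass v u h (fun h2 => h' ((swap_ty_zero S).2 h2))
    exact ⟨b, a, c, d⟩
  e1 := fun u v h h' h2 => by
    obtain ⟨a, b, c, d⟩ := F.e1 v u h ((swap_ty_zero S).1 h') (zm8_a _ _ h2)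
    simp only [Bool.or_comm] at a b c ⊢
    exact ⟨b, a, c, d⟩
  e2 := fun u v h h' h2 => by
    obtain ⟨a, b, c, d⟩ := F.e2 v u h ((swap_ty_zero S).1 h') (zm8_b _ _ h2)
    exact ⟨a.symm, c, b, d⟩
  e3 := fun u v h h' h2 => by
    obtain ⟨a, b, c, d⟩ := F.e3 v u h ((swap_ty_zero S).1 h') (zm8_c _ _ h2)
    exact ⟨a.symm, c, b, d⟩

/-- exactness up to level n -/
def EX {p : ℕ} {G : ℤ → ℤ → Prop} (S : FS p G) (x y : ℤ) (n : ℕ) : Prop :=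
  ∀ i < n, exR S x y i ∧ exR S.swap y x i

theorem EX.swap {p : ℕ} {G : ℤ → ℤ → Prop} {S : FS p G} {x y : ℤ} {n : ℕ} (h : EX S x y n) :
    EX S.swap y x n := fun i hi => ⟨(h i hi).2, (h i hi).1.ss⟩

theorem two_dvd_iff (m : ℕ) (x w : ℤ) : ((2:ℕ):ℤ)^(m+1) ∣ x + 2^m * w - x ↔ Even w := by
  rw [add_sub_cancel_left, pow_succ, even_iff_two_dvd]
  push_cast
  exact mul_dvd_mul_iff_left (by positivity)

section
variable {G : ℤ → ℤ → Prop} {S : FS 2 G} {x y : ℤ} {n : ℕ}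

theorem ty_zero (hex : EX S x y n) {m : ℕ} (hm : m < n) {w z : ℤ} (hw : Odd w) (hz : Odd z)
    (hG : G (x + 2^m * w + mg 2 m) (y + 2^m * z + mg 2 m)) :
    S.ty (x + 2^m * w) (y + 2^m * z) = .zero := by
  refine ((hex m hm).1 _ _ hG (by simp) (by simp) ?_).1 ?_
  · rw [two_dvd_iff]; simpa using hz
  · rw [two_dvd_iff]; simpa using hw

theorem k_pin (hD : DownC G) (hex : EX S x y n) {m : ℕ} (hm : m + 3 < n) {w z : ℤ} (hz : Odd z)
    (hG : G (x + 2^m * w + mg 2 m) (y + 2^m * z + mg 2 m)) :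
    S.k (x + 2^m * w - 1) (y + 2^m * z) + 1 = (w : ZMod (2^3)) := by
  have := (pin S hD le_rfl (i := m) (fun j hj => hex j (by omega)) (v := y + 2^m * z) (by simp)
    (by rw [two_dvd_iff]; simpa using hz) w (by unfold dom; exact_mod_cast hG)).2
  exact_mod_cast this

theorem kc_pin (hD : DownC G) (hex : EX S x y n) {m : ℕ} (hm : m + 3 < n) {w z : ℤ} (hw : Odd w)
    (hG : G (x + 2^m * w + mg 2 m) (y + 2^m * z + mg 2 m)) :
    S.kc (x + 2^m * w) (y + 2^m * z - 1) + 1 = (z : ZMod (2^3)) :=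
  k_pin (S := S.swap) hD.swap hex.swap hm hw hG

theorem delta_pin (hD : DownC G) (hex : EX S x y n) {m : ℕ} (hm : m + 3 < n) {w z : ℤ} (hw : Odd w)
    (hz : Odd z) (hG : G (x + 2^m * w + mg 2 m) (y + 2^m * z + mg 2 m)) :
    (S.k (x + 2^m * w - 1) (y + 2^m * z) + 1 - (S.kc (x + 2^m * w) (y + 2^m * z - 1) + 1)) =
      ((w - z : ℤ) : ZMod (2^3)) := by
  rw [k_pin hD hex hm hz hG, kc_pin hD hex hm hw hG]; push_cast; ring

theorem c8_1 (n : ℤ) (h : (4:ℤ) ∣ n - 2) : 2 * (n : ZMod (2^3)) = 4 := by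
  have : ((2 * n - 4 : ℤ) : ZMod (2^3)) = 0 := by
    rw [ZMod.intCast_zmod_eq_zero_iff_dvd]; push_cast; omega
  push_cast at this; linear_combination this
theorem c8_2 (n : ℤ) (h : (8:ℤ) ∣ n - 4) : (n : ZMod (2^3)) = 4 := by
  have : ((n - 4 : ℤ) : ZMod (2^3)) = 0 := by
    rw [ZMod.intCast_zmod_eq_zero_iff_dvd]; push_cast; omega
  push_cast at this; linear_combination this
theorem c8_3 (n : ℤ) (h : (8:ℤ) ∣ n) : (n : ZMod (2^3)) = 0 := by
  rw [ZMod.intCast_zmod_eq_zero_iff_dvd]; push_cast; omega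

variable (F : FU S)

/-- horizontal transmission of the bit along a row of exact level m -/
theorem fh_seg (hD : DownC G) (hex : EX S x y n) {m : ℕ} (hm : m < n) {w z : ℤ} (hw : Odd w)
    (hz : Odd z) (hG : G (x + 2^m * w - 1 + mg 2 m) (y + 2^m * z + mg 2 m)) :
    F.fh (x + 2^m * w - 1) (y + 2^m * z) = F.fh (x + 2^m * (w-2)) (y + 2^m * z) := by
  have hq : (0:ℤ) < 2^m := by positivity
  refine seg_const (fun u => F.fh u (y + 2^m * z)) _ _ (by nlinarith) ?_
  intro u h1 h2
  have hn := mg_nonneg 2 m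
  have g : G (u + mg 2 m) (y + 2^m * z + mg 2 m) := hD _ _ _ _ hG (by omega) le_rfl
  refine (F.pass u _ (hD _ _ _ _ g (by omega) (by omega)) ?_).1
  by_cases hd : ((2:ℕ):ℤ)^m ∣ u - x
  · obtain ⟨c, hc⟩ := hd
    push_cast at hc
    have e : u = x + 2^m * c := by linarith
    have c1 : c < w := by
      by_contra h; have : 2^m * w ≤ 2^m * c := by nlinarith
      omega
    have c2 : w - 2 < c := by
      by_contra h; have : 2^m * c ≤ 2^m * (w-2) := by nlinarith
      omega
    have c3 : Even c := by
      have : c = w - 1 := by omega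
      rw [this]; obtain ⟨q, rfl⟩ := hw; exact ⟨q, by ring⟩
    have := ((hex m hm).1.go u _ g (by rw [e]; simp) (by simp)
      (by rw [two_dvd_iff]; simpa using hz)).2 (by rw [e, two_dvd_iff]; exact c3)
    rcases this with h | h <;> rw [h] <;> simp
  · obtain ⟨j, hj, a, b⟩ := exists_level 2 x u m hd
    have mm := mg_mono 2 hj.le
    have H := exC_neg (hex j (by omega)).2 (u := u) (v := y + 2^m * z)
      (hD _ _ _ _ g (by omega) (by omega)) a b
      (by rw [add_sub_cancel_left]
          exact (pow_dvd_pow _ (show j+1 ≤ m by omega)).trans (by push_cast; exact dvd_mul_right _ _))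
    by_cases h5 : ((2:ℕ):ℤ)^(j+2) ∣ y + 2^m * z - y
    · rw [H.2 h5]; simp
    · rw [H.1 h5]; simp

theorem fv_seg (hD : DownC G) (hex : EX S x y n) {m : ℕ} (hm : m < n) {w z : ℤ} (hw : Odd w)
    (hz : Odd z) (hG : G (x + 2^m * w + mg 2 m) (y + 2^m * z - 1 + mg 2 m)) :
    F.fv (x + 2^m * w) (y + 2^m * z - 1) = F.fv (x + 2^m * w) (y + 2^m * (z-2)) :=
  fh_seg F.swap hD.swap hex.swap hm hz hw hG

def nb (F : FU S) (x y : ℤ) (m : ℕ) (w z : ℤ) : Bool := F.fh (x + 2^m * w) (y + 2^m * z)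

theorem nb_fv (hD : DownC G) (hex : EX S x y n) {m : ℕ} (hm : m + 3 < n) {w z : ℤ} (hw : Odd w)
    (hz : Odd z) (h4 : (4:ℤ) ∣ w - z - 2)
    (hG : G (x + 2^m * w + mg 2 m) (y + 2^m * z + mg 2 m)) :
    F.fv (x + 2^m * w) (y + 2^m * z) = nb F x y m w z ∧
    F.d0 (x + 2^m * w) (y + 2^m * z) = nb F x y m w z ∧
    F.d1 (x + 2^m * w) (y + 2^m * z) = F.d0 (x + 2^m * w - 1) (y + 2^m * z - 1) ∧
    nb F x y m w z = (F.fh (x + 2^m * w - 1) (y + 2^m * z) || F.fv (x + 2^m * w) (y + 2^m * z - 1)) := by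
  have hn := mg_nonneg 2 m
  obtain ⟨a, b, c, d⟩ := F.e1 _ _ (hD _ _ _ _ hG (by omega) (by omega))
    (ty_zero hex (by omega) hw hz hG) (by rw [delta_pin hD hex hm hw hz hG]; exact c8_1 _ h4)
  exact ⟨b.trans a.symm, c.trans a.symm, d, a⟩

/-- adjacent bits agree -/
theorem nb_adj (hD : DownC G) (hex : EX S x y n) {m : ℕ} (hm : m + 3 < n) {w z : ℤ} (hw : Odd w)
    (hz : Odd z) (h4 : (4:ℤ) ∣ w - z - 2)
    (hG : G (x + 2^m * (w+2) + mg 2 m) (y + 2^m * z + mg 2 m)) :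
    nb F x y m w z = nb F x y m (w+2) (z-2) := by
  have hq : (0:ℤ) < 2^m := by positivity
  have hn := mg_nonneg 2 m
  have hw2 : Odd (w+2) := by obtain ⟨q, rfl⟩ := hw; exact ⟨q+1, by ring⟩
  have hz2 : Odd (z-2) := by obtain ⟨q, rfl⟩ := hz; exact ⟨q-1, by ring⟩
  have t := ty_zero hex (show m < n by omega) hw2 hz hG
  have dl := delta_pin hD hex hm hw2 hz hG
  have g := hD _ _ _ _ hG (show x + 2^m * (w+2) ≤ _ by omega) (show y + 2^m * z ≤ _ by omega)
  have key : F.fh (x + 2^m * (w+2) - 1) (y + 2^m * z) = F.fv (x + 2^m * (w+2)) (y + 2^m * z - 1) := by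
    by_cases h8 : (8:ℤ) ∣ w + 2 - z
    · exact (F.e3 _ _ g t (by rw [dl]; exact c8_3 _ h8)).1
    · exact (F.e2 _ _ g t (by rw [dl]; exact c8_2 _ (by omega))).1
  rw [fh_seg F hD hex (by omega) hw2 hz (hD _ _ _ _ hG (by omega) le_rfl),
    fv_seg F hD hex (by omega) hw2 hz (hD _ _ _ _ hG le_rfl (by omega)), add_sub_cancel_right] at key
  unfold nb
  rw [key]
  exact (nb_fv F hD hex hm hw2 hz2 (by omega) (hD _ _ _ _ hG le_rfl (by nlinarith))).1

/-- diagonal registers pass away from updates -/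
theorem d_pass (hD : DownC G) (hex : EX S x y n) {m : ℕ} (hm : m + 5 < n) {u v : ℤ}
    (hd : (2:ℤ)^(m+2) ∣ (u - x) - (v - y)) (hd' : ¬ (2:ℤ)^(m+3) ∣ (u - x) - (v - y))
    (hne : ¬ ((2:ℤ)^(m+1) ∣ u - x ∧ ¬ (2:ℤ)^(m+2) ∣ u - x))
    (hG : G (u + mg 2 (m+2)) (v + mg 2 (m+2))) :
    F.d0 u v = F.d0 (u-1) (v-1) ∧ F.d1 u v = F.d1 (u-1) (v-1) := by
  have hn := mg_nonneg 2 (m+2)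
  have g := hD _ _ _ _ hG (show u ≤ _ by omega) (show v ≤ _ by omega)
  have P : S.ty u v ≠ .zero → F.d0 u v = F.d0 (u-1) (v-1) ∧ F.d1 u v = F.d1 (u-1) (v-1) :=
    fun h => (F.pass u v g h).2.2
  by_cases h1 : (2:ℤ)^(m+3) ∣ u - x
  · have b1 : (2:ℤ)^(m+2) ∣ v - y := by
      rw [← dvd_sub_right ((pow_dvd_pow _ (by omega)).trans h1)]; exact hd
    have b2 : ¬ (2:ℤ)^(m+3) ∣ v - y := by rwa [dvd_sub_right h1] at hd'
    apply P
    rcases ((hex (m+2) (by omega)).1.go u v hG ((pow_dvd_pow _ (by omega)).trans h1) b1 b2).2 h1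
      with h | h <;> rw [h] <;> simp
  · obtain ⟨j, hj, a, b⟩ := exists_level 2 x u (m+3) h1
    push_cast at a b
    have mm := mg_mono 2 (show j ≤ m+2 by omega)
    have gj : G (u + mg 2 j) (v + mg 2 j) := hD _ _ _ _ hG (by omega) (by omega)
    by_cases hj2 : j = m+2
    · subst hj2
      have b1 : (2:ℤ)^(m+2) ∣ v - y := by rw [← dvd_sub_right a]; exact hd
      have b2 : (2:ℤ)^(m+3) ∣ v - y := by
        obtain ⟨c, hc⟩ := a; obtain ⟨e, he⟩ := b1
        have hq : (2:ℤ)^(m+2) ≠ 0 := by positivity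
        have e3 : (2:ℤ)^(m+3) = 2^(m+2) * 2 := by ring
        rw [hc, e3, mul_dvd_mul_iff_left hq] at b
        rw [hc, he, e3, ← mul_sub, mul_dvd_mul_iff_left hq] at hd'
        rw [he, e3, mul_dvd_mul_iff_left hq]; omega
      have := exC_neg (hex (m+2) (by omega)).2 gj a b b2
      apply P
      by_cases h5 : ((2:ℕ):ℤ)^(m+2+2) ∣ v - y
      · rw [this.2 h5]; simp
      · rw [this.1 h5]; simp
    · have hj1 : j ≠ m+1 := by rintro rfl; exact hne ⟨a, b⟩
      obtain ⟨w, hw⟩ := a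
      have b1 : (2:ℤ)^j ∣ v - y := by
        rw [← dvd_sub_right (Dvd.intro _ hw.symm)]; exact (pow_dvd_pow _ (by omega)).trans hd
      obtain ⟨z, hz⟩ := b1
      have hq : (2:ℤ)^j ≠ 0 := by positivity
      have eu : u = x + 2^j * w := by linarith
      have ev : v = y + 2^j * z := by linarith
      have hd4 : (2:ℤ)^j * 4 ∣ 2^j * (w - z) := by
        rw [mul_sub, ← hw, ← hz]
        refine dvd_trans ?_ hd
        rw [show (2:ℤ)^j * 4 = 2^(j+2) by ring]
        exact pow_dvd_pow _ (by omega)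
      rw [mul_dvd_mul_iff_left hq] at hd4
      have ow : Odd w := by
        rw [hw, pow_succ, mul_dvd_mul_iff_left hq] at b
        rw [← Int.not_even_iff_odd, even_iff_two_dvd]; exact b
      have oz : Odd z := by
        rw [← Int.not_even_iff_odd, even_iff_two_dvd] at ow ⊢; omega
      rw [eu, ev] at gj g ⊢
      have t := ty_zero hex (by omega) ow oz gj
      have dl := delta_pin hD hex (show j + 3 < n by omega) ow oz gj
      by_cases h8 : (8:ℤ) ∣ w - z
      · exact (F.e3 _ _ g t (by rw [dl]; exact c8_3 _ h8)).2.2.2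
      · exact (F.e2 _ _ g t (by rw [dl]; exact c8_2 _ (by omega))).2.2.2

end


section
variable {G : ℤ → ℤ → Prop} {S : FS 2 G} {x y : ℤ} {n : ℕ} (F : FU S)

theorem mg2 (i : ℕ) : mg 2 i = 2^i - 1 := by
  induction i with
  | zero => simp [mg]
  | succ i ih => simp only [mg, ih]; push_cast; ring

theorem dv_odd (m : ℕ) (k : ℤ) : (2:ℤ)^(m+1) ∣ 2^m * k ↔ Even k := by
  rw [pow_succ, even_iff_two_dvd]; exact mul_dvd_mul_iff_left (by positivity)

theorem dv_four (m : ℕ) (k : ℤ) : (2:ℤ)^(m+2) ∣ 2^m * k ↔ (4:ℤ) ∣ k := by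
  rw [pow_add]; norm_num; exact mul_dvd_mul_iff_left (by positivity)

theorem dv_eight (m : ℕ) (k : ℤ) : (2:ℤ)^(m+3) ∣ 2^m * k ↔ (8:ℤ) ∣ k := by
  rw [pow_add]; norm_num; exact mul_dvd_mul_iff_left (by positivity)

/-- constancy of registers along a diagonal between updates; cells strictly after a, up to b -/
theorem d_seg (hD : DownC G) (hex : EX S x y n) {m : ℕ} (hm : m + 5 < n) {X Y a b : ℤ} (hab : a ≤ b)
    (hd : (2:ℤ)^(m+2) ∣ (X - x) - (Y - y)) (hd' : ¬ (2:ℤ)^(m+3) ∣ (X - x) - (Y - y))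
    (hne : ∀ t, a < t → t ≤ b → ¬ ((2:ℤ)^(m+1) ∣ X + t - x ∧ ¬ (2:ℤ)^(m+2) ∣ X + t - x))
    (hG : G (X + b + mg 2 (m+2)) (Y + b + mg 2 (m+2))) :
    F.d0 (X+b) (Y+b) = F.d0 (X+a) (Y+a) ∧ F.d1 (X+b) (Y+b) = F.d1 (X+a) (Y+a) := by
  have key : ∀ t, a < t → t ≤ b → F.d0 (X+t) (Y+t) = F.d0 (X+t-1) (Y+t-1) ∧
      F.d1 (X+t) (Y+t) = F.d1 (X+t-1) (Y+t-1) := by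
    intro t h1 h2
    refine d_pass F hD hex hm ?_ ?_ (hne t h1 h2) (hD _ _ _ _ hG (by omega) (by omega))
    · rwa [show X + t - x - (Y + t - y) = X - x - (Y - y) by ring]
    · rwa [show X + t - x - (Y + t - y) = X - x - (Y - y) by ring]
  constructor
  · refine seg_const (fun t => F.d0 (X+t) (Y+t)) a b hab ?_
    intro t h1 h2
    have := (key t h1 h2).1
    rwa [add_sub_assoc, add_sub_assoc] at this
  · refine seg_const (fun t => F.d1 (X+t) (Y+t)) a b hab ?_
    intro t h1 h2
    have := (key t h1 h2).2
    rwa [add_sub_assoc, add_sub_assoc] at this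

def sig (s : ℤ) : ℤ := if (s - 2) % 8 = 2 then 5 else 7

/-- register read at an E2 cell -/
theorem e2_read (hD : DownC G) (hex : EX S x y n) {m : ℕ} (hm : m + 5 < n) {w z : ℤ} (hw : Odd w)
    (hz : Odd z) (h8 : (8:ℤ) ∣ w - z - 4)
    (hG : G (x + 2^m * w - 1 + mg 2 (m+2)) (y + 2^m * z - 1 + mg 2 (m+2))) :
    ∃ w' z', Odd w' ∧ Odd z' ∧ (4:ℤ) ∣ w' - z' - 2 ∧ 2 * w' = w - sig (w+z+2) ∧
      2 * z' = z - sig (w+z+2) ∧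
      F.d1 (x + 2^m * w - 1) (y + 2^m * z - 1) = nb F x y (m+1) w' z' := by
  have hq : (0:ℤ) < 2^m := by positivity
  obtain ⟨a, rfl⟩ := hw
  obtain ⟨b, rfl⟩ := hz
  -- latest update index
  obtain ⟨σ, hσ, hs, hmod⟩ : ∃ σ : ℤ, σ = sig ((2*a+1)+(2*b+1)+2) ∧ (σ = 5 ∨ σ = 7) ∧
      (4:ℤ) ∣ 2*a+1 - σ - 2 := by
    refine ⟨_, rfl, ?_, ?_⟩ <;> unfold sig <;> split_ifs <;> omega
  rw [← hσ]
  obtain ⟨w', hw'⟩ : ∃ w', 2 * w' = 2*a+1 - σ := ⟨(2*a+1-σ)/2, by omega⟩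
  obtain ⟨z', hz'⟩ : ∃ z', 2 * z' = 2*b+1 - σ := ⟨(2*b+1-σ)/2, by omega⟩
  have ow : Odd w' := Int.odd_iff.2 (by omega)
  have oz : Odd z' := Int.odd_iff.2 (by omega)
  have h4 : (4:ℤ) ∣ w' - z' - 2 := by omega
  refine ⟨w', z', ow, oz, h4, hw', hz', ?_⟩
  have ow2 : Odd (w'+2) := Int.odd_iff.2 (by have := Int.odd_iff.1 ow; omega)
  have oz2 : Odd (z'+2) := Int.odd_iff.2 (by have := Int.odd_iff.1 oz; omega)
  set X := x + 2^(m+1) * w' with hX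
  set Y := y + 2^(m+1) * z' with hY
  have ed : X - x - (Y - y) = 2^m * (2 * (w' - z')) := by rw [hX, hY]; ring
  have hd : (2:ℤ)^(m+2) ∣ (X - x) - (Y - y) := by rw [ed, dv_four]; omega
  have hd' : ¬ (2:ℤ)^(m+3) ∣ (X - x) - (Y - y) := by rw [ed, dv_eight]; omega
  have eE : x + 2^m * (2*a+1) - 1 = X + (2^m * σ - 1) := by
    rw [hX, show (2*a+1) = 2 * w' + σ by omega]; ring
  have eE' : y + 2^m * (2*b+1) - 1 = Y + (2^m * σ - 1) := by
    rw [hY, show (2*b+1) = 2 * z' + σ by omega]; ring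
  rw [eE, eE'] at hG ⊢
  -- update positions
  have upd : ∀ t : ℤ, ((2:ℤ)^(m+1) ∣ X + t - x ∧ ¬ (2:ℤ)^(m+2) ∣ X + t - x) →
      ∃ c, t = 2^m * (4 * c) := by
    rintro t ⟨⟨e, he⟩, h2⟩
    rw [he, show m + 2 = (m+1)+1 by ring, dv_odd, Int.not_even_iff_odd] at h2
    obtain ⟨c, hc⟩ := h2
    obtain ⟨d, hd⟩ := ow
    refine ⟨c - d, ?_⟩
    have : t = 2^(m+1) * e - 2^(m+1) * w' := by rw [← he, hX]; ring
    rw [this, hc, hd]; ring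
  have hsl : 5 ≤ σ := by omega
  have hsu : σ ≤ 7 := by omega
  have s1 := (d_seg F hD hex hm (X := X) (Y := Y) (a := 2^m * 4) (b := 2^m * σ - 1) (by nlinarith) hd hd' (by
    intro t h1 h2 h3
    obtain ⟨c, rfl⟩ := upd t h3
    have c1 : 1 < c := by
      by_contra h; have : (2:ℤ)^m * (4*c) ≤ 2^m * 4 := by nlinarith
      omega
    have : (2:ℤ)^m * (4*c) ≥ 2^m * σ := by nlinarith
    omega) hG).2
  have hG0 : G (X + 2^m * σ + mg 2 (m+2) - 1) (Y + 2^m * σ + mg 2 (m+2) - 1) := by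
    rwa [show X + 2^m * σ + mg 2 (m+2) - 1 = X + (2^m * σ - 1) + mg 2 (m+2) by ring,
      show Y + 2^m * σ + mg 2 (m+2) - 1 = Y + (2^m * σ - 1) + mg 2 (m+2) by ring]
  have hs4 : (2:ℤ)^m * 4 + 1 ≤ 2^m * σ := by nlinarith
  have hm12 : mg 2 (m+1) ≤ mg 2 (m+2) := mg_mono 2 (by omega)
  have s2 := (d_seg F hD hex hm (X := X) (Y := Y) (a := 0) (b := 2^m * 4 - 1) (by nlinarith) hd hd' (by
    intro t h1 h2 h3
    obtain ⟨c, rfl⟩ := upd t h3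
    have c1 : 0 < c := by
      by_contra h; have : (2:ℤ)^m * (4*c) ≤ 0 := by nlinarith
      omega
    have : (2:ℤ)^m * (4*c) ≥ 2^m * 4 := by nlinarith
    omega) (hD _ _ _ _ hG0 (by omega) (by omega))).1
  have eU : X + 2^m * 4 = x + 2^(m+1) * (w'+2) := by rw [hX]; ring
  have eU' : Y + 2^m * 4 = y + 2^(m+1) * (z'+2) := by rw [hY]; ring
  have up := (nb_fv F hD hex (m := m+1) (by omega) ow2 oz2 (by omega)
    (by rw [← eU, ← eU']; exact hD _ _ _ _ hG0 (by omega) (by omega))).2.2.1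
  have up0 := (nb_fv F hD hex (m := m+1) (by omega) ow oz (by omega)
    (by exact hD _ _ _ _ hG0 (show X + _ ≤ _ by nlinarith) (show Y + _ ≤ _ by nlinarith))).2.1
  rw [← eU, ← eU'] at up
  rw [s1, up, ← up0, add_sub_assoc, add_sub_assoc, s2, add_zero, add_zero]

theorem parent (hD : DownC G) (hex : EX S x y n) {m : ℕ} (hm : m + 5 < n) {w z : ℤ} (hw : Odd w)
    (hz : Odd z) (h4 : (4:ℤ) ∣ w - z - 2)
    (hG : G (x + 2^m * w - 1 + mg 2 (m+2)) (y + 2^m * z - 1 + mg 2 (m+2))) :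
    ∃ w' z', Odd w' ∧ Odd z' ∧ (4:ℤ) ∣ w' - z' - 2 ∧ 2 * (w' + z') = w + z - 2 - 2 * sig (w+z) ∧
      (2 * w' = w - sig (w+z) ∨ 2 * w' = w - 2 - sig (w+z)) ∧
      G (x + 2^(m+1) * w' - 1 + mg 2 (m+1+2)) (y + 2^(m+1) * z' - 1 + mg 2 (m+1+2)) ∧
      nb F x y m w z = nb F x y (m+1) w' z' := by
  have hq : (0:ℤ) < 2^m := by positivity
  have hmg := mg2 m
  have hmg2 : mg 2 (m+2) = 2^m*4 - 1 := by rw [mg2]; ring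
  have hmg3 : mg 2 (m+1+2) = 2^m*8 - 1 := by rw [mg2]; ring
  have hG0 : G (x + 2^m * w + mg 2 m) (y + 2^m * z + mg 2 m) := hD _ _ _ _ hG (by omega) (by omega)
  have hn := mg_nonneg 2 m
  obtain ⟨-, -, -, hnb⟩ := nb_fv F hD hex (show m + 3 < n by omega) hw hz h4 hG0
  have ow2 : Odd (w-2) := Int.odd_iff.2 (by have := Int.odd_iff.1 hw; omega)
  have oz2 : Odd (z-2) := Int.odd_iff.2 (by have := Int.odd_iff.1 hz; omega)
  rw [fh_seg F hD hex (by omega) hw hz (hD _ _ _ _ hG0 (by omega) le_rfl),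
    fv_seg F hD hex (by omega) hw hz (hD _ _ _ _ hG0 le_rfl (by omega))] at hnb
  have gW : G (x + 2^m * (w-2) + mg 2 m) (y + 2^m * z + mg 2 m) := hD _ _ _ _ hG0 (by nlinarith) le_rfl
  have gN : G (x + 2^m * w + mg 2 m) (y + 2^m * (z-2) + mg 2 m) := hD _ _ _ _ hG0 le_rfl (by nlinarith)
  have tW := ty_zero hex (show m < n by omega) ow2 hz gW
  have tN := ty_zero hex (show m < n by omega) hw oz2 gN
  have dW := delta_pin hD hex (show m+3 < n by omega) ow2 hz gW
  have dN := delta_pin hD hex (show m+3 < n by omega) hw oz2 gN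
  have gW' := hD _ _ _ _ gW (show x + 2^m * (w-2) ≤ _ by omega) (show y + 2^m * z ≤ _ by omega)
  have gN' := hD _ _ _ _ gN (show x + 2^m * w ≤ _ by omega) (show y + 2^m * (z-2) ≤ _ by omega)
  have hsl : 5 ≤ sig (w+z) := by unfold sig; split_ifs <;> omega
  have gout : ∀ w' z' : ℤ, 2 * w' ≤ w - sig (w+z) → 2 * z' ≤ z - sig (w+z) →
      G (x + 2^(m+1) * w' - 1 + mg 2 (m+1+2)) (y + 2^(m+1) * z' - 1 + mg 2 (m+1+2)) := by
    intro w' z' h1 h2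
    refine hD _ _ _ _ hG ?_ ?_
    · rw [hmg2, hmg3, pow_succ]; nlinarith
    · rw [hmg2, hmg3, pow_succ]; nlinarith
  by_cases h8 : (8:ℤ) ∣ w - z - 2
  · -- W is zero, N is E2
    rw [(F.e3 _ _ gW' tW (by rw [dW]; exact c8_3 _ (by omega))).2.1,
      (F.e2 _ _ gN' tN (by rw [dN]; exact c8_2 _ (by omega))).2.2.1, Bool.false_or] at hnb
    obtain ⟨w', z', a, b, c, d, e, f⟩ := e2_read F hD hex hm hw oz2 (by omega)
      (hD _ _ _ _ hG le_rfl (by nlinarith))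
    rw [show w + (z-2) + 2 = w + z by ring] at d e
    exact ⟨w', z', a, b, c, by omega, by omega, gout _ _ (by omega) (by omega), hnb.trans f⟩
  · rw [(F.e3 _ _ gN' tN (by rw [dN]; exact c8_3 _ (by omega))).2.2.1,
      (F.e2 _ _ gW' tW (by rw [dW]; exact c8_2 _ (by omega))).2.1, Bool.or_false] at hnb
    obtain ⟨w', z', a, b, c, d, e, f⟩ := e2_read F hD hex hm ow2 hz (by omega)
      (hD _ _ _ _ hG (by nlinarith) le_rfl)
    rw [show (w-2) + z + 2 = w + z by ring] at d e
    exact ⟨w', z', a, b, c, by omega, by omega, gout _ _ (by omega) (by omega), hnb.trans f⟩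

theorem chain (hD : DownC G) (hex : EX S x y n) (B : ℤ) (M : ℕ) (hM : B ≤ 2^(M+1)) (hn : M + 5 < n) (j : ℕ) :
    ∀ m, m + j = M → ∀ w z s : ℤ, Odd w → Odd z → (4:ℤ) ∣ w - z - 2 → Even s → 0 ≤ s →
      2^m * s + 2 ≤ B + 2^(m+1) →
      G (x + 2^m * w - 1 + mg 2 (m+2)) (y + 2^m * z - 1 + mg 2 (m+2)) →
      G (x + 2^m * (w+s) - 1 + mg 2 (m+2)) (y + 2^m * (z-s) - 1 + mg 2 (m+2)) →
      nb F x y m w z = nb F x y m (w+s) (z-s) := by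
  induction j with
  | zero =>
    intro m hm w z s hw hz h4 hs hs0 hb g1 g2
    obtain rfl : m = M := by omega
    have hq : (0:ℤ) < 2^m := by positivity
    obtain ⟨c, rfl⟩ := hs
    rw [pow_succ] at hM hb
    have : c < 2 := by
      by_contra h; have : (2:ℤ)^m * (c+c) ≥ 2^m * 4 := by nlinarith
      omega
    have : c = 0 ∨ c = 1 := by omega
    rcases this with rfl | rfl
    · simp
    · have h1 := mg2 m
      have h2 : mg 2 (m+2) = 2^m*4 - 1 := by rw [mg2]; ring
      refine nb_adj F hD hex (by omega) hw hz h4 (hD _ _ _ _ g2 ?_ ?_)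
      · norm_num; omega
      · rw [h1, h2]; nlinarith
  | succ j ih =>
    intro m hm w z s hw hz h4 hs hs0 hb g1 g2
    have hq : (0:ℤ) < 2^m := by positivity
    obtain ⟨c, rfl⟩ := hs
    by_cases hc : c = 0
    · subst hc; simp
    have ow2 : Odd (w+(c+c)) := Int.odd_iff.2 (by have := Int.odd_iff.1 hw; omega)
    have oz2 : Odd (z-(c+c)) := Int.odd_iff.2 (by have := Int.odd_iff.1 hz; omega)
    obtain ⟨w1, z1, a1, b1, c1, d1, e1, f1, k1⟩ := parent F hD hex (by omega) hw hz h4 g1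
    obtain ⟨w2, z2, a2, b2, c2, d2, e2, f2, k2⟩ := parent F hD hex (by omega) ow2 oz2 (by omega) g2
    rw [show w + (c+c) + (z - (c+c)) = w + z by ring] at d2 e2
    rw [k1, k2]
    obtain ⟨s', hs'⟩ : ∃ s', w2 = w1 + s' := ⟨w2 - w1, by ring⟩
    have hz' : z2 = z1 - s' := by omega
    subst hs' hz'
    refine ih (m+1) (by omega) w1 z1 s' a1 b1 c1 ?_ ?_ ?_ f1 f2
    · have := Int.odd_iff.1 a1; have := Int.odd_iff.1 a2; exact Int.even_iff.2 (by omega)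
    · omega
    · have : 2 * s' ≤ 2*c + 2 := by omega
      rw [pow_succ] at hb ⊢
      have : (2:ℤ)^m * (2*s') ≤ 2^m * (2*c+2) := by nlinarith
      rw [pow_succ, pow_succ]
      nlinarith

theorem d0_prev (hD : DownC G) (hex : EX S x y n) (hn : 5 < n) {w z : ℤ} (hw : Odd w)
    (hz : Odd z) (h4 : (4:ℤ) ∣ w - z - 2) (hG : G (x + w) (y + z)) :
    F.d0 (x + w - 1) (y + z - 1) = nb F x y 0 (w-2) (z-2) := by
  obtain ⟨a, rfl⟩ := hw
  obtain ⟨b, rfl⟩ := hz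
  have h : S.ty (x + (2*a+1) - 1) (y + (2*b+1) - 1) ≠ .zero := by
    have g : G (x + (2*a+1) - 1 + mg 2 1) (y + (2*b+1) - 1 + mg 2 1) := by
      simpa [mg] using hG
    by_cases hb : (2:ℤ) ∣ b
    · have := exC_neg (hex 1 (by omega)).2 g (by push_cast; omega) (by push_cast; omega) (by push_cast; omega)
      by_cases h5 : ((2:ℕ):ℤ)^(1+2) ∣ y + (2*b+1) - 1 - y
      · rw [this.2 h5]; simp
      · rw [this.1 h5]; simp
    · rcases ((hex 1 (by omega)).1.go _ _ g (by push_cast; omega) (by push_cast; omega)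
        (by push_cast; omega)).2 (by push_cast; omega) with h | h <;> rw [h] <;> simp
  rw [(F.pass _ _ (hD _ _ _ _ hG (by omega) (by omega)) h).2.2.1]
  have := (nb_fv F hD hex (m := 0) (by omega) (w := 2*a+1-2) (z := 2*b+1-2) (Int.odd_iff.2 (by omega))
    (Int.odd_iff.2 (by omega)) (by omega) (by simp only [mg]; exact hD _ _ _ _ hG (by omega) (by omega))).2.1
  rw [← this]
  congr 1 <;> ring

/-- if one level-0 update cell has its register set, so do all on the antidiagonal -/
theorem boom_all (hD : DownC G) (hS : ∀ n, ∃ x y, (((2:ℕ):ℤ) ∣ x - S.x0 ∧ ((2:ℕ):ℤ) ∣ y - S.y0) ∧ EX S x y n)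
    {u v s : ℤ} (hs : Even s)
    (h1 : G u v) (h2 : G (u+s) (v-s)) (ht : S.ty u v = .zero) (hu : ¬ (2:ℤ) ∣ u - S.x0)
    (hv : ¬ (2:ℤ) ∣ v - S.y0)
    (hd : 2 * (S.k (u-1) v + 1 - (S.kc u (v-1) + 1)) = 4) :
    S.ty (u+s) (v-s) = .zero ∧ 2 * (S.k (u+s-1) (v-s) + 1 - (S.kc (u+s) (v-s-1) + 1)) = 4 ∧
    F.d0 (u+s-1) (v-s-1) = F.d0 (u-1) (v-1) := by
  obtain ⟨M, hM⟩ : ∃ M : ℕ, |s| ≤ 2^(M+1) := by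
    refine ⟨s.natAbs, ?_⟩
    rw [Int.abs_eq_natAbs]
    exact_mod_cast (Nat.lt_two_pow_self (n := s.natAbs)).le.trans (Nat.pow_le_pow_right (by norm_num) (by omega))
  obtain ⟨x, y, ⟨hx, hy⟩, hex⟩ := hS (M+6)
  push_cast at hx hy
  obtain ⟨w, rfl⟩ : ∃ w, u = x + w := ⟨u - x, by ring⟩
  obtain ⟨z, rfl⟩ : ∃ z, v = y + z := ⟨v - y, by ring⟩
  have ow : Odd w := Int.odd_iff.2 (by omega)
  have oz : Odd z := Int.odd_iff.2 (by omega)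
  obtain ⟨c, rfl⟩ := hs
  have ow2 : Odd (w+(c+c)) := Int.odd_iff.2 (by have := Int.odd_iff.1 ow; omega)
  have oz2 : Odd (z-(c+c)) := Int.odd_iff.2 (by have := Int.odd_iff.1 oz; omega)
  have h4 : (4:ℤ) ∣ w - z - 2 := by
    have := delta_pin hD hex (m := 0) (by omega) ow oz (by simpa [mg] using h1)
    simp only [pow_zero, one_mul] at this
    rw [this] at hd
    have h : ((2 * (w - z) - 4 : ℤ) : ZMod (2^3)) = 0 := by
      push_cast at hd ⊢; rw [hd]; ring
    rw [ZMod.intCast_zmod_eq_zero_iff_dvd] at h; push_cast at h; omega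
  have h42 : (4:ℤ) ∣ (w+(c+c)) - (z-(c+c)) - 2 := by omega
  have eu : x + w + (c+c) = x + (w + (c+c)) := by ring
  have ev : y + z - (c+c) = y + (z - (c+c)) := by ring
  rw [eu, ev] at h2 ⊢
  refine ⟨?_, ?_, ?_⟩
  · have := ty_zero hex (m := 0) (by omega) ow2 oz2 (by simpa [mg] using h2)
    simpa using this
  · have := delta_pin hD hex (m := 0) (by omega) ow2 oz2 (by simpa [mg] using h2)
    simp only [pow_zero, one_mul] at this
    rw [this]; exact c8_1 _ h42
  · rw [d0_prev F hD hex (by omega) ow oz h4 h1, d0_prev F hD hex (by omega) ow2 oz2 h42 h2]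
    have om : Odd (w-2) := Int.odd_iff.2 (by have := Int.odd_iff.1 ow; omega)
    have omz : Odd (z-2) := Int.odd_iff.2 (by have := Int.odd_iff.1 oz; omega)
    have om2 : Odd (w+(c+c)-2) := Int.odd_iff.2 (by have := Int.odd_iff.1 ow; omega)
    have omz2 : Odd (z-(c+c)-2) := Int.odd_iff.2 (by have := Int.odd_iff.1 oz; omega)
    have e2 : mg 2 (0+2) = 3 := by rw [mg2]; norm_num
    have g1 : G (x + 2^0 * (w-2) - 1 + mg 2 (0+2)) (y + 2^0 * (z-2) - 1 + mg 2 (0+2)) := by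
      rw [e2]; convert h1 using 1 <;> ring
    have g2 : G (x + 2^0 * (w+(c+c)-2) - 1 + mg 2 (0+2)) (y + 2^0 * (z-(c+c)-2) - 1 + mg 2 (0+2)) := by
      rw [e2]; convert h2 using 1 <;> ring
    rcases le_total 0 c with hc | hc
    · have := chain F hD hex |c+c| M hM (by omega) M 0 (by omega) (w-2) (z-2) (c+c) om omz (by omega) ⟨c, rfl⟩
        (by omega) (by rw [abs_of_nonneg (by omega)]; norm_num) g1 (by convert g2 using 3 <;> ring)
      rw [this]; congr 1 <;> ring
    · have := chain F hD hex |c+c| M hM (by omega) M 0 (by omega) (w+(c+c)-2) (z-(c+c)-2) (-(c+c)) om2 omz2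
        (by omega) ⟨-c, by ring⟩
        (by omega) (by rw [abs_of_nonpos (by omega)]; norm_num) g2 (by convert g1 using 3 <;> ring)
      rw [this]; congr 1 <;> ring

end


/-! ## Generic partial dynamics and compactness -/

inductive Res (A : Type*) | die | fire | alive (a : A)

def stp {A : Type*} (ν : A → A → Res A) (c : ℤ → Option A) : ℤ → Option A := fun i =>
  match c (i-1), c i, c (i+1) with
  | some a, some b, some _ => match ν a b with
    | .alive s => some s
    | _ => none
  | _, _, _ => none

def fires {A : Type*} (ν : A → A → Res A) (c : ℤ → Option A) (i : ℤ) : Prop :=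
  ∃ a b d, c (i-1) = some a ∧ c i = some b ∧ c (i+1) = some d ∧ ν a b = .fire

theorem stp_some {A : Type*} {ν : A → A → Res A} {c : ℤ → Option A} {i : ℤ} {s : A} :
    stp ν c i = some s ↔ ∃ a b d, c (i-1) = some a ∧ c i = some b ∧ c (i+1) = some d ∧
      ν a b = .alive s := by
  unfold stp
  constructor
  · intro h
    split at h
    · rename_i a b d e1 e2 e3
      split at h
      · rename_i s' e4
        obtain rfl := Option.some.inj h
        exact ⟨a, b, d, e1, e2, e3, e4⟩
      · cases h
    · cases h
  · rintro ⟨a, b, d, e1, e2, e3, e4⟩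
    simp [e1, e2, e3, e4]

theorem ultra_const {A : Type*} [Finite A] (U : Ultrafilter ℕ) (f : ℕ → A) :
    ∃ a, ∀ᶠ n in (U : Filter ℕ), f n = a := by
  by_contra h
  push Not at h
  have h2 : ∀ a, ∀ᶠ n in (U : Filter ℕ), f n ≠ a := h
  obtain ⟨n, hn⟩ := (Filter.eventually_all.2 h2).exists
  exact hn (f n) rfl

def GP (P : ℤ → Prop) (u v : ℤ) : Prop := ∃ p, P p ∧ u ≤ p ∧ v ≤ -p

theorem GP_down (P : ℤ → Prop) : DownC (GP P) := by
  rintro u v u' v' ⟨p, hp, a, b⟩ h1 h2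
  exact ⟨p, hp, h1.trans a, h2.trans b⟩

theorem past_limit {A : Type*} [Finite A] (ν : A → A → Res A) (P : ℤ → Prop) (XT : ℕ → ℤ → ℤ → A)
    (h : ∀ T : ℕ, ∀ u v, GP P u v → -(T:ℤ) < u + v →
      ν (XT T (u-1) v) (XT T u (v-1)) = .alive (XT T u v)) :
    ∃ X : ℤ → ℤ → A, (∀ u v, GP P u v → ν (X (u-1) v) (X u (v-1)) = .alive (X u v)) ∧
      ∀ s : Finset (ℤ × ℤ), ∃ T, ∀ i ∈ s, X i.1 i.2 = XT T i.1 i.2 := by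
  let U : Ultrafilter ℕ := Filter.hyperfilter ℕ
  choose X hX using fun u v => ultra_const U (fun T => XT T u v)
  refine ⟨X, ?_, ?_⟩
  · intro u v hG
    have hT : ∀ᶠ T : ℕ in (U : Filter ℕ), -(T:ℤ) < u + v := by
      refine Filter.Eventually.filter_mono Nat.hyperfilter_le_atTop ?_
      filter_upwards [Filter.eventually_gt_atTop (-(u+v)).toNat] with T hT
      omega
    obtain ⟨T, a, b, c, d⟩ := (hT.and ((hX (u-1) v).and ((hX u (v-1)).and (hX u v)))).exists
    rw [← b, ← c, ← d]; exact h T u v hG a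
  · intro s
    obtain ⟨T, hT⟩ := ((Filter.eventually_all_finset s).2 (fun i _ => hX i.1 i.2)).exists
    exact ⟨T, fun i hi => (hT i hi).symm⟩

theorem back_alive {A : Type*} {ν : A → A → Res A} {c : ℤ → Option A} (j : ℕ) : ∀ (t : ℕ) (i p : ℤ),
    |i - p| ≤ j → ((stp ν)^[t + j] c p).isSome → ((stp ν)^[t] c i).isSome := by
  induction j with
  | zero =>
    intro t i p h1 h2
    have : i = p := by
      rw [abs_le] at h1; push_cast at h1; omega
    subst this; simpa using h2
  | succ j ih =>
    intro t i p h1 h2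
    rw [← add_assoc, Function.iterate_succ_apply'] at h2
    obtain ⟨s, hs⟩ := Option.isSome_iff_exists.1 h2
    obtain ⟨a, b, d, e1, e2, e3, -⟩ := stp_some.1 hs
    push_cast at h1
    rw [abs_le] at h1
    rcases lt_trichotomy i p with h | h | h
    · exact ih t i (p-1) (abs_le.2 (by omega)) (by rw [e1]; rfl)
    · exact ih t i p (abs_le.2 (by omega)) (by rw [e2]; rfl)
    · exact ih t i (p+1) (abs_le.2 (by omega)) (by rw [e3]; rfl)

theorem to_past {A : Type*} [Finite A] [Nonempty A] (ν : A → A → Res A) (P : Finset ℤ) (Q : (ℤ → A) → Prop)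
    (h : ∀ T : ℕ, ∃ (c : ℤ → Option A) (t : ℕ), T ≤ t ∧ (∀ p ∈ P, ((stp ν)^[t] c p).isSome) ∧
      ∀ f : ℤ → A, (∀ p ∈ P, (stp ν)^[t] c p = some (f p)) → Q f) :
    ∃ X : ℤ → ℤ → A, (∀ u v, GP (· ∈ P) u v → ν (X (u-1) v) (X u (v-1)) = .alive (X u v)) ∧
      Q (fun p => X p (-p)) := by
  choose c t htT hal hQ using h
  have a0 : A := Classical.arbitrary A
  let XT : ℕ → ℤ → ℤ → A := fun T u v => ((stp ν)^[(t T + u + v).toNat] (c T) u).getD a0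
  have al : ∀ (T : ℕ) u v, GP (· ∈ P) u v → -(T:ℤ) ≤ u + v →
      (stp ν)^[(t T + u + v).toNat] (c T) u = some (XT T u v) := by
    rintro T u v ⟨p, hp, h1, h2⟩ h3
    have := htT T
    have := back_alive (ν := ν) (c := c T) (-(u+v)).toNat ((t T + u + v).toNat) u p (abs_le.2 (by omega))
      (by rw [show (t T + u + v).toNat + (-(u+v)).toNat = t T by omega]; exact hal T p hp)
    obtain ⟨s, hs⟩ := Option.isSome_iff_exists.1 this
    simp only [XT, hs, Option.getD_some]
  obtain ⟨X, h1, h2⟩ := past_limit ν (· ∈ P) XT (by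
    intro T u v hG hT
    have := htT T
    have e := al T u v hG hT.le
    rw [show (t T + u + v).toNat = (t T + u + v - 1).toNat + 1 by omega, Function.iterate_succ_apply',
      stp_some] at e
    obtain ⟨a, b, d, e1, e2, -, e4⟩ := e
    have f1 := al T (u-1) v (GP_down _ _ _ _ _ hG (by omega) le_rfl) (by omega)
    have f2 := al T u (v-1) (GP_down _ _ _ _ _ hG le_rfl (by omega)) (by omega)
    rw [show (t T : ℤ) + (u - 1) + v = t T + u + v - 1 by ring, e1] at f1
    rw [show (t T : ℤ) + u + (v - 1) = t T + u + v - 1 by ring, e2] at f2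
    rw [← Option.some.inj f1, ← Option.some.inj f2, e4])
  refine ⟨X, h1, ?_⟩
  obtain ⟨T, e⟩ := h2 (P.image (fun p => (p, -p)))
  refine hQ T _ (fun p hp => ?_)
  have e1 := e (p, -p) (Finset.mem_image_of_mem _ hp)
  have f1 := al T p (-p) ⟨p, hp, le_rfl, le_rfl⟩ (by omega)
  rw [show ((t T : ℤ) + p + -p).toNat = t T by omega] at f1
  rw [f1, ← e1]

/-! ## The concrete local rule -/

structure Fst where
  R2 : Wire 2
  C2 : Wire 2
  D2 : Bool
  D2p : Bool
  R3 : Wire 3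
  C3 : Wire 3
  D3 : Bool
  D3p : Bool
  fh : Bool
  fv : Bool
  d0 : Bool
  d1 : Bool
  d0p : Bool
  d1p : Bool
  boom : Bool

theorem Fst.finite : Finite Fst := by
  have := Wire.finite 2
  have := Wire.finite 3
  let f : Fst → (Wire 2 × Wire 2 × Bool × Bool) × (Wire 3 × Wire 3 × Bool × Bool) ×
    (Bool × Bool × Bool × Bool) × (Bool × Bool × Bool) := fun s =>
    ((s.R2, s.C2, s.D2, s.D2p), (s.R3, s.C3, s.D3, s.D3p), (s.fh, s.fv, s.d0, s.d1), (s.d0p, s.d1p, s.boom))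
  apply Finite.of_injective f
  rintro ⟨⟩ ⟨⟩ h
  simp only [f, Prod.mk.injEq] at h
  simp only [Fst.mk.injEq]
  tauto

def dlt (W N : Fst) : ZMod (2^3) := W.R2.k + 1 - (N.C2.k + 1)
def isE1 (W N : Fst) (t : Ty) : Prop := t = .zero ∧ 2 * dlt W N = 4
def isE2 (W N : Fst) (t : Ty) : Prop := t = .zero ∧ dlt W N = 4
def isE3 (W N : Fst) (t : Ty) : Prop := t = .zero ∧ dlt W N = 0

def fC (W N : Fst) (t2 t3 : Ty) : Prop :=
  cellOK t2 W.R2 N.C2 N.D2p ∧ cellOK t3 W.R3 N.C3 N.D3p ∧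
  W.C2.c + 1 = N.C2.c ∧ N.R2.c + 1 = W.R2.c ∧ W.C3.c + 1 = N.C3.c ∧ N.R3.c + 1 = W.R3.c ∧
  (isE2 W N t2 ∨ isE3 W N t2 → W.fh = N.fv)

open Classical in
noncomputable def fX (W N : Fst) (t2 t3 : Ty) : Fst where
  R2 := updR t2 W.R2
  C2 := updR t2.swap N.C2
  D2 := updD t2 N.D2p
  D2p := W.D2
  R3 := updR t3 W.R3
  C3 := updR t3.swap N.C3
  D3 := updD t3 N.D3p
  D3p := W.D3
  fh := if isE1 W N t2 then W.fh || N.fv else if isE2 W N t2 then N.d1p else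
    if isE3 W N t2 then false else W.fh
  fv := if isE1 W N t2 then W.fh || N.fv else if isE2 W N t2 then N.d1p else
    if isE3 W N t2 then false else N.fv
  d0 := if isE1 W N t2 then W.fh || N.fv else N.d0p
  d1 := if isE1 W N t2 then N.d0p else N.d1p
  d0p := W.d0
  d1p := W.d1
  boom := decide (isE1 W N t2 ∧ W.R2.c ≠ 0 ∧ N.C2.c ≠ 0 ∧ N.d0p = true)

open Classical in
theorem fX_boom (W N : Fst) (t2 t3 : Ty) : (fX W N t2 t3).boom = true ↔
    isE1 W N t2 ∧ W.R2.c ≠ 0 ∧ N.C2.c ≠ 0 ∧ N.d0p = true := by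
  unfold fX; exact decide_eq_true_iff

theorem fC_unique {W N : Fst} {t2 t3 t2' t3' : Ty} (h : fC W N t2 t3) (h' : fC W N t2' t3') :
    t2 = t2' ∧ t3 = t3' := ⟨cellOK_unique h.1 h'.1, cellOK_unique h.2.1 h'.2.1⟩

/-- label systems -/
structure Lsys (Λ : Type*) where
  H : Λ → Λ → Prop
  V : Λ → Λ → Prop
  Val : Bool → Bool → Λ → Prop

/-- label conditions at a cell: row label `l`, column label `m` -/
def labOK {Λ : Type*} (L : Lsys Λ) (N : Fst) (t2 t3 : Ty) (l m : Λ) : Prop :=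
  L.Val (decide (N.C2.c ≠ 0)) (decide (N.C3.c ≠ 0)) m ∧
  (t2 = .zero → t3 = .zero → l = m) ∧
  (t2 = .neg1 → t3 = .zero → L.H m l) ∧
  (t2 = .zero → t3 = .neg1 → L.V m l)

abbrev FA (Λ : Type*) := Fst × Λ × Λ

def aliveTo {Λ : Type*} (L : Lsys Λ) (W N X : FA Λ) : Prop :=
  ∃ t2 t3, fC W.1 N.1 t2 t3 ∧ labOK L N.1 t2 t3 W.2.1 N.2.2 ∧
    X = (fX W.1 N.1 t2 t3, W.2.1, N.2.2)

open Classical in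
noncomputable def fnu {Λ : Type*} (L : Lsys Λ) (W N : FA Λ) : Res (FA Λ) :=
  if W.1.boom = true ∨ N.1.boom = true then .fire
  else if h : ∃ X, aliveTo L W N X then .alive h.choose
  else .die

theorem fnu_alive {Λ : Type*} {L : Lsys Λ} {W N X : FA Λ} :
    fnu L W N = .alive X ↔ W.1.boom = false ∧ N.1.boom = false ∧ aliveTo L W N X := by
  unfold fnu
  split_ifs with h1 h2
  · simp; intro h3 h4; simp [h3, h4] at h1
  · have hs := h2.choose_spec
    constructor
    · intro h; rw [Res.alive.injEq] at h
      rw [h] at hs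
      simp at h1
      exact ⟨h1.1, h1.2, hs⟩
    · rintro ⟨-, -, h⟩
      rw [Res.alive.injEq]
      obtain ⟨t2, t3, a, -, b⟩ := h
      obtain ⟨t2', t3', a', -, b'⟩ := hs
      obtain ⟨rfl, rfl⟩ := fC_unique a a'
      rw [b, b']
  · simp only [false_iff]
    rintro ⟨-, -, h⟩; exact h2 ⟨X, h⟩

theorem fnu_fire {Λ : Type*} {L : Lsys Λ} {W N : FA Λ} :
    fnu L W N = .fire ↔ W.1.boom = true ∨ N.1.boom = true := by
  unfold fnu
  split_ifs with h1 h2 <;> simp [h1]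

/-- data extracted from an infinite past -/
theorem past_data {Λ : Type*} {L : Lsys Λ} {G : ℤ → ℤ → Prop} (hD : DownC G) {X : ℤ → ℤ → FA Λ}
    (hX : ∀ u v, G u v → fnu L (X (u-1) v) (X u (v-1)) = .alive (X u v)) :
    ∃ (S2 : FS 2 G) (S3 : FS 3 G) (F : FU S2),
      (∀ u v, G u v → labOK L (X u (v-1)).1 (S2.ty u v) (S3.ty u v) (X (u-1) v).2.1 (X u (v-1)).2.2) ∧
      (∀ u v, G u v → (X u v).2.1 = (X (u-1) v).2.1 ∧ (X u v).2.2 = (X u (v-1)).2.2) ∧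
      (∀ u v, G u v → (X u v).1.C2.c = ((u - S2.x0 : ℤ) : ZMod 2)) ∧
      (∀ u v, G u v → (X u v).1.C3.c = ((u - S3.x0 : ℤ) : ZMod 3)) ∧
      (∀ u v, G u v → ((X u v).1.boom = true ↔ S2.ty u v = .zero ∧ ¬ (2:ℤ) ∣ u - S2.x0 ∧ ¬ (2:ℤ) ∣ v - S2.y0 ∧
         2 * (S2.k (u-1) v + 1 - (S2.kc u (v-1) + 1)) = 4 ∧ F.d0 (u-1) (v-1) = true)) := by
  have h0 : ∀ u v, ∃ t2 t3, G u v → fC (X (u-1) v).1 (X u (v-1)).1 t2 t3 ∧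
      labOK L (X u (v-1)).1 t2 t3 (X (u-1) v).2.1 (X u (v-1)).2.2 ∧
      X u v = (fX (X (u-1) v).1 (X u (v-1)).1 t2 t3, (X (u-1) v).2.1, (X u (v-1)).2.2) := by
    intro u v
    by_cases hG : G u v
    · obtain ⟨-, -, t2, t3, h⟩ := fnu_alive.1 (hX u v hG)
      exact ⟨t2, t3, fun _ => h⟩
    · exact ⟨.zero, .zero, fun h => (hG h).elim⟩
  choose t2 t3 h using h0
  have hf : ∀ u v, G u v → (X u v).1 = fX (X (u-1) v).1 (X u (v-1)).1 (t2 u v) (t3 u v) :=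
    fun u v hG => by conv_lhs => rw [(h u v hG).2.2]
  have gl : ∀ {u v}, G u v → G (u-1) v := fun {u v} hG => hD _ _ _ _ hG (by omega) le_rfl
  have gd : ∀ {u v}, G u v → G u (v-1) := fun {u v} hG => hD _ _ _ _ hG le_rfl (by omega)
  have p2 : ∀ u v, G u v → (X u (v-1)).1.D2p = (X (u-1) (v-1)).1.D2 :=
    fun u v hG => by rw [hf _ _ (gd hG)]; rfl
  have p3 : ∀ u v, G u v → (X u (v-1)).1.D3p = (X (u-1) (v-1)).1.D3 :=
    fun u v hG => by rw [hf _ _ (gd hG)]; rfl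
  have q0 : ∀ u v, G u v → (X u (v-1)).1.d0p = (X (u-1) (v-1)).1.d0 :=
    fun u v hG => by rw [hf _ _ (gd hG)]; rfl
  have q1 : ∀ u v, G u v → (X u (v-1)).1.d1p = (X (u-1) (v-1)).1.d1 :=
    fun u v hG => by rw [hf _ _ (gd hG)]; rfl
  obtain ⟨S2, ht2, hk2, hkc2, hc2, hr2⟩ := exists_FS (p := 2) le_rfl hD t2 (fun u v => (X u v).1.R2)
    (fun u v => (X u v).1.C2) (fun u v => (X u (v-1)).1.D2p) (fun u v hG => (h u v hG).1.1)
    (fun u v hG => by rw [hf u v hG]; rfl) (fun u v hG => by rw [hf u v hG]; rfl)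
    (fun u v hG => (h u v hG).1.2.2.1) (fun u v hG => (h u v hG).1.2.2.2.1)
  obtain ⟨S3, ht3, hk3, hkc3, hc3, hr3⟩ := exists_FS (p := 3) (by norm_num) hD t3 (fun u v => (X u v).1.R3)
    (fun u v => (X u v).1.C3) (fun u v => (X u (v-1)).1.D3p) (fun u v hG => (h u v hG).1.2.1)
    (fun u v hG => by rw [hf u v hG]; rfl) (fun u v hG => by rw [hf u v hG]; rfl)
    (fun u v hG => (h u v hG).1.2.2.2.2.1) (fun u v hG => (h u v hG).1.2.2.2.2.2.1)
  have dl : ∀ u v, S2.k (u-1) v + 1 - (S2.kc u (v-1) + 1) = dlt (X (u-1) v).1 (X u (v-1)).1 := by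
    intro u v; rw [hk2, hkc2]; rfl
  have z1 : ∀ x : ZMod (2^3), 2 * x = 4 → x ≠ 4 ∧ x ≠ 0 := by decide
  have z2 : (4 : ZMod (2^3)) ≠ 0 := by decide
  refine ⟨S2, S3, {
    fh := fun u v => (X u v).1.fh
    fv := fun u v => (X u v).1.fv
    d0 := fun u v => (X u v).1.d0
    d1 := fun u v => (X u v).1.d1
    pass := ?_, e1 := ?_, e2 := ?_, e3 := ?_ }, ?_, ?_, hc2, hc3, ?_⟩
  · intro u v hG ht
    rw [ht2] at ht
    rw [← q0 u v hG, ← q1 u v hG, hf u v hG]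
    simp [fX, isE1, isE2, isE3, ht]
  · intro u v hG ht hd
    rw [ht2] at ht
    rw [dl] at hd
    rw [← q0 u v hG, hf u v hG]
    simp [fX, isE1, ht, hd]
  · intro u v hG ht hd
    rw [ht2] at ht
    rw [dl] at hd
    refine ⟨(h u v hG).1.2.2.2.2.2.2 (Or.inl ⟨ht, hd⟩), ?_⟩
    have n1 : ¬ 2 * dlt (X (u-1) v).1 (X u (v-1)).1 = 4 := fun h => (z1 _ h).1 hd
    rw [← q0 u v hG, ← q1 u v hG, hf u v hG]
    simp [fX, isE1, isE2, ht, n1]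
    simp [hd]
  · intro u v hG ht hd
    rw [ht2] at ht
    rw [dl] at hd
    refine ⟨(h u v hG).1.2.2.2.2.2.2 (Or.inr ⟨ht, hd⟩), ?_⟩
    have n1 : ¬ 2 * dlt (X (u-1) v).1 (X u (v-1)).1 = 4 := fun h => (z1 _ h).2 hd
    have n2 : ¬ dlt (X (u-1) v).1 (X u (v-1)).1 = 4 := fun h => z2 (h.symm.trans hd)
    rw [← q0 u v hG, ← q1 u v hG, hf u v hG]
    simp [fX, isE1, isE2, isE3, ht, n1, n2]
    simp [hd]
  · intro u v hG; rw [ht2, ht3]; exact (h u v hG).2.1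
  · intro u v hG; constructor
    · conv_lhs => rw [(h u v hG).2.2]
    · conv_lhs => rw [(h u v hG).2.2]
  · intro u v hG
    have c1 : (X (u-1) v).1.R2.c ≠ 0 ↔ ¬ (2:ℤ) ∣ v - S2.y0 := by
      rw [hr2 _ _ (gl hG), Ne, ZMod.intCast_zmod_eq_zero_iff_dvd]; rfl
    have c2 : (X u (v-1)).1.C2.c ≠ 0 ↔ ¬ (2:ℤ) ∣ u - S2.x0 := by
      rw [hc2 _ _ (gd hG), Ne, ZMod.intCast_zmod_eq_zero_iff_dvd]; rfl
    have e : S2.ty u v = t2 u v := by rw [ht2]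
    change _ ↔ _ ∧ _ ∧ _ ∧ _ ∧ (X (u-1) (v-1)).1.d0 = true
    rw [e, hf u v hG, dl, ← q0 u v hG]
    rw [fX_boom, c1, c2]; unfold isE1; tauto

/-- (N5) -/
theorem N5a {Λ : Type*} [Finite Λ] [Nonempty Λ] (L : Lsys Λ) (k : ℤ) : ∃ T0 : ℕ, ∀ (c : ℤ → Option (FA Λ)) (t : ℕ),
    T0 ≤ t → fires (fnu L) ((stp (fnu L))^[t] c) k → (stp (fnu L))^[t+1] c 0 = none := by
  by_contra hcon
  push Not at hcon
  have := Fst.finite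
  have : Nonempty Fst := ⟨⟨⟨0,0,0,true⟩,⟨0,0,0,true⟩,true,true,⟨0,0,0,true⟩,⟨0,0,0,true⟩,true,true,true,true,true,true,true,true,true⟩⟩
  let P : Finset ℤ := {k, k-1, 0, -1}
  obtain ⟨X, hX, hQ, n0, n1⟩ := to_past (fnu L) P (fun f => ((f k).1.boom = true ∨ (f (k-1)).1.boom = true) ∧
      (f 0).1.boom = false ∧ (f (-1)).1.boom = false) (by
    intro T
    obtain ⟨c, t, h1, ⟨a, b, d, e1, e2, e3, e4⟩, h3⟩ := hcon T
    obtain ⟨s, hs⟩ := Option.ne_none_iff_exists'.1 h3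
    rw [Function.iterate_succ_apply'] at hs
    obtain ⟨a', b', d', e1', e2', e3', e4'⟩ := stp_some.1 hs
    rw [show (0:ℤ) - 1 = -1 by norm_num] at e1'
    refine ⟨c, t, h1, ?_, ?_⟩
    · intro p hp
      simp only [P, Finset.mem_insert, Finset.mem_singleton] at hp
      rcases hp with rfl | rfl | rfl | rfl
      · rw [e2]; rfl
      · rw [e1]; rfl
      · rw [e2']; rfl
      · rw [e1']; rfl
    · intro f hf
      have f1 := hf k (by simp [P])
      have f2 := hf (k-1) (by simp [P])
      have f3 := hf 0 (by simp [P])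
      have f4 := hf (-1) (by simp [P])
      rw [e2] at f1; rw [e1] at f2; rw [e2'] at f3; rw [e1'] at f4
      rw [← Option.some.inj f1, ← Option.some.inj f2, ← Option.some.inj f3, ← Option.some.inj f4]
      obtain ⟨g1, g2, -⟩ := fnu_alive.1 e4'
      exact ⟨(fnu_fire.1 e4).symm, g2, g1⟩)
  have hD := GP_down (· ∈ P)
  obtain ⟨S2, S3, F, -, -, -, -, hb⟩ := past_data hD hX
  have hS := fun n => forced S2 hD le_rfl n
  have key : ∀ q ∈ P, ∀ q' ∈ P, Even (q' - q) → (X q (-q)).1.boom = true → (X q' (-q')).1.boom = true := by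
    intro q hq q' hq' he hbq
    have g : GP (· ∈ P) q (-q) := ⟨q, hq, le_rfl, le_rfl⟩
    have g' : GP (· ∈ P) q' (-q') := ⟨q', hq', le_rfl, le_rfl⟩
    have b := (hb _ _ g).1 hbq
    obtain ⟨b1, b2, b3, b4, b5⟩ := b
    obtain ⟨r1, r2, r3⟩ := boom_all F hD hS he g (by convert g' using 1 <;> ring) b1 b2 b3 b4
    rw [show q + (q' - q) = q' by ring, show -q - (q' - q) = -q' by ring] at r1 r2 r3
    refine (hb _ _ g').2 ⟨r1, ?_, ?_, r2, r3.trans b5⟩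
    · obtain ⟨m, hm⟩ := he; omega
    · obtain ⟨m, hm⟩ := he; omega
  have key2 : ∀ q ∈ P, (X q (-q)).1.boom = true → False := by
    intro q hq hbq
    rcases Int.even_or_odd q with h | h
    · have := key q hq 0 (by simp [P]) (by simpa using h) hbq
      rw [n0] at this; cases this
    · have := key q hq (-1) (by simp [P]) (by obtain ⟨m, rfl⟩ := h; exact ⟨-1-m, by ring⟩) hbq
      rw [n1] at this; cases this
  rcases hQ with h | h
  · exact key2 k (by simp [P]) h
  · exact key2 (k-1) (by simp [P]) h

theorem N5 {Λ : Type*} [Finite Λ] [Nonempty Λ] (L : Lsys Λ) (n : ℕ) : ∃ T0 : ℕ, ∀ (c : ℤ → Option (FA Λ)) (t : ℕ) (k : ℤ),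
    T0 ≤ t → |k| ≤ n → fires (fnu L) ((stp (fnu L))^[t] c) k → (stp (fnu L))^[t+1] c 0 = none := by
  choose T hT using fun k => N5a L k
  refine ⟨(Finset.Icc (-(n:ℤ)) n).sup T, fun c t k ht hk hf => hT k c t (le_trans ?_ ht) hf⟩
  exact Finset.le_sup (f := T) (Finset.mem_Icc.2 (abs_le.1 hk))

theorem crt_low (x2 x3 : ℤ) (a b : ℕ) (B : ℤ) : ∃ u ≤ B, (((2:ℕ):ℤ)^a ∣ u - x2 ∧ ¬ ((2:ℕ):ℤ)^(a+1) ∣ u - x2) ∧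
    (((3:ℕ):ℤ)^b ∣ u - x3 ∧ ¬ ((3:ℕ):ℤ)^(b+1) ∣ u - x3) := by
  obtain ⟨u2, -, h1, h2⟩ := low_exact (p := 2) le_rfl x2 0 a
  obtain ⟨u3, -, h3, h4⟩ := low_exact (p := 3) (by norm_num) x3 0 b
  have hc : IsCoprime (((2:ℕ):ℤ)^(a+1)) (((3:ℕ):ℤ)^(b+1)) :=
    IsCoprime.pow (by norm_num)
  obtain ⟨α, β, hαβ⟩ := hc
  obtain ⟨u, hu, c, hc⟩ := low_class B (u2 + α * ((2:ℕ):ℤ)^(a+1) * (u3 - u2)) (((2:ℕ):ℤ)^(a+1) * ((3:ℕ):ℤ)^(b+1)) (by positivity)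
  have e2 : ((2:ℕ):ℤ)^(a+1) ∣ u - u2 :=
    ⟨((3:ℕ):ℤ)^(b+1) * c + α * (u3 - u2), by linear_combination hc⟩
  have e3 : ((3:ℕ):ℤ)^(b+1) ∣ u - u3 :=
    ⟨((2:ℕ):ℤ)^(a+1) * c - β * (u3 - u2), by linear_combination hc + (u3 - u2) * hαβ⟩
  have s2 : ∀ j ≤ a+1, (((2:ℕ):ℤ)^j ∣ u - x2 ↔ ((2:ℕ):ℤ)^j ∣ u2 - x2) := fun j hj => by
    rw [show u - x2 = (u - u2) + (u2 - x2) by ring]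
    exact Int.dvd_add_right ((pow_dvd_pow _ hj).trans e2)
  have s3 : ∀ j ≤ b+1, (((3:ℕ):ℤ)^j ∣ u - x3 ↔ ((3:ℕ):ℤ)^j ∣ u3 - x3) := fun j hj => by
    rw [show u - x3 = (u - u3) + (u3 - x3) by ring]
    exact Int.dvd_add_right ((pow_dvd_pow _ hj).trans e3)
  refine ⟨u, hu, ⟨(s2 _ (by omega)).2 h1, fun h => h2 ((s2 _ le_rfl).1 h)⟩,
    (s3 _ (by omega)).2 h3, fun h => h4 ((s3 _ le_rfl).1 h)⟩

/-- a labelling of a box -/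
def boxLab {Λ : Type*} (L : Lsys Λ) (n : ℕ) (lab : ℕ → ℕ → Λ) : Prop :=
  ∀ a < n, ∀ b < n, L.Val (decide (a = 0)) (decide (b = 0)) (lab a b) ∧
    (a + 1 < n → L.H (lab a b) (lab (a+1) b)) ∧ (b + 1 < n → L.V (lab a b) (lab a (b+1)))

/-- (N3) -/
theorem N3 {Λ : Type*} [Finite Λ] [Nonempty Λ] (L : Lsys Λ) (n : ℕ) (hn : ¬ ∃ lab, boxLab L n lab) :
    ∃ T : ℕ, ∀ c : ℤ → Option (FA Λ), (stp (fnu L))^[T] c 0 = none := by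
  by_contra hcon
  push Not at hcon
  apply hn
  have := Fst.finite
  have : Nonempty Fst := ⟨⟨⟨0,0,0,true⟩,⟨0,0,0,true⟩,true,true,⟨0,0,0,true⟩,⟨0,0,0,true⟩,true,true,true,true,true,true,true,true,true⟩⟩
  obtain ⟨X, hX, -⟩ := to_past (fnu L) {0} (fun _ => True) (by
    intro T
    obtain ⟨c, hc⟩ := hcon T
    refine ⟨c, T, le_rfl, ?_, by simp⟩
    intro p hp
    rw [Finset.mem_singleton.1 hp]
    exact Option.isSome_iff_ne_none.2 hc)
  have hD := GP_down (· ∈ ({0} : Finset ℤ))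
  have hG : ∀ {u v : ℤ}, u ≤ 0 → v ≤ 0 → GP (· ∈ ({0} : Finset ℤ)) u v :=
    fun h1 h2 => ⟨0, by simp, h1, by simpa using h2⟩
  obtain ⟨S2, S3, F, hlab, hcon, hc2, hc3, -⟩ := past_data hD hX
  obtain ⟨x2, y2, ⟨hx2, hy2⟩, ex2⟩ := forced S2 hD le_rfl (n+1)
  obtain ⟨x3, y3, ⟨hx3, hy3⟩, ex3⟩ := forced S3 hD (by norm_num) (n+1)
  let B : ℤ := -(mg 2 n + mg 3 n)
  have hB2 : ∀ i ≤ n, ∀ u ≤ B, u + mg 2 i ≤ 0 := by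
    intro i hi u hu
    have := mg_mono 2 hi; have := mg_nonneg 3 n
    simp only [B] at hu; omega
  have hB3 : ∀ i ≤ n, ∀ u ≤ B, u + mg 3 i ≤ 0 := by
    intro i hi u hu
    have := mg_mono 3 hi; have := mg_nonneg 2 n
    simp only [B] at hu; omega
  have hB0 : ∀ u ≤ B, u ≤ 0 := fun u hu => by have := hB2 0 (by omega) u hu; simpa [mg] using this
  choose uu hu1 hu2 hu3 using fun a b => crt_low x2 x3 a b B
  choose vv hv1 hv2 hv3 using fun a b => crt_low y2 y3 a b B
  -- labels are constant on rows and columns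
  have crow : ∀ v ≤ 0, ∀ u ≤ 0, (X u v).2.1 = (X 0 v).2.1 := by
    intro v hv u hu
    refine (seg_const (fun w => (X w v).2.1) u 0 hu ?_).symm
    intro w _ h2; exact (hcon w v (hG h2 hv)).1
  have ccol : ∀ u ≤ 0, ∀ v ≤ 0, (X u v).2.2 = (X u 0).2.2 := by
    intro u hu v hv
    refine (seg_const (fun w => (X u w).2.2) v 0 hv ?_).symm
    intro w _ h2; exact (hcon u w (hG hu h2)).2
  -- types
  have tz : ∀ {p : ℕ} {S : FS p (GP (· ∈ ({0} : Finset ℤ)))} {x y : ℤ} {i : ℕ} {u v : ℤ}, exR S x y i → u + mg p i ≤ 0 →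
      v + mg p i ≤ 0 → ((p:ℤ)^i ∣ u - x ∧ ¬ (p:ℤ)^(i+1) ∣ u - x) → ((p:ℤ)^i ∣ v - y ∧ ¬ (p:ℤ)^(i+1) ∣ v - y) →
      S.ty u v = .zero := fun h h1 h2 h3 h4 => (h _ _ (hG h1 h2) h3.1 h4.1 h4.2).1 h3.2
  have tn : ∀ {p : ℕ} {S : FS p (GP (· ∈ ({0} : Finset ℤ)))} {x y : ℤ} {i : ℕ} {u v : ℤ}, exR S.swap y x i → u + mg p i ≤ 0 →
      v + mg p i ≤ 0 → ((p:ℤ)^i ∣ u - x ∧ ¬ (p:ℤ)^(i+1) ∣ u - x) → ((p:ℤ)^(i+1) ∣ v - y ∧ ¬ (p:ℤ)^(i+1+1) ∣ v - y) →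
      S.ty u v = .neg1 := fun h h1 h2 h3 h4 => (exC_neg h (hG h1 h2) h3.1 h3.2 h4.1).1 h4.2
  have eqz : ∀ a ≤ n, ∀ b ≤ n, (X 0 (vv a b)).2.1 = (X (uu a b) 0).2.2 := by
    intro a ha b hb
    have := (hlab (uu a b) (vv a b) (hG (hB0 _ (hu1 a b)) (hB0 _ (hv1 a b)))).2.1
      (tz (ex2 a (by omega)).1 (hB2 a ha _ (hu1 a b)) (hB2 a ha _ (hv1 a b)) (hu2 a b) (hv2 a b))
      (tz (ex3 b (by omega)).1 (hB3 b hb _ (hu1 a b)) (hB3 b hb _ (hv1 a b)) (hu3 a b) (hv3 a b))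
    have := hB0 _ (hu1 a b)
    have := hB0 _ (hv1 a b)
    rwa [crow _ (by omega) _ (by omega), ccol _ (by omega) _ (by omega)] at *
  refine ⟨fun a b => (X (uu a b) 0).2.2, fun a ha b hb => ⟨?_, ?_, ?_⟩⟩
  · have g0 := hB0 _ (hu1 a b)
    have := (hlab (uu a b) 0 (hG g0 le_rfl)).1
    rw [ccol _ g0 _ (by omega), hc2 _ _ (hG g0 (by omega)), hc3 _ _ (hG g0 (by omega))] at this
    convert this using 1
    · rw [decide_eq_decide, Ne, ZMod.intCast_zmod_eq_zero_iff_dvd, ← dvd_shift hx2]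
      constructor
      · rintro rfl; simpa using (hu2 0 b).2
      · intro h; by_contra h0
        exact h ((dvd_pow_self _ h0).trans (hu2 a b).1)
    · rw [decide_eq_decide, Ne, ZMod.intCast_zmod_eq_zero_iff_dvd, ← dvd_shift hx3]
      constructor
      · rintro rfl; simpa using (hu3 a 0).2
      · intro h; by_contra h0
        exact h ((dvd_pow_self _ h0).trans (hu3 a b).1)
  · intro ha1
    have g0 := hB0 _ (hu1 a b)
    have g1 := hB0 _ (hv1 (a+1) b)
    have := (hlab (uu a b) (vv (a+1) b) (hG g0 g1)).2.2.1
      (tn (ex2 a (by omega)).2 (hB2 a (by omega) _ (hu1 a b)) (hB2 a (by omega) _ (hv1 _ b)) (hu2 a b) (hv2 (a+1) b))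
      (tz (ex3 b (by omega)).1 (hB3 b (by omega) _ (hu1 a b)) (hB3 b (by omega) _ (hv1 _ b)) (hu3 a b) (hv3 _ b))
    rwa [crow _ (by omega) _ (by omega), ccol _ (by omega) _ (by omega), eqz _ (by omega) _ (by omega)] at this
  · intro hb1
    have g0 := hB0 _ (hu1 a b)
    have g1 := hB0 _ (hv1 a (b+1))
    have := (hlab (uu a b) (vv a (b+1)) (hG g0 g1)).2.2.2
      (tz (ex2 a (by omega)).1 (hB2 a (by omega) _ (hu1 a b)) (hB2 a (by omega) _ (hv1 a _)) (hu2 a b) (hv2 a _))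
      (tn (ex3 b (by omega)).2 (hB3 b (by omega) _ (hu1 a b)) (hB3 b (by omega) _ (hv1 a _)) (hu3 a b) (hv3 a (b+1)))
    rwa [crow _ (by omega) _ (by omega), ccol _ (by omega) _ (by omega), eqz _ (by omega) _ (by omega)] at this


/-! ## The canonical solution and (N4) -/

def oddfl (n : ℤ) : ℤ := 2 * ((n-1)/2) + 1

def fbit (al be : ℤ) : Bool :=
  if (al - be) % 4 ≠ 0 then decide (-3 ≤ (al + be) / 4)
  else if (al - be) % 8 = 4 then decide (-2 ≤ (al + be) / 8) else false

theorem fbit_comm (a b : ℤ) : fbit a b = fbit b a := by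
  unfold fbit
  rw [add_comm b a]
  have h1 : (a - b) % 4 ≠ 0 ↔ (b - a) % 4 ≠ 0 := by omega
  have h2 : (a - b) % 8 = 4 ↔ (b - a) % 8 = 4 := by omega
  simp only [h1, h2]

def cfh (u v : ℤ) : Bool := fbit (oddfl (u / 2^(lvl 2 v))) (v / 2^(lvl 2 v))

def cd (i : ℤ) (u v : ℤ) : Bool :=
  if lvl 2 (u - v) = 0 then false else decide (-3 ≤ (u+v) / 2^(lvl 2 (u-v) + 1) - i)

def cboom (u v : ℤ) : Bool := decide (u % 2 = 1 ∧ v % 2 = 1 ∧ (u - v) % 4 = 2 ∧ -8 ≤ u + v)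

theorem fl_not {t : ℤ} {c : ℕ} (hc : c ≠ 0) (h2 : t % 2 = 0) (h : ¬ (2:ℤ)^(c+1) ∣ t) :
    (t - 2) / 2^(c+1) = t / 2^(c+1) := by
  obtain ⟨s, rfl⟩ : ∃ s, t = 2 * s := ⟨t / 2, by omega⟩
  rw [pow_succ, mul_comm _ (2:ℤ)] at *
  rw [show 2 * s - 2 = 2 * (s - 1) by ring, Int.mul_ediv_mul_of_pos _ _ (by norm_num),
    Int.mul_ediv_mul_of_pos _ _ (by norm_num)]
  exact ediv_sub_one_of_not_dvd (by positivity) (fun h' => h (mul_dvd_mul_left _ h'))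

theorem fl_dvd {t : ℤ} {c : ℕ} (h : (2:ℤ)^(c+1) ∣ t) :
    (t - 2) / 2^(c+1) = t / 2^(c+1) - 1 := by
  obtain ⟨s, rfl⟩ : ∃ s, t = 2 * s := by
    obtain ⟨k, rfl⟩ := h; exact ⟨2^c * k, by ring⟩
  rw [pow_succ, mul_comm _ (2:ℤ)] at *
  rw [show 2 * s - 2 = 2 * (s - 1) by ring, Int.mul_ediv_mul_of_pos _ _ (by norm_num),
    Int.mul_ediv_mul_of_pos _ _ (by norm_num)]
  exact ediv_sub_one_of_dvd (by positivity) ((mul_dvd_mul_iff_left (by norm_num)).1 h)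

theorem cd_pass {u v : ℤ} (huv : u - v ≠ 0) (i : ℤ) (h : ¬ (2:ℤ)^(lvl 2 (u-v) + 1) ∣ u + v) :
    cd i (u-1) (v-1) = cd i u v := by
  unfold cd
  rw [show u - 1 - (v-1) = u - v by ring, show u - 1 + (v-1) = u + v - 2 by ring]
  split_ifs with h0
  · rfl
  · have h1 : (2:ℤ)^1 ∣ u - v := by
      have := (lvl_dvd (p := 2) huv 1).2 (by omega)
      simpa using this
    rw [fl_not h0 (by rw [pow_one] at h1; omega) h]

theorem cd_swap (i u v : ℤ) : cd i u v = cd i v u := by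
  unfold cd
  have : lvl 2 (u - v) = lvl 2 (v - u) := by
    unfold lvl padicValInt; rw [show (u-v).natAbs = (v-u).natAbs by omega]
  rw [this, add_comm u v]

theorem d2 {v : ℤ} (hv : v ≠ 0) (n : ℕ) : (2:ℤ)^n ∣ v ↔ n ≤ lvl 2 v := by
  have := lvl_dvd (p := 2) hv n
  simpa using this

theorem odd_quot {v : ℤ} (hv : v ≠ 0) : ∃ al : ℤ, al % 2 = 1 ∧ v = 2^(lvl 2 v) * al := by
  obtain ⟨al, h⟩ := (d2 hv (lvl 2 v)).2 le_rfl
  refine ⟨al, ?_, h⟩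
  by_contra h0
  have : (2:ℤ)^(lvl 2 v + 1) ∣ v := by
    refine ⟨al / 2, ?_⟩
    rw [pow_succ, mul_assoc, show 2 * (al / 2) = al by omega]; exact h
  rw [d2 hv] at this
  omega

theorem pass_lt {u v : ℤ} (hu : u ≠ 0) (hv : v ≠ 0) (huv : u - v ≠ 0) (h : lvl 2 u < lvl 2 v) :
    cfh u v = cfh (u-1) v ∧ cfh v u = cfh (v-1) u ∧ ∀ i, cd i u v = cd i (u-1) (v-1) := by
  have e1 : (2:ℤ)^(lvl 2 u) ∣ v := (d2 hv _).2 h.le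
  have e2 : (2:ℤ)^(lvl 2 u + 1) ∣ v := (d2 hv _).2 h
  have e3 : (2:ℤ)^(lvl 2 u) ∣ u := (d2 hu _).2 le_rfl
  have e4 : ¬ (2:ℤ)^(lvl 2 u + 1) ∣ u := by rw [d2 hu]; omega
  refine ⟨?_, ?_, fun i => (cd_pass huv i ?_).symm⟩
  · unfold cfh
    rw [ediv_sub_one_of_not_dvd (by positivity) (by rw [d2 hu]; omega)]
  · unfold cfh
    rw [ediv_sub_one_of_dvd (by positivity) e1]
    congr 1
    obtain ⟨s, hs⟩ := e2
    have : v / 2^(lvl 2 u) = 2 * s := by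
      apply Int.ediv_eq_of_eq_mul_right (by positivity); rw [hs]; ring
    rw [this]; unfold oddfl; omega
  · have : lvl 2 (u - v) = lvl 2 u := by
      have h1 := (d2 huv (lvl 2 u)).1 (dvd_sub e3 e1)
      have h2 : ¬ lvl 2 u + 1 ≤ lvl 2 (u - v) := by
        rw [← d2 huv, dvd_sub_left e2]; exact e4
      omega
    rw [this, dvd_add_left e2]; exact e4

theorem pass_gt {u v : ℤ} (hu : u ≠ 0) (hv : v ≠ 0) (huv : u - v ≠ 0) (h : lvl 2 v < lvl 2 u) :
    cfh u v = cfh (u-1) v ∧ cfh v u = cfh (v-1) u ∧ ∀ i, cd i u v = cd i (u-1) (v-1) := by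
  obtain ⟨a, b, c⟩ := pass_lt hv hu (by omega) h
  exact ⟨b, a, fun i => by rw [cd_swap, c, cd_swap]⟩

/-- facts at a cell with equal levels -/
theorem eq_lvl {u v : ℤ} (hu : u ≠ 0) (hv : v ≠ 0) (huv : u - v ≠ 0) (h : lvl 2 u = lvl 2 v) :
    ∃ al be : ℤ, al % 2 = 1 ∧ be % 2 = 1 ∧ u = 2^(lvl 2 v) * al ∧ v = 2^(lvl 2 v) * be ∧
      cfh u v = fbit al be ∧ cfh v u = fbit al be ∧ cfh (u-1) v = fbit (al-2) be ∧
      cfh (v-1) u = fbit al (be-2) := by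
  obtain ⟨al, ha, hal⟩ := odd_quot hu
  obtain ⟨be, hb, hbe⟩ := odd_quot hv
  have e1 : u / 2^(lvl 2 v) = al := by
    apply Int.ediv_eq_of_eq_mul_right (by positivity); rw [← h]; exact hal
  have e2 : v / 2^(lvl 2 v) = be := by
    apply Int.ediv_eq_of_eq_mul_right (by positivity); exact hbe
  have o1 : ∀ x : ℤ, x % 2 = 1 → oddfl x = x := by intro x hx; unfold oddfl; omega
  have o2 : ∀ x : ℤ, x % 2 = 1 → oddfl (x-1) = x-2 := by intro x hx; unfold oddfl; omega
  refine ⟨al, be, ha, hb, by rw [← h]; exact hal, hbe, ?_, ?_, ?_, ?_⟩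
  · unfold cfh; rw [e1, e2, o1 _ ha]
  · unfold cfh; rw [h, e1, e2, o1 _ hb, fbit_comm]
  · unfold cfh; rw [ediv_sub_one_of_dvd (by positivity) (by rw [d2 hu]; omega), e1, e2, o2 _ ha]
  · unfold cfh; rw [h, ediv_sub_one_of_dvd (by positivity) (by rw [d2 hv]), e1, e2, o2 _ hb, fbit_comm]

theorem lvl_of {x : ℤ} {n : ℕ} {a : ℤ} (h : x = 2^n * a) (ha : a % 2 = 1) : lvl 2 x = n := by
  apply lvl_eq (p := 2)
  · exact ⟨a, by simpa using h⟩
  · rintro ⟨c, hc⟩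
    rw [h, pow_succ] at hc
    have : a = 2 * c := by
      have h2 : (2:ℤ)^n ≠ 0 := by positivity
      apply mul_left_cancel₀ h2
      push_cast at hc
      rw [hc]; ring
    omega

theorem nd_of {x : ℤ} {n m : ℕ} {a : ℤ} (h : x = 2^n * a) (ha : a % 2 = 1) (hm : n < m) : ¬ (2:ℤ)^m ∣ x := by
  have hx : x ≠ 0 := by
    rw [h]; refine mul_ne_zero (by positivity) (by rintro rfl; simp at ha)
  rw [d2 hx, lvl_of h ha]; omega

theorem c_e1 {u v al be : ℤ} {l : ℕ} (ha : al % 2 = 1) (hb : be % 2 = 1)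
    (hu : u = 2^l * al) (hv : v = 2^l * be) (h : (al - be) % 4 = 2) :
    fbit al be = (fbit (al-2) be || fbit al (be-2)) ∧ cd 0 u v = fbit al be ∧
    cd 1 u v = cd 0 (u-1) (v-1) := by
  obtain ⟨m, hm⟩ : ∃ m, al - be = 2 * m := ⟨(al-be)/2, by omega⟩
  have hl : lvl 2 (u - v) = l + 1 := lvl_of (a := m) (by rw [hu, hv, ← mul_sub, hm]; ring) (by omega)
  obtain ⟨j, hj⟩ : ∃ j, al + be = 4 * j := ⟨(al+be)/4, by omega⟩
  have ht : u + v = 2^(l+1+1) * j := by rw [hu, hv, ← mul_add, hj]; ring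
  have hd : (u + v) / 2^(l+1+1) = j := by rw [ht]; exact Int.mul_ediv_cancel_left _ (by positivity)
  refine ⟨?_, ?_, ?_⟩
  · unfold fbit
    rw [if_pos (show (al - be) % 4 ≠ 0 by omega), if_neg (show ¬ (al - 2 - be) % 4 ≠ 0 by omega),
      if_neg (show ¬ (al - (be - 2)) % 4 ≠ 0 by omega)]
    rcases (by omega : (al - 2 - be) % 8 = 4 ∧ ¬ (al - (be-2)) % 8 = 4 ∨ ¬ (al - 2 - be) % 8 = 4 ∧ (al - (be-2)) % 8 = 4) with h | h
    · rw [if_pos h.1, if_neg h.2, Bool.or_false, decide_eq_decide]; omega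
    · rw [if_neg h.1, if_pos h.2, Bool.false_or, decide_eq_decide]; omega
  · unfold cd fbit
    rw [hl, if_neg (by omega), if_pos (by omega), hd, decide_eq_decide]; omega
  · unfold cd
    rw [show u - 1 - (v-1) = u - v by ring, show u - 1 + (v-1) = u + v - 2 by ring]
    rw [hl, if_neg (by omega), if_neg (by omega), fl_dvd ⟨j, ht⟩, sub_zero]

theorem c_e2 {u v al be : ℤ} {l : ℕ} (huv : u - v ≠ 0) (ha : al % 2 = 1) (hb : be % 2 = 1)
    (hu : u = 2^l * al) (hv : v = 2^l * be) (h : (al - be) % 4 = 0) :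
    fbit (al-2) be = fbit al (be-2) ∧ (∀ i, cd i u v = cd i (u-1) (v-1)) ∧
    ((al - be) % 8 = 4 → fbit al be = cd 1 (u-1) (v-1)) ∧
    ((al - be) % 8 = 0 → fbit al be = false) := by
  obtain ⟨m, hm⟩ : ∃ m, al - be = 4 * m := ⟨(al-be)/4, by omega⟩
  have hl : l + 2 ≤ lvl 2 (u - v) := by
    rw [← d2 huv]; exact ⟨m, by rw [hu, hv, ← mul_sub, hm]; ring⟩
  obtain ⟨j, hj⟩ : ∃ j, al + be = 2 * j := ⟨(al+be)/2, by omega⟩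
  have ht : u + v = 2^(l+1) * j := by rw [hu, hv, ← mul_add, hj]; ring
  have hp : ∀ i, cd i (u-1) (v-1) = cd i u v := fun i =>
    cd_pass huv i (nd_of ht (by omega) (by omega))
  refine ⟨?_, fun i => (hp i).symm, ?_, ?_⟩
  · unfold fbit
    rw [if_pos (by omega), if_pos (by omega), decide_eq_decide]; omega
  · intro h8
    rw [hp]
    have hl : lvl 2 (u - v) = l + 2 := lvl_of (a := m) (by rw [hu, hv, ← mul_sub, hm]; ring) (by omega)
    unfold cd fbit
    rw [hl, if_neg (by omega), if_pos h8, if_neg (by omega), decide_eq_decide]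
    have : (u + v) / 2^(l+2+1) = (al + be) / 8 := by
      rw [hu, hv, ← mul_add, show (2:ℤ)^(l+2+1) = 2^l * 8 by ring, Int.mul_ediv_mul_of_pos _ _ (by positivity)]
    rw [this]; omega
  · intro h8
    unfold fbit
    rw [if_neg (by omega), if_neg (by omega)]

noncomputable def cX {Λ : Type*} (Lab : ℕ → ℕ → Λ) (u v : ℤ) : FA Λ :=
  ({ R2 := cw 2 u v, C2 := cw 2 v u, D2 := cD 2 u v, D2p := cD 2 (u-1) v
     R3 := cw 3 u v, C3 := cw 3 v u, D3 := cD 3 u v, D3p := cD 3 (u-1) v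
     fh := cfh u v, fv := cfh v u, d0 := cd 0 u v, d1 := cd 1 u v
     d0p := cd 0 (u-1) v, d1p := cd 1 (u-1) v, boom := cboom u v },
   Lab (lvl 2 v) (lvl 3 v), Lab (lvl 2 u) (lvl 3 u))

theorem cty_zero {a b : ℕ} : cty a b = .zero ↔ a = b := by
  unfold cty; split_ifs <;> simp_all
theorem cty_neg1 {a b : ℕ} : cty a b = .neg1 ↔ a + 1 = b := by
  unfold cty; split_ifs <;> simp_all

set_option maxHeartbeats 2000000 in
theorem cX_step {Λ : Type*} {L : Lsys Λ} {Lab : ℕ → ℕ → Λ}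
    (hV : ∀ a b, L.Val (decide (a = 0)) (decide (b = 0)) (Lab a b))
    (hH : ∀ a b, L.H (Lab a b) (Lab (a+1) b)) (hW : ∀ a b, L.V (Lab a b) (Lab a (b+1)))
    {u v : ℤ} (hu : u ≠ 0) (hv : v ≠ 0) (huv : u - v ≠ 0) :
    aliveTo L (cX Lab (u-1) v) (cX Lab u (v-1)) (cX Lab u v) := by
  obtain ⟨a1, a2, a3, a4⟩ := canon (p := 2) hu hv huv
  obtain ⟨b1, b2, b3, b4⟩ := canon (p := 3) hu hv huv
  have hdl : lvl 2 u = lvl 2 v → ∀ al be : ℤ, u = 2^(lvl 2 v) * al → v = 2^(lvl 2 v) * be →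
      dlt (cX Lab (u-1) v).1 (cX Lab u (v-1)).1 = ((al - be : ℤ) : ZMod (2^3)) := by
    intro h al be hal hbe
    unfold dlt
    have c1 := (cw_ge (p := 2) hu hv h.ge).2.2.2.2.2
    have c2 := (cw_ge (p := 2) hv hu h.le).2.2.2.2.2
    change (cw 2 (u-1) v).k + 1 - ((cw 2 (v-1) u).k + 1) = _
    rw [c1, c2, h]
    have e1 : u / ((2:ℕ):ℤ)^(lvl 2 v) = al := by
      apply Int.ediv_eq_of_eq_mul_right (by positivity); simpa using hal
    have e2 : v / ((2:ℕ):ℤ)^(lvl 2 v) = be := by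
      apply Int.ediv_eq_of_eq_mul_right (by positivity); simpa using hbe
    rw [e1, e2]; push_cast; rfl
  have z4 : ∀ x : ℤ, 2 * (x : ZMod (2^3)) = 4 ↔ x % 4 = 2 := by
    intro x
    rw [← sub_eq_zero, show (2 * (x : ZMod (2^3)) - 4) = ((2 * x - 4 : ℤ) : ZMod (2^3)) by push_cast; rfl,
      ZMod.intCast_zmod_eq_zero_iff_dvd]
    push_cast; omega
  have z8 : ∀ x : ℤ, (x : ZMod (2^3)) = 4 ↔ x % 8 = 4 := by
    intro x
    rw [← sub_eq_zero, show ((x : ZMod (2^3)) - 4) = ((x - 4 : ℤ) : ZMod (2^3)) by push_cast; rfl,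
      ZMod.intCast_zmod_eq_zero_iff_dvd]
    push_cast; omega
  have z0 : ∀ x : ℤ, (x : ZMod (2^3)) = 0 ↔ x % 8 = 0 := by
    intro x
    rw [ZMod.intCast_zmod_eq_zero_iff_dvd]
    push_cast; omega
  set W := cX Lab (u-1) v with hWd
  set N := cX Lab u (v-1) with hNd
  set t2 := cty (lvl 2 u) (lvl 2 v) with ht2
  set t3 := cty (lvl 3 u) (lvl 3 v) with ht3
  -- fuse facts
  have boomE : cboom u v = true ↔ isE1 W.1 N.1 t2 ∧ W.1.R2.c ≠ 0 ∧ N.1.C2.c ≠ 0 ∧ N.1.d0p = true := by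
    have r1 : W.1.R2.c ≠ 0 ↔ v % 2 = 1 := by
      change ((v : ℤ) : ZMod 2) ≠ 0 ↔ _
      rw [Ne, ZMod.intCast_zmod_eq_zero_iff_dvd]; push_cast; omega
    have r2 : N.1.C2.c ≠ 0 ↔ u % 2 = 1 := by
      change ((u : ℤ) : ZMod 2) ≠ 0 ↔ _
      rw [Ne, ZMod.intCast_zmod_eq_zero_iff_dvd]; push_cast; omega
    rw [r1, r2]
    unfold cboom isE1
    rw [decide_eq_true_iff]
    by_cases h1 : u % 2 = 1
    swap
    · tauto
    by_cases h2 : v % 2 = 1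
    swap
    · tauto
    have l1 : lvl 2 u = 0 := lvl_of (a := u) (by ring) h1
    have l2 : lvl 2 v = 0 := lvl_of (a := v) (by ring) h2
    have d := hdl (by rw [l1, l2]) u v (by rw [l2]; ring) (by rw [l2]; ring)
    rw [d, z4]
    have tz : t2 = .zero := by rw [ht2, cty_zero, l1, l2]
    by_cases h4 : (u - v) % 4 = 2
    swap
    · tauto
    have l3 : lvl 2 (u - v) = 1 := lvl_of (a := (u-v)/2) (by omega) (by omega)
    have : N.1.d0p = true ↔ -8 ≤ u + v := by
      change cd 0 (u-1) (v-1) = true ↔ _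
      unfold cd
      rw [show u - 1 - (v-1) = u - v by ring, l3, if_neg (by omega), decide_eq_true_iff]
      norm_num
      omega
    tauto
  have fuse : (isE2 W.1 N.1 t2 ∨ isE3 W.1 N.1 t2 → W.1.fh = N.1.fv) ∧
      (cfh u v = (fX W.1 N.1 t2 t3).fh ∧ cfh v u = (fX W.1 N.1 t2 t3).fv ∧
       cd 0 u v = (fX W.1 N.1 t2 t3).d0 ∧ cd 1 u v = (fX W.1 N.1 t2 t3).d1) := by
    have w1 : W.1.fh = cfh (u-1) v := rfl
    have w2 : N.1.fv = cfh (v-1) u := rfl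
    have w3 : N.1.d0p = cd 0 (u-1) (v-1) := rfl
    have w4 : N.1.d1p = cd 1 (u-1) (v-1) := rfl
    by_cases h : lvl 2 u = lvl 2 v
    · obtain ⟨al, be, ha, hb, hal, hbe, k1, k2, k3, k4⟩ := eq_lvl hu hv huv h
      have d := hdl h al be hal hbe
      have tz : t2 = .zero := by rw [ht2, cty_zero, h]
      rcases (by omega : (al - be) % 4 = 2 ∨ (al - be) % 4 = 0 ∧ (al - be) % 8 = 4 ∨ (al - be) % 4 = 0 ∧ (al - be) % 8 = 0) with h4 | ⟨h4, h8⟩ | ⟨h4, h8⟩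
      · obtain ⟨m1, m2, m3⟩ := c_e1 ha hb hal hbe h4
        have i1 : isE1 W.1 N.1 t2 := ⟨tz, by rw [d, z4]; exact h4⟩
        have i2 : ¬ isE2 W.1 N.1 t2 := by rintro ⟨-, h⟩; rw [d, z8] at h; omega
        have i3 : ¬ isE3 W.1 N.1 t2 := by rintro ⟨-, h⟩; rw [d, z0] at h; omega
        refine ⟨by tauto, ?_⟩
        simp only [fX, if_pos i1, w1, w2, w3, w4, k1, k2, k3, k4, m2, m3, ← m1, and_self]
      · obtain ⟨m1, m2, m3, m4⟩ := c_e2 huv ha hb hal hbe h4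
        have i1 : ¬ isE1 W.1 N.1 t2 := by rintro ⟨-, h⟩; rw [d, z4] at h; omega
        have i2 : isE2 W.1 N.1 t2 := ⟨tz, by rw [d, z8]; omega⟩
        refine ⟨fun _ => by rw [w1, w2, k3, k4, m1], ?_⟩
        simp only [fX, if_neg i1, if_pos i2, w3, w4, k1, k2, m2, m3 h8, and_self]
      · obtain ⟨m1, m2, m3, m4⟩ := c_e2 huv ha hb hal hbe h4
        have i1 : ¬ isE1 W.1 N.1 t2 := by rintro ⟨-, h⟩; rw [d, z4] at h; omega
        have i2 : ¬ isE2 W.1 N.1 t2 := by rintro ⟨-, h⟩; rw [d, z8] at h; omega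
        have i3 : isE3 W.1 N.1 t2 := ⟨tz, by rw [d, z0]; omega⟩
        refine ⟨fun _ => by rw [w1, w2, k3, k4, m1], ?_⟩
        simp only [fX, if_neg i1, if_neg i2, if_pos i3, w3, w4, k1, k2, m2, m4 h8, and_self]
    · have i0 : t2 ≠ .zero := by rw [ht2, Ne, cty_zero]; exact h
      have i1 : ¬ isE1 W.1 N.1 t2 := fun h => i0 h.1
      have i2 : ¬ isE2 W.1 N.1 t2 := fun h => i0 h.1
      have i3 : ¬ isE3 W.1 N.1 t2 := fun h => i0 h.1
      obtain ⟨m1, m2, m3⟩ : cfh u v = cfh (u-1) v ∧ cfh v u = cfh (v-1) u ∧ ∀ i, cd i u v = cd i (u-1) (v-1) := by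
        rcases lt_or_gt_of_ne h with h | h
        · exact pass_lt hu hv huv h
        · exact pass_gt hu hv huv h
      refine ⟨by tauto, ?_⟩
      simp only [fX, if_neg i1, if_neg i2, if_neg i3, w1, w2, w3, w4]
      exact ⟨m1, m2, m3 0, m3 1⟩
  refine ⟨t2, t3, ⟨a1, b1, ?_, ?_, ?_, ?_, fuse.1⟩, ⟨?_, ?_, ?_, ?_⟩, ?_⟩
  · change (((u - 1 : ℤ)) : ZMod 2) + 1 = (u : ZMod 2); push_cast; ring
  · change (((v - 1 : ℤ)) : ZMod 2) + 1 = (v : ZMod 2); push_cast; ring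
  · change (((u - 1 : ℤ)) : ZMod 3) + 1 = (u : ZMod 3); push_cast; ring
  · change (((v - 1 : ℤ)) : ZMod 3) + 1 = (v : ZMod 3); push_cast; ring
  · have := hV (lvl 2 u) (lvl 3 u)
    change L.Val (decide ((cw 2 (v-1) u).c ≠ 0)) (decide ((cw 3 (v-1) u).c ≠ 0)) (Lab (lvl 2 u) (lvl 3 u))
    convert this using 1
    · rw [decide_eq_decide, Ne, cw_c hu, not_not]
    · rw [decide_eq_decide, Ne, cw_c hu, not_not]
  · intro h2 h3
    rw [ht2, cty_zero] at h2; rw [ht3, cty_zero] at h3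
    change Lab (lvl 2 v) (lvl 3 v) = Lab (lvl 2 u) (lvl 3 u); rw [h2, h3]
  · intro h2 h3
    rw [ht2, cty_neg1] at h2; rw [ht3, cty_zero] at h3
    change L.H (Lab (lvl 2 u) (lvl 3 u)) (Lab (lvl 2 v) (lvl 3 v)); rw [← h2, h3]; exact hH _ _
  · intro h2 h3
    rw [ht2, cty_zero] at h2; rw [ht3, cty_neg1] at h3
    change L.V (Lab (lvl 2 u) (lvl 3 u)) (Lab (lvl 2 v) (lvl 3 v)); rw [h2, ← h3]; exact hW _ _
  · have bo : (fX W.1 N.1 t2 t3).boom = cboom u v := by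
      rw [Bool.eq_iff_iff, fX_boom, boomE]
    obtain ⟨f1, f2, f3, f4⟩ := fuse.2
    refine Prod.ext ?_ rfl
    change Fst.mk (cw 2 u v) (cw 2 v u) (cD 2 u v) (cD 2 (u-1) v) (cw 3 u v) (cw 3 v u) (cD 3 u v) (cD 3 (u-1) v)
      (cfh u v) (cfh v u) (cd 0 u v) (cd 1 u v) (cd 0 (u-1) v) (cd 1 (u-1) v) (cboom u v) = fX W.1 N.1 t2 t3
    rw [f1, f2, f3, f4, ← bo, a2, a3, a4, b2, b3, b4]
    rfl

/-- (N4) -/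
theorem N4 {Λ : Type*} {L : Lsys Λ} {Lab : ℕ → ℕ → Λ}
    (hV : ∀ a b, L.Val (decide (a = 0)) (decide (b = 0)) (Lab a b))
    (hH : ∀ a b, L.H (Lab a b) (Lab (a+1) b)) (hW : ∀ a b, L.V (Lab a b) (Lab a (b+1)))
    (T J : ℕ) : ∃ c : ℤ → Option (FA Λ), ∀ i : ℤ, |i| ≤ J → fires (fnu L) ((stp (fnu L))^[T] c) i := by
  let U : ℤ := J + T + 5
  let c : ℤ → Option (FA Λ) := fun i => if |i| ≤ J + 1 + T then some (cX Lab (i+U) (-8-T-(i+U))) else none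
  have key : ∀ s : ℕ, s ≤ T → ∀ i : ℤ, |i| + s ≤ J + 1 + T →
      (stp (fnu L))^[s] c i = some (cX Lab (i+U) (s-8-T-(i+U))) := by
    intro s
    induction s with
    | zero =>
      intro _ i hi
      simp only [Function.iterate_zero, id, c]
      rw [if_pos (by simpa using hi)]
      simp
    | succ s ih =>
      intro hs i hi
      rw [Function.iterate_succ_apply', stp_some]
      push_cast at hi
      have hi' := abs_le.1 (show |i| ≤ J + T - s by omega)
      refine ⟨_, _, _, ih (by omega) (i-1) ?_, ih (by omega) i (by omega), ih (by omega) (i+1) ?_, ?_⟩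
      · have : |i-1| ≤ J + T - s + 1 := abs_le.2 (by omega)
        omega
      · have : |i+1| ≤ J + T - s + 1 := abs_le.2 (by omega)
        omega
      · rw [fnu_alive]
        have n0 : ∀ u v : ℤ, u + v < -8 → cboom u v = false := by
          intro u v h; unfold cboom; rw [decide_eq_false_iff_not]; omega
        refine ⟨n0 _ _ (by omega), n0 _ _ (by omega), ?_⟩
        have := cX_step (L := L) hV hH hW (u := i + U) (v := ((s+1:ℕ):ℤ)-8-T-(i+U)) (by omega) (by push_cast; omega) (by push_cast; omega)
        convert this using 2
        · ring
        · push_cast; ring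
        · push_cast; ring
  refine ⟨c, fun i hi => ?_⟩
  have hi' := abs_le.1 hi
  refine ⟨_, _, _, key T le_rfl (i-1) ?_, key T le_rfl i (by omega), key T le_rfl (i+1) ?_, ?_⟩
  · have : |i-1| ≤ J + 1 := abs_le.2 (by omega)
    omega
  · have : |i+1| ≤ J + 1 := abs_le.2 (by omega)
    omega
  · rw [fnu_fire]
    rcases Int.emod_two_eq_zero_or_one (i + U) with h | h
    · left
      change cboom _ _ = true
      unfold cboom; rw [decide_eq_true_iff]; omega
    · right
      change cboom _ _ = true
      unfold cboom; rw [decide_eq_true_iff]; omega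


/-! ## Binary words as numbers -/

def num (x : ℤ → Bool) (i : ℤ) : ℕ → ℕ
  | 0 => 0
  | len+1 => (x i).toNat + 2 * num x (i+1) len

theorem num_testBit (x : ℤ → Bool) (len : ℕ) : ∀ (i : ℤ) (o : ℕ),
    (num x i len).testBit o = (decide (o < len) && x (i+o)) := by
  induction len with
  | zero => intro i o; simp [num]
  | succ n ih =>
    intro i o
    rw [num]
    cases o with
    | zero => 
      rw [Nat.testBit_zero]
      cases hx : x i <;> simp [Nat.add_mod, hx]
    | succ o =>
      rw [Nat.testBit_succ, show ((x i).toNat + 2 * num x (i+1) n) / 2 = num x (i+1) n by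
        have := Bool.toNat_lt (x i); omega, ih]
      congr 1
      · simp
      · congr 1; push_cast; ring

theorem num_lt (x : ℤ → Bool) (i : ℤ) (len : ℕ) : num x i len < 2^len := by
  apply Nat.lt_pow_two_of_testBit
  intro o ho; rw [num_testBit]; simp; omega

theorem num_eq_iff {x : ℤ → Bool} {i : ℤ} {len v : ℕ} (hv : v < 2^len) :
    num x i len = v ↔ ∀ o < len, x (i+o) = v.testBit o := by
  constructor
  · rintro rfl o ho; rw [num_testBit]; simp [ho]
  · intro h
    apply Nat.eq_of_testBit_eq
    intro o; rw [num_testBit]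
    by_cases ho : o < len
    · simp [ho, h o ho]
    · simp only [ho, decide_false, Bool.false_and]
      exact (Nat.testBit_lt_two_pow (hv.trans_le (Nat.pow_le_pow_right (by norm_num) (by omega)))).symm

theorem num_congr {x y : ℤ → Bool} {i j : ℤ} {len : ℕ} (h : ∀ o : ℕ, o < len → x (i+o) = y (j+o)) :
    num x i len = num y j len := by
  rw [num_eq_iff (num_lt _ _ _)]
  intro o ho; rw [num_testBit]; simp [ho, h o ho]

theorem num_sub {x : ℤ → Bool} {i : ℤ} {len p q : ℕ} (h : p + q ≤ len) :
    num x (i+p) q = num x i len / 2^p % 2^q := by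
  apply Nat.eq_of_testBit_eq
  intro o
  rw [num_testBit, Nat.testBit_mod_two_pow, Nat.testBit_div_two_pow, num_testBit]
  by_cases ho : o < q
  · simp [ho, show p + o < len by omega, show o + p < len by omega]
    congr 1; ring
  · simp [ho]

/-- parameters of the block coding -/
structure RP where
  L : ℕ
  un : ℕ
  Q : ℕ
  UF : List ℕ
  w : ℕ
  a : ℕ
  S : ℕ
  nuN : ℕ → ℕ → ℕ

namespace RP

/-- repeated forbidden word -/
def rep (L un : ℕ) : ℕ → ℕ
  | 0 => 0
  | m+1 => un + 2^L * rep L un m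

def ufree (L un Q v : ℕ) : Prop := ∀ o, o + L ≤ Q → v / 2^o % 2^L ≠ un

structure OK (P : RP) : Prop where
  hL : 0 < P.L
  hun : P.un < 2^(P.L-1)
  hQ : 2 * P.L ≤ P.Q
  hUF : ∀ v, v ∈ P.UF ↔ v < 2^P.Q ∧ ufree P.L P.un P.Q v
  hW : P.UF.length ≤ 2^(P.Q-2)
  hW0 : 0 < P.UF.length
  hS : P.S ≤ 2^P.w
  ha : P.w + P.Q + 3 * P.Q * P.L < P.a
  hcl : ∀ s s' r, s < P.S → s' < P.S → P.nuN s s' = r + 2 → r < P.S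

variable (P : RP)

def pos : ℕ := P.a + 1 + 3 * P.Q * P.L
def t : ℕ := P.pos + P.w
def ell : ℕ := P.Q * P.t
/-- header number -/
def HP : ℕ := 2^P.a - 1 + 2^(P.a+1) * rep P.L P.un (3*P.Q)

def Coded (x : ℤ → Bool) (j : ℤ) : Prop :=
  num x j P.pos = P.HP ∧ num x (j + P.pos) P.w < P.S ∧
    ∀ b < P.t, num x (j + (P.t + (P.Q-1) * b : ℕ)) (P.Q-1) < P.UF.length

def st (x : ℤ → Bool) (j : ℤ) : ℕ := num x (j + P.pos) P.w

open Classical in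
noncomputable def act (x : ℤ → Bool) (j : ℤ) : ℕ :=
  if P.Coded x (j - P.ell) ∧ P.Coded x j ∧ P.Coded x (j + P.ell) then P.nuN (P.st x (j - P.ell)) (P.st x j) else 0

def pay (x : ℤ → Bool) (j : ℤ) (b : ℕ) : ℕ :=
  P.UF.getD (num x (j + (P.t + (P.Q-1) * b : ℕ)) (P.Q-1)) 0

noncomputable def out (x : ℤ → Bool) (j : ℤ) (o : ℕ) : Bool :=
  if P.act x j = 1 then (P.pay x j (o / P.Q)).testBit (o % P.Q)
  else if P.pos ≤ o ∧ o < P.t then (P.act x j - 2).testBit (o - P.pos) else x (j + o)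

open Classical in
noncomputable def hat (e : Bool) (x : ℤ → Bool) (i : ℤ) : Bool :=
  if ∃ o : ℕ, o < P.ell ∧ P.Coded x (i - o) then e else x i

open Classical in
noncomputable def H (F : (ℤ → Bool) → (ℤ → Bool)) (e : Bool) (x : ℤ → Bool) (i : ℤ) : Bool :=
  if ∃ o : ℕ, o < P.ell ∧ P.act x (i - o) ≠ 0 then
    decide (∃ o : ℕ, o < P.ell ∧ P.act x (i - o) ≠ 0 ∧ P.out x (i - o) o = true)
  else F (P.hat e x) i

variable {P}

theorem rep_lt (L un : ℕ) (h : un < 2^L) (m : ℕ) : rep L un m < 2^(L*m) := by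
  induction m with
  | zero => simp [rep]
  | succ m ih =>
    rw [rep, Nat.mul_succ, pow_add]
    have : rep L un m + 1 ≤ 2^(L*m) := ih
    nlinarith [Nat.mul_le_mul_left (2^L) this, Nat.two_pow_pos L]

theorem rep_get (L un : ℕ) (h : un < 2^L) (m : ℕ) : ∀ c < m, rep L un m / 2^(L*c) % 2^L = un := by
  induction m with
  | zero => intro c hc; omega
  | succ m ih =>
    intro c hc
    rw [rep]
    cases c with
    | zero => simp [Nat.mod_eq_of_lt h]
    | succ c =>
      rw [Nat.mul_succ, add_comm (L*c) L, pow_add, ← Nat.div_div_eq_div_mul,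
        Nat.add_mul_div_left _ _ (by positivity), Nat.div_eq_of_lt h, zero_add]
      exact ih c (by omega)

theorem OK.hunL (h : P.OK) : P.un < 2^P.L :=
  h.hun.trans_le (Nat.pow_le_pow_right (by norm_num) (by omega))

theorem HP_lt (h : P.OK) : P.HP < 2^P.pos := by
  have h1 := rep_lt P.L P.un h.hunL (3*P.Q)
  unfold HP pos
  rw [pow_add _ (P.a+1), pow_succ, show 3 * P.Q * P.L = P.L * (3*P.Q) by ring]
  have : rep P.L P.un (3*P.Q) + 1 ≤ 2^(P.L*(3*P.Q)) := h1
  have h2 := Nat.mul_le_mul_left (2^P.a*2) this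
  have : 0 < 2^P.a := by positivity
  rw [mul_add, mul_one] at h2
  omega

theorem HP_bit_lt {o : ℕ} (ho : o < P.a) : P.HP.testBit o = true := by
  unfold HP
  have : (2^P.a - 1 + 2^(P.a+1) * rep P.L P.un (3*P.Q)) % 2^P.a = 2^P.a - 1 := by
    rw [pow_succ, mul_assoc, Nat.add_mul_mod_self_left]
    exact Nat.mod_eq_of_lt (by have : 0 < 2^P.a := by positivity
                               omega)
  have h2 := Nat.testBit_mod_two_pow (2^P.a - 1 + 2^(P.a+1) * rep P.L P.un (3*P.Q)) P.a o
  rw [this, Nat.testBit_two_pow_sub_one] at h2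
  simpa [ho] using h2.symm

theorem HP_div (P : RP) : P.HP / 2^(P.a+1) = rep P.L P.un (3*P.Q) := by
  unfold HP
  rw [Nat.add_mul_div_left _ _ (by positivity), Nat.div_eq_of_lt, zero_add]
  rw [pow_succ]; have : 0 < 2^P.a := by positivity
  omega

theorem HP_bit_a : P.HP.testBit P.a = false := by
  have : P.HP % 2^(P.a+1) = 2^P.a - 1 := by
    unfold HP
    rw [Nat.add_mul_mod_self_left]
    apply Nat.mod_eq_of_lt; rw [pow_succ]; have : 0 < 2^P.a := by positivity
    omega
  have h2 := Nat.testBit_mod_two_pow P.HP (P.a+1) P.a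
  rw [this, Nat.testBit_two_pow_sub_one] at h2
  simpa using h2.symm

theorem HP_get (h : P.OK) {c : ℕ} (hc : c < 3 * P.Q) : P.HP / 2^(P.a+1+P.L*c) % 2^P.L = P.un := by
  rw [pow_add _ (P.a+1), ← Nat.div_div_eq_div_mul, HP_div]
  exact rep_get _ _ h.hunL _ _ hc

/-- copies of the forbidden word in a coded block -/
theorem Coded.copy (h : P.OK) {x : ℤ → Bool} {j : ℤ} (hc : P.Coded x j) {c : ℕ} (hlt : c < 3 * P.Q) :
    num x (j + (P.a + 1 + P.L * c : ℕ)) P.L = P.un := by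
  rw [num_sub (len := P.pos), hc.1, HP_get h hlt]
  unfold pos
  have : P.L * c + P.L ≤ 3 * P.Q * P.L := by
    rw [← Nat.mul_succ, mul_comm (3 * P.Q)]; exact Nat.mul_le_mul_left _ hlt
  omega

theorem OK.hQ2 (h : P.OK) : 2 ≤ P.Q := by have := h.hQ; have := h.hL; omega

theorem OK.ell_eq (h : P.OK) : P.ell = P.t + (P.Q - 1) * P.t := by
  have := h.hQ2
  unfold ell
  obtain ⟨q, hq⟩ : ∃ q, P.Q = q + 1 := ⟨P.Q - 1, by omega⟩
  rw [hq]; simp; ring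

theorem Coded.bit {x : ℤ → Bool} {j : ℤ} (h : P.OK) (hc : P.Coded x j) {o : ℕ} (ho : o < P.pos) :
    x (j + o) = P.HP.testBit o := (num_eq_iff (HP_lt h)).1 hc.1 o ho

theorem top_zero {x : ℤ → Bool} {i : ℤ} {len v : ℕ} (h : num x i (len+1) < v) (hv : v ≤ 2^len) :
    x (i + len) = false := by
  have h1 := num_testBit x (len+1) i len
  rw [Nat.testBit_lt_two_pow (h.trans_le hv)] at h1
  simpa using h1.symm

/-- zero positions in a coded block -/
theorem Coded.zero (h : P.OK) {x : ℤ → Bool} {j : ℤ} (hc : P.Coded x j) {o : ℕ} (h0 : 0 < o) (ho : o < P.ell) :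
    ∃ z : ℕ, o ≤ z ∧ z < o + P.a ∧ x (j + z) = false := by
  have ha := h.ha
  have hQ := h.hQ2
  by_cases h1 : o ≤ P.a
  · exact ⟨P.a, h1, by omega, by rw [hc.bit h (by unfold pos; omega)]; exact HP_bit_a⟩
  by_cases h2 : o < P.pos
  · refine ⟨P.pos - 1, by omega, by unfold pos; omega, ?_⟩
    have hq3 : 3 * P.Q - 1 < 3 * P.Q := by omega
    have hcp := hc.copy h hq3
    obtain ⟨l, hl⟩ : ∃ l, P.L = l + 1 := ⟨P.L - 1, by have := h.hL; omega⟩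
    have hun := h.hun
    rw [hl, Nat.add_sub_cancel] at hun
    have hz := top_zero (x := x) (i := j + (P.a + 1 + P.L * (3 * P.Q - 1) : ℕ)) (len := l) (v := 2^l)
      (by rw [← hl, hcp]; exact hun) le_rfl
    rw [← hz]; congr 1
    have : P.L * (3 * P.Q - 1) + P.L = 3 * P.Q * P.L := by
      rw [← Nat.mul_succ, show (3 * P.Q - 1).succ = 3 * P.Q by omega, mul_comm]
    unfold pos; push_cast [Nat.cast_sub (show 1 ≤ P.a + 1 + 3 * P.Q * P.L by omega)]
    zify at this hl
    linarith
  -- body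
  have ht : P.t = P.pos + P.w := rfl
  have body : ∀ b < P.t, x (j + (P.t + (P.Q - 1) * b + (P.Q - 2) : ℕ)) = false := by
    intro b hb
    have := hc.2.2 b hb
    rw [show P.Q - 1 = (P.Q - 2) + 1 by omega] at this
    have := top_zero this h.hW
    rw [← this]; congr 1
    rw [show P.Q - 1 = P.Q - 2 + 1 by omega]
    push_cast; ring
  by_cases h3 : o < P.t + (P.Q - 1)
  · refine ⟨_, ?_, ?_, body 0 (by unfold pos at ht; omega)⟩
    · omega
    · simp only [mul_zero]; omega
  · obtain ⟨b, d, hbd, hd⟩ : ∃ b d, o - P.t = (P.Q - 1) * b + d ∧ d < P.Q - 1 :=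
      ⟨(o - P.t) / (P.Q-1), (o - P.t) % (P.Q-1), (Nat.div_add_mod _ _).symm, Nat.mod_lt _ (by omega)⟩
    refine ⟨_, ?_, ?_, body b ?_⟩
    · omega
    · omega
    · rw [h.ell_eq] at ho
      by_contra hcon
      have := Nat.mul_le_mul_left (P.Q-1) (not_lt.1 hcon)
      omega

theorem ell_pos (h : P.OK) : 0 < P.ell := by
  unfold ell t pos; have := h.hQ2; positivity

theorem OK.a_lt_ell (h : P.OK) : P.a < P.ell := by
  rw [h.ell_eq]; unfold t pos; omega

/-- coded blocks do not overlap -/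
theorem Coded.sep (h : P.OK) {x : ℤ → Bool} {i j : ℤ} (hi : P.Coded x i) (hj : P.Coded x j) (hij : i < j) :
    i + P.ell ≤ j := by
  by_contra hcon
  obtain ⟨o, ho⟩ : ∃ o : ℕ, j = i + o := ⟨(j - i).toNat, by omega⟩
  subst ho
  obtain ⟨z, h1, h2, h3⟩ := hi.zero h (o := o) (by omega) (by omega)
  have h4 := hj.bit h (o := z - o) (by unfold pos; omega)
  rw [HP_bit_lt (by omega), show i + (o:ℤ) + ((z - o : ℕ) : ℤ) = i + z by omega, h3] at h4
  cases h4

theorem Coded.uniq (h : P.OK) {x : ℤ → Bool} {i : ℤ} {o o' : ℕ} (ho : o < P.ell) (ho' : o' < P.ell)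
    (hi : P.Coded x (i - o)) (hj : P.Coded x (i - o')) : o = o' := by
  rcases lt_trichotomy o o' with hl | hl | hl
  · have := hj.sep h hi (by omega); omega
  · exact hl
  · have := hi.sep h hj (by omega); omega

theorem act_coded {x : ℤ → Bool} {j : ℤ} (ha : P.act x j ≠ 0) :
    P.Coded x (j - P.ell) ∧ P.Coded x j ∧ P.Coded x (j + P.ell) := by
  unfold act at ha; split_ifs at ha with h
  · exact h
  · exact (ha rfl).elim

theorem H_blk (h : P.OK) {F : (ℤ → Bool) → (ℤ → Bool)} {e : Bool} {x : ℤ → Bool} {j : ℤ} {o : ℕ}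
    (ha : P.act x j ≠ 0) (ho : o < P.ell) : P.H F e x (j + o) = P.out x j o := by
  unfold H
  have e1 : j + (o:ℤ) - o = j := by ring
  rw [if_pos ⟨o, ho, by rw [e1]; exact ha⟩]
  rw [Bool.eq_iff_iff, decide_eq_true_iff]
  constructor
  · rintro ⟨o', h1, h2, h3⟩
    have := Coded.uniq h h1 ho (act_coded h2).2.1 (by rw [e1]; exact (act_coded ha).2.1)
    subst this
    rwa [e1] at h3
  · intro h3; exact ⟨o, ho, by rw [e1]; exact ha, by rw [e1]; exact h3⟩

theorem H_raw {F : (ℤ → Bool) → (ℤ → Bool)} {e : Bool} {x : ℤ → Bool} {i : ℤ}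
    (ha : ∀ o : ℕ, o < P.ell → P.act x (i - o) = 0) : P.H F e x i = F (P.hat e x) i := by
  unfold H
  rw [if_neg]
  rintro ⟨o, h1, h2⟩; exact h2 (ha o h1)

end RP


/-! ## Autonomy of the coded blocks -/
namespace RP
variable {P : RP} {F : (ℤ → Bool) → (ℤ → Bool)} {e : Bool} {x : ℤ → Bool}

theorem Coded.aligned (h : P.OK) {y : ℤ → Bool} {j : ℤ} (hc : P.Coded y j) {p : ℤ}
    (h1 : j + P.a + 1 ≤ p) (h2 : p + P.Q ≤ j + P.a + 1 + 3 * P.Q * P.L) :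
    ∃ o : ℕ, o + P.L ≤ P.Q ∧ num y (p + o) P.L = P.un := by
  obtain ⟨d, hd⟩ : ∃ d : ℕ, p = j + P.a + 1 + d := ⟨(p - (j + P.a + 1)).toNat, by omega⟩
  have hL := h.hL
  have hQ := h.hQ
  set k := (d + (P.L - 1)) / P.L with hk
  have e1 : P.L * k + (d + (P.L - 1)) % P.L = d + (P.L - 1) := Nat.div_add_mod _ _
  have e2 := Nat.mod_lt (d + (P.L - 1)) hL
  refine ⟨P.L * k - d, by omega, ?_⟩
  have hk3 : k < 3 * P.Q := by
    by_contra hcon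
    have h3 := Nat.mul_le_mul_left P.L (not_lt.1 hcon)
    have h4 : (d:ℤ) + P.Q ≤ 3 * P.Q * P.L := by linarith
    have h5 : d + P.Q ≤ P.L * (3 * P.Q) := by
      have : P.L * (3 * P.Q) = 3 * P.Q * P.L := by ring
      rw [this]; exact_mod_cast h4
    omega
  rw [← hc.copy h hk3]
  congr 1
  rw [hd]; push_cast [Nat.cast_sub (show d ≤ P.L * k by omega)]; ring

theorem act_closed (h : P.OK) {j : ℤ} {s : ℕ} (ha : P.act x j = s + 2) : s < P.S := by
  have hc := act_coded (P := P) (x := x) (j := j) (by omega)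
  unfold act at ha
  rw [if_pos hc] at ha
  exact h.hcl _ _ _ hc.1.2.1 hc.2.1.2.1 ha

theorem t_le_ell (h : P.OK) : P.t ≤ P.ell := by rw [h.ell_eq]; omega

theorem H_surv_same (h : P.OK) {j : ℤ} {s : ℕ} (ha : P.act x j = s + 2) {o : ℕ} (ho : o < P.ell)
    (hn : ¬ (P.pos ≤ o ∧ o < P.t)) : P.H F e x (j + o) = x (j + o) := by
  rw [H_blk h (by omega) ho]
  unfold out
  rw [if_neg (by omega), if_neg hn]

theorem st_surv (h : P.OK) {j : ℤ} {s : ℕ} (ha : P.act x j = s + 2) : P.st (P.H F e x) j = s := by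
  unfold st
  have hs := act_closed h ha
  rw [num_eq_iff (hs.trans_le h.hS)]
  intro o ho
  have ht : P.t = P.pos + P.w := rfl
  have := t_le_ell h
  rw [show j + (P.pos:ℤ) + o = j + (P.pos + o : ℕ) by push_cast; ring, H_blk h (by omega) (by omega)]
  unfold out
  rw [if_neg (by omega), if_pos (by omega), ha]
  congr 1; omega

theorem body_end (h : P.OK) {b : ℕ} (hb : b < P.t) : P.t + (P.Q - 1) * b + (P.Q - 1) ≤ P.ell := by
  rw [h.ell_eq, add_assoc, ← Nat.mul_succ]
  exact Nat.add_le_add_left (Nat.mul_le_mul_left _ hb) _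

theorem coded_surv (h : P.OK) {j : ℤ} {s : ℕ} (ha : P.act x j = s + 2) : P.Coded (P.H F e x) j := by
  have hc := act_coded (P := P) (x := x) (j := j) (by omega)
  have hs := act_closed h ha
  have ht : P.t = P.pos + P.w := rfl
  have htl := t_le_ell h
  refine ⟨?_, ?_, ?_⟩
  · rw [← hc.2.1.1]
    apply num_congr
    intro o ho
    exact H_surv_same h ha (by omega) (by omega)
  · have := st_surv (F := F) (e := e) h ha
    unfold st at this
    rw [this]; exact hs
  · intro b hb
    have hc2 := hc.2.1.2.2 b hb
    have hbe := body_end h hb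
    convert hc2 using 1
    apply num_congr
    intro o ho
    have := H_surv_same (F := F) (e := e) h ha (o := P.t + (P.Q - 1) * b + o) (by omega) (by omega)
    rw [Nat.cast_add, ← add_assoc] at this
    exact this

theorem piece_le (h : P.OK) {c : ℕ} (hc : c < P.t) : P.Q * c + P.Q ≤ P.ell := by
  rw [← Nat.mul_succ]; exact Nat.mul_le_mul_left _ hc

theorem pay_mem {j : ℤ} (hc : P.Coded x j) {c : ℕ} (hlt : c < P.t) : P.pay x j c ∈ P.UF := by
  unfold pay
  have := hc.2.2 c hlt
  rw [List.getD_eq_getElem _ _ this]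
  exact List.getElem_mem _

theorem fired_piece (h : P.OK) {j : ℤ} (ha : P.act x j = 1) {c : ℕ} (hc : c < P.t) :
    num (P.H F e x) (j + (P.Q * c : ℕ)) P.Q = P.pay x j c := by
  have hm := (h.hUF _).1 (pay_mem (act_coded (P := P) (x := x) (j := j) (by omega)).2.1 hc)
  have hp := piece_le h hc
  rw [num_eq_iff hm.1]
  intro o ho
  rw [show j + ((P.Q * c : ℕ):ℤ) + o = j + (P.Q * c + o : ℕ) by push_cast; ring,
    H_blk h (by omega) (by omega)]
  unfold out
  rw [if_pos ha, Nat.mul_add_div (by omega), Nat.div_eq_of_lt ho, Nat.mul_add_mod, Nat.mod_eq_of_lt ho]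
  simp

theorem no_accident (h : P.OK) (hF : ∀ x i, num (F x) i P.L ≠ P.un) {j : ℤ}
    (hc : P.Coded (P.H F e x) j) : ∃ s, P.act x j = s + 2 := by
  by_contra hcon
  have hns : ∀ s, P.act x j ≠ s + 2 := fun s hs => hcon ⟨s, hs⟩
  have hQ := h.hQ
  have hL := h.hL
  have hQ2 := h.hQ2
  have htl := t_le_ell h
  have ht : P.t = P.a + 1 + 3 * P.Q * P.L + P.w := rfl
  have h3Q : 3 * P.Q ≤ 3 * P.Q * P.L := Nat.le_mul_of_pos_right _ hL
  -- cells of the block are not in surviving blocks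
  have key : ∀ (d : ℕ) (o : ℕ), d < P.ell → o < P.ell → P.act x (j + d - o) ≠ 0 → P.act x (j + d - o) = 1 := by
    intro d o hd ho ha
    by_contra h1
    obtain ⟨s, hs⟩ : ∃ s, P.act x (j + d - o) = s + 2 := ⟨P.act x (j + d - o) - 2, by omega⟩
    have hc2 := coded_surv (F := F) (e := e) h hs
    rcases lt_trichotomy (j + d - o) j with hl | hl | hl
    · have := hc2.sep h hc hl; omega
    · rw [hl] at hs; exact hns s hs
    · have := hc.sep h hc2 hl; omega
  by_cases hf : ∃ d o : ℕ, P.a + 1 + P.Q ≤ d ∧ d < P.a + 1 + 2 * P.Q ∧ o < P.ell ∧ P.act x (j + d - o) ≠ 0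
  · obtain ⟨d, o, h1, h2, h3, h4⟩ := hf
    have h5 := key d o (by omega) h3 h4
    set c := o / P.Q with hcdef
    have e1 : P.Q * c + o % P.Q = o := Nat.div_add_mod _ _
    have e2 := Nat.mod_lt o (show 0 < P.Q by omega)
    have hct : c < P.t := Nat.div_lt_of_lt_mul h3
    have h6 := fired_piece (F := F) (e := e) h h5 hct
    have hm := (h.hUF _).1 (pay_mem (act_coded (P := P) h4).2.1 hct)
    rw [← h6] at hm
    obtain ⟨o', ho', hu⟩ := hc.aligned h (p := j + d - o + (P.Q * c : ℕ)) (by omega) (by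
      have : (3:ℤ) * P.Q ≤ 3 * P.Q * P.L := by exact_mod_cast h3Q
      omega)
    apply hm.2 o' ho'
    rw [← num_sub ho', hu]
  · push Not at hf
    obtain ⟨o', ho', hu⟩ := hc.aligned h (p := j + (P.a + 1 + P.Q : ℕ)) (by omega) (by
      have : (3:ℤ) * P.Q ≤ 3 * P.Q * P.L := by exact_mod_cast h3Q
      push_cast; omega)
    apply hF (P.hat e x) (j + (P.a + 1 + P.Q : ℕ) + o')
    rw [← hu]
    apply num_congr
    intro o ho
    symm
    rw [show j + ((P.a + 1 + P.Q : ℕ):ℤ) + o' + o = j + (P.a + 1 + P.Q + o' + o : ℕ) by push_cast; ring]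
    apply H_raw
    intro o2 ho2
    exact hf _ o2 (by omega) (by omega) ho2

/-- interpretation of numeric results -/
def resOf : ℕ → Res ℕ
  | 0 => .die
  | 1 => .fire
  | s+2 => .alive s

def nu (P : RP) (a b : ℕ) : Res ℕ := resOf (P.nuN a b)

theorem resOf_alive {m s : ℕ} : resOf m = .alive s ↔ m = s + 2 := by
  rcases m with _ | _ | m <;> simp [resOf]

theorem resOf_fire {m : ℕ} : resOf m = .fire ↔ m = 1 := by
  rcases m with _ | _ | m <;> simp [resOf]

open Classical in
/-- the configuration of states of the blocks in phase `p` -/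
noncomputable def stC (P : RP) (x : ℤ → Bool) (p : ℤ) (k : ℤ) : Option ℕ :=
  if P.Coded x (p + k * P.ell) then some (P.st x (p + k * P.ell)) else none

theorem stC_some {p k : ℤ} {s : ℕ} : P.stC x p k = some s ↔
    P.Coded x (p + k * P.ell) ∧ P.st x (p + k * P.ell) = s := by
  unfold stC; split_ifs with h <;> simp [h]

theorem stC_isSome {p k : ℤ} : (P.stC x p k).isSome ↔ P.Coded x (p + k * P.ell) := by
  unfold stC; split_ifs with h <;> simp [h]

theorem act_iff {j : ℤ} {m : ℕ} (hm : m ≠ 0) : P.act x j = m ↔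
    P.Coded x (j - P.ell) ∧ P.Coded x j ∧ P.Coded x (j + P.ell) ∧ P.nuN (P.st x (j - P.ell)) (P.st x j) = m := by
  unfold act
  split_ifs with h
  · simp [h]
  · constructor
    · intro h'; exact (hm h'.symm).elim
    · rintro ⟨a, b, c, -⟩; exact (h ⟨a, b, c⟩).elim

theorem stC_fires {p k : ℤ} : fires P.nu (P.stC x p) k ↔ P.act x (p + k * P.ell) = 1 := by
  have e1 : p + k * P.ell - P.ell = p + (k-1) * P.ell := by ring
  have e2 : p + k * P.ell + P.ell = p + (k+1) * P.ell := by ring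
  rw [act_iff (by norm_num), e1, e2]
  unfold fires
  simp only [stC_some, nu, resOf_fire]
  constructor
  · rintro ⟨a, b, d, ⟨h1, rfl⟩, ⟨h2, rfl⟩, ⟨h3, rfl⟩, h4⟩
    exact ⟨h1, h2, h3, h4⟩
  · rintro ⟨h1, h2, h3, h4⟩
    exact ⟨_, _, _, ⟨h1, rfl⟩, ⟨h2, rfl⟩, ⟨h3, rfl⟩, h4⟩

theorem stC_H (h : P.OK) (hF : ∀ x i, num (F x) i P.L ≠ P.un) (p : ℤ) :
    P.stC (P.H F e x) p = stp P.nu (P.stC x p) := by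
  funext k
  apply Option.ext
  intro s
  rw [stp_some, stC_some]
  have e1 : p + k * P.ell - P.ell = p + (k-1) * P.ell := by ring
  have e2 : p + k * P.ell + P.ell = p + (k+1) * P.ell := by ring
  have : (P.Coded (P.H F e x) (p + k * P.ell) ∧ P.st (P.H F e x) (p + k * P.ell) = s) ↔
      P.act x (p + k * P.ell) = s + 2 := by
    constructor
    · rintro ⟨h1, h2⟩
      obtain ⟨s', hs'⟩ := no_accident h hF h1
      rw [hs', ← h2, st_surv h hs']
    · intro ha; exact ⟨coded_surv h ha, st_surv h ha⟩
  rw [this, act_iff (by omega), e1, e2]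
  simp only [stC_some, nu, resOf_alive]
  constructor
  · rintro ⟨h1, h2, h3, h4⟩
    exact ⟨_, _, _, ⟨h1, rfl⟩, ⟨h2, rfl⟩, ⟨h3, rfl⟩, h4⟩
  · rintro ⟨a, b, d, ⟨h1, rfl⟩, ⟨h2, rfl⟩, ⟨h3, rfl⟩, h4⟩
    exact ⟨h1, h2, h3, h4⟩

theorem stC_iter (h : P.OK) (hF : ∀ x i, num (F x) i P.L ≠ P.un) (p : ℤ) (T : ℕ) :
    P.stC ((P.H F e)^[T] x) p = (stp P.nu)^[T] (P.stC x p) := by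
  induction T with
  | zero => rfl
  | succ T ih => rw [Function.iterate_succ_apply', Function.iterate_succ_apply', stC_H h hF, ih]

end RP


def Loc (r : ℕ) (G : (ℤ → Bool) → (ℤ → Bool)) : Prop :=
  ∀ x x' i, (∀ k : ℤ, |k - i| ≤ r → x k = x' k) → G x i = G x' i

theorem Loc.continuous {r : ℕ} {G : (ℤ → Bool) → (ℤ → Bool)} (h : Loc r G) : Continuous G := by
  apply continuous_pi
  intro i
  classical
  let g : (Set.Icc (i - r) (i + r) → Bool) → Bool := fun w =>
    G (fun k => if hk : k ∈ Set.Icc (i - r) (i + r) then w ⟨k, hk⟩ else false) i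
  have : (fun x : ℤ → Bool => G x i) = g ∘ (fun x k => x k) := by
    funext x
    apply h
    intro k hk
    rw [abs_le] at hk
    rw [dif_pos ⟨by linarith, by linarith⟩]
  rw [this]
  have hg : Continuous g := continuous_of_discreteTopology
  exact hg.comp (continuous_pi fun k => continuous_apply _)

/-- approximation criterion for membership in ranges -/
theorem Loc.mem_range {r : ℕ} {G : (ℤ → Bool) → (ℤ → Bool)} (h : Loc r G) (s : ℕ) (y : ℤ → Bool)
    (hy : ∀ n : ℕ, ∃ z, ∀ i : ℤ, |i| ≤ n → G^[s] z i = y i) : y ∈ Set.range G^[s] := by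
  have hc : IsClosed (Set.range G^[s]) := (isCompact_range (h.continuous.iterate s)).isClosed
  choose z hz using hy
  apply hc.mem_of_tendsto (b := Filter.atTop) (f := fun n => G^[s] (z n))
  · rw [tendsto_pi_nhds]
    intro i
    apply tendsto_const_nhds.congr'
    filter_upwards [Filter.eventually_ge_atTop i.natAbs] with n hn
    exact (hz n i (by rw [Int.abs_eq_natAbs]; exact_mod_cast hn)).symm
  · exact Filter.Eventually.of_forall fun n => ⟨_, rfl⟩

theorem range_iterate_anti {G : (ℤ → Bool) → (ℤ → Bool)} {s t : ℕ} (h : s ≤ t) :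
    Set.range G^[t] ⊆ Set.range G^[s] := by
  rintro _ ⟨z, rfl⟩
  obtain ⟨d, rfl⟩ := Nat.exists_eq_add_of_le h
  exact ⟨G^[d] z, by rw [Function.iterate_add_apply]⟩

namespace RP
variable {P : RP} {F F' : (ℤ → Bool) → (ℤ → Bool)} {e : Bool} {x : ℤ → Bool}

def valid (P : RP) (c : ℤ → Option ℕ) : Prop := ∀ i s, c i = some s → s < P.S

theorem stC_valid (x : ℤ → Bool) (p : ℤ) : P.valid (P.stC x p) := by
  intro i s h
  obtain ⟨h1, rfl⟩ := stC_some.1 h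
  exact h1.2.1

theorem H_free (hx : ∀ j, ¬ P.Coded x j) : P.H F e x = F x := by
  funext i
  rw [H_raw]
  · congr 1
    funext i; unfold hat; rw [if_neg]; rintro ⟨o, -, h⟩; exact hx _ h
  · intro o _; by_contra h; exact hx _ (act_coded h).2.1

theorem F_free (h : P.OK) (hF : ∀ x i, num (F x) i P.L ≠ P.un) (j : ℤ) : ¬ P.Coded (F x) j := by
  intro hc
  exact hF _ _ (hc.copy h (c := 0) (by have := h.hQ2; omega))

theorem H_free_iter (h : P.OK) (hF : ∀ x i, num (F x) i P.L ≠ P.un) (s : ℕ) : ∀ x, 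
    (∀ j, ¬ P.Coded x j) → (P.H F e)^[s] x = F^[s] x := by
  induction s with
  | zero => intro x _; rfl
  | succ s ih =>
    intro x hx
    rw [Function.iterate_succ_apply, Function.iterate_succ_apply, H_free hx]
    exact ih _ (F_free h hF)

theorem coded_iter_iff (h : P.OK) (hF : ∀ x i, num (F x) i P.L ≠ P.un) (T : ℕ) (p k : ℤ) :
    P.Coded ((P.H F e)^[T] x) (p + k * P.ell) ↔ ((stp P.nu)^[T] (P.stC x p) k).isSome := by
  rw [← stC_iter h hF (e := e), stC_isSome]

theorem coded_iter_iff0 (h : P.OK) (hF : ∀ x i, num (F x) i P.L ≠ P.un) (T : ℕ) (p : ℤ) :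
    P.Coded ((P.H F e)^[T] x) p ↔ ((stp P.nu)^[T] (P.stC x p) 0).isSome := by
  rw [← coded_iter_iff h hF (e := e)]; simp

/-- the dying case -/
theorem limit_dying (h : P.OK) (hF : ∀ x i, num (F x) i P.L ≠ P.un)
    (hd : ∃ T, ∀ c, P.valid c → (stp P.nu)^[T] c 0 = none) :
    (⋂ j : ℕ, Set.range (P.H F e)^[j]) = ⋂ j : ℕ, Set.range F^[j] := by
  obtain ⟨T, hT⟩ := hd
  apply Set.Subset.antisymm
  · intro y hy
    rw [Set.mem_iInter] at hy ⊢
    intro s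
    obtain ⟨z, hz⟩ := hy (s + T)
    refine ⟨(P.H F e)^[T] z, ?_⟩
    rw [← hz, Function.iterate_add_apply]
    symm
    apply H_free_iter h hF
    intro j hj
    rw [coded_iter_iff0 h hF, hT _ (stC_valid _ _)] at hj
    cases hj
  · intro y hy
    rw [Set.mem_iInter] at hy ⊢
    intro s
    obtain ⟨z, hz⟩ := hy (s + 1)
    refine ⟨F z, ?_⟩
    rw [← hz, Function.iterate_add_apply, H_free_iter h hF _ _ (F_free h hF)]
    rfl

/-! ### locality of `H` -/
theorem Coded.congr {x' : ℤ → Bool} {j : ℤ} (h : P.OK) (hx : ∀ o : ℕ, o < P.ell → x (j+o) = x' (j+o)) :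
    P.Coded x j ↔ P.Coded x' j := by
  have ht : P.t = P.pos + P.w := rfl
  have htl := t_le_ell h
  unfold Coded
  rw [num_congr (x := x) (y := x') (i := j) (j := j) (len := P.pos) (fun o ho => hx o (by omega)),
    num_congr (x := x) (y := x') (i := j + P.pos) (j := j + P.pos) (len := P.w) (fun o ho => by
      have := hx (P.pos + o) (by omega)
      rw [Nat.cast_add, ← add_assoc] at this; exact this)]
  have : ∀ b < P.t, num x (j + (P.t + (P.Q-1) * b : ℕ)) (P.Q-1) = num x' (j + (P.t + (P.Q-1) * b : ℕ)) (P.Q-1) := by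
    intro b hb
    apply num_congr
    intro o ho
    have hbe := body_end h hb
    have := hx (P.t + (P.Q - 1) * b + o) (by omega)
    rw [Nat.cast_add, ← add_assoc] at this
    exact this
  constructor
  · rintro ⟨a, b, c⟩; exact ⟨a, b, fun k hk => by rw [← this k hk]; exact c k hk⟩
  · rintro ⟨a, b, c⟩; exact ⟨a, b, fun k hk => by rw [this k hk]; exact c k hk⟩

theorem st_congr {x' : ℤ → Bool} {j : ℤ} (h : P.OK) (hx : ∀ o : ℕ, o < P.ell → x (j+o) = x' (j+o)) :
    P.st x j = P.st x' j := by
  have ht : P.t = P.pos + P.w := rfl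
  have htl := t_le_ell h
  unfold st
  apply num_congr
  intro o ho
  have := hx (P.pos + o) (by omega)
  rw [Nat.cast_add, ← add_assoc] at this; exact this

theorem pay_congr {x' : ℤ → Bool} {j : ℤ} (h : P.OK) (hx : ∀ o : ℕ, P.t ≤ o → o < P.ell → x (j+o) = x' (j+o))
    {b : ℕ} (hb : b < P.t) : P.pay x j b = P.pay x' j b := by
  unfold pay
  congr 1
  apply num_congr
  intro o ho
  have hbe := body_end h hb
  have := hx (P.t + (P.Q - 1) * b + o) (by omega) (by omega)
  rw [Nat.cast_add, ← add_assoc] at this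
  exact this

theorem act_congr {x' : ℤ → Bool} {j : ℤ} (h : P.OK)
    (hx : ∀ k : ℤ, j - P.ell ≤ k → k < j + 2 * P.ell → x k = x' k) : P.act x j = P.act x' j := by
  have a1 : ∀ o : ℕ, o < P.ell → x (j - P.ell +o) = x' (j - P.ell+o) := fun o ho => hx _ (by omega) (by omega)
  have a2 : ∀ o : ℕ, o < P.ell → x (j +o) = x' (j+o) := fun o ho => hx _ (by omega) (by omega)
  have a3 : ∀ o : ℕ, o < P.ell → x (j + P.ell +o) = x' (j + P.ell+o) := fun o ho => hx _ (by omega) (by omega)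
  unfold act
  rw [Coded.congr h a1, Coded.congr h a2, Coded.congr h a3, st_congr h a1, st_congr h a2]

theorem out_congr {x' : ℤ → Bool} {j : ℤ} (h : P.OK)
    (hx : ∀ k : ℤ, j - P.ell ≤ k → k < j + 2 * P.ell → x k = x' k) {o : ℕ} (ho : o < P.ell) :
    P.out x j o = P.out x' j o := by
  unfold out
  rw [act_congr h hx, hx (j+o) (by omega) (by omega), pay_congr h (fun o _ ho => hx (j+o) (by omega) (by omega))
    (Nat.div_lt_of_lt_mul ho)]

theorem H_loc (h : P.OK) {r : ℕ} (hl : Loc r F) : Loc (r + 2 * P.ell) (P.H F e) := by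
  intro x x' i hx
  have hx' : ∀ k : ℤ, i - 2 * P.ell - r ≤ k → k ≤ i + 2 * P.ell + r → x k = x' k := by
    intro k h1 h2; apply hx; rw [abs_le]; push_cast; constructor <;> linarith
  have ha : ∀ o : ℕ, o < P.ell → ∀ k : ℤ, i - o - P.ell ≤ k → k < i - o + 2 * P.ell → x k = x' k :=
    fun o ho k h1 h2 => hx' k (by omega) (by omega)
  have hex : ∀ o : ℕ, o < P.ell → P.act x (i - o) = P.act x' (i - o) := fun o ho => act_congr h (ha o ho)
  by_cases hb : ∃ o : ℕ, o < P.ell ∧ P.act x (i - o) ≠ 0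
  · obtain ⟨o, ho, h0⟩ := hb
    have := H_blk (F := F) (e := e) h h0 ho
    rw [sub_add_cancel] at this
    rw [this]
    rw [hex o ho] at h0
    have := H_blk (F := F) (e := e) h h0 ho
    rw [sub_add_cancel] at this
    rw [this]
    exact out_congr h (ha o ho) ho
  · push Not at hb
    rw [H_raw hb, H_raw (fun o ho => by rw [← hex o ho]; exact hb o ho)]
    apply hl
    intro k hk
    rw [abs_le] at hk
    unfold hat
    have : (∃ o : ℕ, o < P.ell ∧ P.Coded x (k - o)) ↔ (∃ o : ℕ, o < P.ell ∧ P.Coded x' (k - o)) := by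
      apply exists_congr; intro o
      apply and_congr_right; intro ho
      apply Coded.congr h
      intro o' ho'
      apply hx' <;> omega
    rw [hx' k (by omega) (by omega)]
    by_cases hc : ∃ o : ℕ, o < P.ell ∧ P.Coded x (k - o)
    · rw [if_pos hc, if_pos (this.1 hc)]
    · rw [if_neg hc, if_neg (fun h' => hc (this.2 h'))]

end RP


namespace RP
variable {P : RP} {F F' : (ℤ → Bool) → (ℤ → Bool)} {e : Bool} {x : ℤ → Bool}

theorem coded_back (h : P.OK) (hF : ∀ x i, num (F x) i P.L ≠ P.un) {t d : ℕ} {j k : ℤ}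
    (hc : P.Coded ((P.H F e)^[t+d] x) j) (hk : |k| ≤ d) : P.Coded ((P.H F e)^[t] x) (j + k * P.ell) := by
  rw [coded_iter_iff h hF]
  rw [coded_iter_iff0 h hF] at hc
  exact back_alive d t k 0 (by simpa using hk) hc

theorem coded_back0 (h : P.OK) (hF : ∀ x i, num (F x) i P.L ≠ P.un) {t d : ℕ} {j : ℤ}
    (hc : P.Coded ((P.H F e)^[t+d] x) j) : P.Coded ((P.H F e)^[t] x) j := by
  simpa using coded_back h hF hc (k := 0) (by simp)

theorem content (h : P.OK) (hF : ∀ x i, num (F x) i P.L ≠ P.un) (T : ℕ) {j : ℤ}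
    (hc : P.Coded ((P.H F e)^[T] x) j) {o : ℕ} (ho : o < P.ell) (hn : ¬ (P.pos ≤ o ∧ o < P.t)) :
    (P.H F e)^[T] x (j + o) = x (j + o) := by
  induction T with
  | zero => rfl
  | succ T ih =>
    rw [Function.iterate_succ_apply'] at hc ⊢
    obtain ⟨s, hs⟩ := no_accident h hF hc
    rw [H_surv_same h hs ho hn]
    exact ih (act_coded (P := P) (by omega)).2.1

theorem coded_other (h : P.OK) (hF : ∀ x i, num (F x) i P.L ≠ P.un) (hF' : ∀ x i, num (F' x) i P.L ≠ P.un) 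
    (T : ℕ) (j : ℤ) :
    P.Coded ((P.H F e)^[T] x) j ↔ P.Coded ((P.H F' e)^[T] x) j := by
  rw [coded_iter_iff0 h hF, coded_iter_iff0 h hF']

theorem content_eq (h : P.OK) (hF : ∀ x i, num (F x) i P.L ≠ P.un) (hF' : ∀ x i, num (F' x) i P.L ≠ P.un) 
    (T : ℕ) {j : ℤ} (hc : P.Coded ((P.H F e)^[T] x) j) {o : ℕ} (ho : o < P.ell) :
    (P.H F e)^[T] x (j + o) = (P.H F' e)^[T] x (j + o) := by
  have hc' := (coded_other h hF hF' T j).1 hc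
  by_cases hn : P.pos ≤ o ∧ o < P.t
  · have h1 := stC_iter (e := e) (x := x) h hF j T
    have h2 := stC_iter (e := e) (x := x) h hF' j T
    rw [← h2] at h1
    have h3 := congrFun h1 0
    have h4 : P.stC ((P.H F e)^[T] x) j 0 = some (P.st ((P.H F e)^[T] x) j) := stC_some.2 (by simpa using hc)
    rw [h4] at h3
    have h5 := (stC_some.1 h3.symm).2
    simp only [zero_mul, add_zero] at h5
    unfold st at h5
    have h6 := num_testBit ((P.H F e)^[T] x) P.w (j + P.pos) (o - P.pos)
    have h7 := num_testBit ((P.H F' e)^[T] x) P.w (j + P.pos) (o - P.pos)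
    rw [h5, h6] at h7
    have ht : P.t = P.pos + P.w := rfl
    rw [show j + (P.pos:ℤ) + ((o - P.pos : ℕ):ℤ) = j + o by omega] at h7
    simpa [show o - P.pos < P.w by omega] using h7
  · rw [content h hF T hc ho hn, content h hF' T hc' ho hn]

theorem in_block (h : P.OK) (j i : ℤ) : ∃ (k : ℤ) (o : ℕ), o < P.ell ∧ i = j + k * P.ell + o := by
  have hl := ell_pos h
  refine ⟨(i - j) / P.ell, ((i - j) % P.ell).toNat, ?_, ?_⟩
  · have := Int.emod_lt_of_pos (i - j) (show (0:ℤ) < P.ell by exact_mod_cast hl)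
    omega
  · have h1 := Int.emod_nonneg (i - j) (show (P.ell:ℤ) ≠ 0 by omega)
    have h2 := Int.mul_ediv_add_emod (i - j) P.ell
    rw [Int.toNat_of_nonneg h1]; linarith

theorem block_bd (h : P.OK) {j i k : ℤ} {o K : ℕ} (ho : o < P.ell) (hi : i = j + k * P.ell + o)
    (hb : |i - j| ≤ K * P.ell) : |k| ≤ K := by
  have hl : (0:ℤ) < P.ell := by exact_mod_cast ell_pos h
  have ho' : (o:ℤ) < P.ell := by exact_mod_cast ho
  rw [abs_le] at hb ⊢
  have e1 : i - j = k * P.ell + o := by rw [hi]; ring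
  rw [e1] at hb
  constructor
  · by_contra hcon
    nlinarith
  · by_contra hcon
    nlinarith

theorem phase (h : P.OK) {z : ℤ → Bool} {j b : ℤ} {K : ℕ} (hz : ∀ k : ℤ, |k| ≤ K → P.Coded z (j + k * P.ell))
    (hb : P.Coded z b) (hd : |b - j| ≤ K * P.ell) : ∃ k : ℤ, |k| ≤ K ∧ b = j + k * P.ell := by
  obtain ⟨k, o, ho, hk⟩ := in_block h j b
  have hK := block_bd h ho hk hd
  refine ⟨k, hK, ?_⟩
  by_contra hne
  have := (hz k hK).sep h hb (by omega)
  omega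

/-- fire kills the centre -/
def N5' (P : RP) : Prop := ∀ n : ℕ, ∃ T0 : ℕ, ∀ (c : ℤ → Option ℕ) (t : ℕ) (k : ℤ), P.valid c →
    T0 ≤ t → |k| ≤ n → fires P.nu ((stp P.nu)^[t] c) k → (stp P.nu)^[t+1] c 0 = none

/-- unbounded simultaneous fire -/
def N4' (P : RP) : Prop := ∀ T J : ℕ, ∃ c : ℤ → Option ℕ, P.valid c ∧
    ∀ i : ℤ, |i| ≤ J → fires P.nu ((stp P.nu)^[T] c) i

theorem quiet (h : P.OK) (hF : ∀ x i, num (F x) i P.L ≠ P.un) {r : ℕ} (hl : Loc r F)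
    (hq : ∀ i, F (fun _ => e) i = e) {N t0 : ℕ} {j : ℤ} (hc : P.Coded ((P.H F e)^[t0+N] x) j)
    (hN5 : ∀ (c : ℤ → Option ℕ) (t : ℕ) (k : ℤ), P.valid c →
      t0 ≤ t → |k| ≤ N → fires P.nu ((stp P.nu)^[t] c) k → (stp P.nu)^[t+1] c 0 = none) (d : ℕ) :
    d ≤ N → ∀ i : ℤ, |i - j| + r * d + P.ell ≤ N * P.ell →
      (∀ o : ℕ, o < P.ell → ¬ P.Coded ((P.H F e)^[t0+d] x) (i - o)) → (P.H F e)^[t0+d] x i = e := by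
  have hz : ∀ k : ℤ, |k| ≤ N → P.Coded ((P.H F e)^[t0] x) (j + k * P.ell) := fun k hk => coded_back h hF hc hk
  induction d with
  | zero =>
    intro _ i hi hno
    exfalso
    obtain ⟨k, o, ho, hk⟩ := in_block h j i
    apply hno o ho
    have := hz k (block_bd h ho hk (by simp at hi; linarith [Int.natCast_nonneg P.ell]))
    rw [hk, add_sub_cancel_right]; exact this
  | succ d ih =>
    intro hd i hi hno
    have hlp : (0:ℤ) ≤ P.ell := Int.natCast_nonneg _
    rw [show t0 + (d+1) = (t0 + d) + 1 by ring, Function.iterate_succ_apply'] at hno ⊢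
    have hact : ∀ o : ℕ, o < P.ell → P.act ((P.H F e)^[t0+d] x) (i - o) = 0 := by
      intro o ho
      by_contra h0
      rcases Nat.lt_or_ge (P.act ((P.H F e)^[t0+d] x) (i - o)) 2 with h2 | h2
      · have h1 : P.act ((P.H F e)^[t0+d] x) (i - o) = 1 := by omega
        have hcd := (act_coded h0).2.1
        have hc0 := coded_back0 h hF hcd
        obtain ⟨k, hk, hb⟩ := phase h hz hc0 (by
          have : |i - o - j| ≤ |i - j| + o := by
            rw [show i - o - j = (i - j) - o by ring]
            exact (abs_sub _ _).trans (by simp)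
          push_cast at hi
          have hro : (0:ℤ) ≤ r * (d + 1) := by positivity
          have : (o:ℤ) < P.ell := by exact_mod_cast ho
          linarith)
        rw [hb, ← stC_fires, stC_iter h hF] at h1
        have h3 := hN5 _ (t0+d) k (stC_valid _ _) (by omega) hk h1
        rw [show t0 + N = (t0 + d + 1) + (N - d - 1) by omega] at hc
        have h4 := coded_back0 h hF hc
        rw [coded_iter_iff0 h hF, h3] at h4
        cases h4
      · obtain ⟨s, hs⟩ := Nat.exists_eq_add_of_le' h2
        exact hno o ho (coded_surv h hs)
    rw [H_raw hact]
    refine (hl _ (fun _ => e) i ?_).trans (hq i)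
    intro k hk
    unfold hat
    split_ifs with hcov
    · rfl
    · refine ih (by omega) k ?_ (fun o ho hco => hcov ⟨o, ho, hco⟩)
      have : |k - j| ≤ |k - i| + |i - j| := abs_sub_le _ _ _
      push_cast at hi
      linarith

/-! ### Building configurations -/

/-- bit of a coded block -/
def blk (P : RP) (s : ℕ) (g : ℕ → ℕ) (o : ℕ) : Bool :=
  if o < P.pos then P.HP.testBit o else if o < P.t then s.testBit (o - P.pos)
  else (g ((o - P.t) / (P.Q-1))).testBit ((o - P.t) % (P.Q-1))

theorem blk_chunk (h : P.OK) {j : ℤ} {s : ℕ} {g : ℕ → ℕ} (hg : ∀ b < P.t, g b < P.UF.length)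
    (hx : ∀ o : ℕ, o < P.ell → x (j + o) = P.blk s g o) {b : ℕ} (hb : b < P.t) :
    num x (j + (P.t + (P.Q-1) * b : ℕ)) (P.Q-1) = g b := by
  have hQ := h.hQ2
  have ht : P.t = P.pos + P.w := rfl
  rw [num_eq_iff ((hg b hb).trans_le (h.hW.trans (Nat.pow_le_pow_right (by norm_num) (by omega))))]
  intro o ho
  have hbe := body_end h hb
  have := hx (P.t + (P.Q-1) * b + o) (by omega)
  rw [Nat.cast_add, ← add_assoc] at this
  rw [this]
  unfold blk
  rw [if_neg (by omega), if_neg (by omega), show P.t + (P.Q-1) * b + o - P.t = (P.Q-1) * b + o by omega,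
    Nat.mul_add_div (by omega), Nat.div_eq_of_lt ho, Nat.mul_add_mod, Nat.mod_eq_of_lt ho, add_zero]

theorem blk_coded (h : P.OK) {j : ℤ} {s : ℕ} {g : ℕ → ℕ} (hs : s < P.S) (hg : ∀ b < P.t, g b < P.UF.length)
    (hx : ∀ o : ℕ, o < P.ell → x (j + o) = P.blk s g o) : P.Coded x j ∧ P.st x j = s := by
  have ht : P.t = P.pos + P.w := rfl
  have htl := t_le_ell h
  have hst : num x (j + P.pos) P.w = s := by
    rw [num_eq_iff (hs.trans_le h.hS)]
    intro o ho
    have := hx (P.pos + o) (by omega)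
    rw [Nat.cast_add, ← add_assoc] at this
    rw [this]; unfold blk; rw [if_neg (by omega), if_pos (by omega)]
    congr 1; omega
  refine ⟨⟨?_, ?_, ?_⟩, hst⟩
  · rw [num_eq_iff (HP_lt h)]
    intro o ho
    rw [hx o (by omega)]; unfold blk; rw [if_pos ho]
  · rw [hst]; exact hs
  · intro b hb
    rw [blk_chunk h hg hx hb]; exact hg b hb

/-- configuration from a state configuration and bodies -/
noncomputable def conf (P : RP) (p : ℤ) (c : ℤ → Option ℕ) (g : ℤ → ℕ → ℕ) : ℤ → Bool := fun i =>
  match c ((i - p) / P.ell) with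
  | some s => P.blk s (g ((i - p) / P.ell)) ((i - p) % P.ell).toNat
  | none => false

theorem conf_at (h : P.OK) (p : ℤ) (c : ℤ → Option ℕ) (g : ℤ → ℕ → ℕ) (k : ℤ) {o : ℕ} (ho : o < P.ell) :
    P.conf p c g (p + k * P.ell + o) = match c k with
      | some s => P.blk s (g k) o
      | none => false := by
  have hl : (0:ℤ) < P.ell := by exact_mod_cast ell_pos h
  have ho' : (o:ℤ) < P.ell := by exact_mod_cast ho
  have e1 : (p + k * P.ell + o - p) / P.ell = k := by
    rw [show p + k * P.ell + o - p = o + k * P.ell by ring, Int.add_mul_ediv_right _ _ hl.ne',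
      Int.ediv_eq_zero_of_lt (by omega) ho', zero_add]
  have e2 : (p + k * P.ell + o - p) % P.ell = o := by
    rw [show p + k * P.ell + o - p = o + k * P.ell by ring, Int.add_mul_emod_self_right,
      Int.emod_eq_of_lt (by omega) ho']
  unfold conf
  rw [e1, e2]; simp

theorem conf_stC (h : P.OK) (p : ℤ) (c : ℤ → Option ℕ) (g : ℤ → ℕ → ℕ) (hv : P.valid c)
    (hg : ∀ k, ∀ b < P.t, g k b < P.UF.length) : P.stC (P.conf p c g) p = c := by
  funext k
  cases hck : c k with
  | some s =>
    rw [stC_some]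
    apply blk_coded h (hv k s hck) (hg k)
    intro o ho
    rw [conf_at h p c g k ho, hck]
  | none =>
    unfold stC
    rw [if_neg]
    intro hco
    have h1 := hco.bit h (o := 0) (by unfold pos; omega)
    rw [conf_at h p c g k (ell_pos h), hck, HP_bit_lt (by have := h.ha; omega)] at h1
    cases h1

end RP


namespace RP
variable {P : RP} {F F' : (ℤ → Bool) → (ℤ → Bool)} {e : Bool} {x : ℤ → Bool}

theorem pieces (h : P.OK) (hF : ∀ x i, num (F x) i P.L ≠ P.un) {T n : ℕ} (hT : 2 * (n + P.Q) + 1 ≤ T)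
    (hno : ∀ (b : ℤ) (o : ℕ), o < P.ell → |b + o| ≤ n + P.Q → ¬ P.Coded ((P.H F e)^[T+1] x) b) :
    ∃ p : ℤ, ∀ m : ℤ, -(n + P.Q : ℤ) ≤ p + P.Q * m → p + P.Q * m + P.Q ≤ n + P.Q + 1 →
      num ((P.H F e)^[T+1] x) (p + P.Q * m) P.Q ∈ P.UF := by
  rw [Function.iterate_succ_apply'] at hno ⊢
  have hQ2 := h.hQ2
  have hl : (0:ℤ) < P.ell := by exact_mod_cast ell_pos h
  have hone : ∀ (i : ℤ) (o : ℕ), o < P.ell → |i| ≤ n + P.Q → P.act ((P.H F e)^[T] x) (i - o) ≠ 0 →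
      P.act ((P.H F e)^[T] x) (i - o) = 1 := by
    intro i o ho hi h0
    by_contra h1
    obtain ⟨s, hs⟩ : ∃ s, P.act ((P.H F e)^[T] x) (i - o) = s + 2 := ⟨_, (Nat.sub_add_cancel (by omega)).symm⟩
    exact hno (i - o) o ho (by simpa using hi) (coded_surv h hs)
  have hraw : ∀ q : ℤ, (∀ d : ℕ, d < P.Q → ∀ o : ℕ, o < P.ell → P.act ((P.H F e)^[T] x) (q + d - o) = 0) →
      num (P.H F e ((P.H F e)^[T] x)) q P.Q ∈ P.UF := by
    intro q hq
    rw [num_congr (y := F (P.hat e ((P.H F e)^[T] x))) (j := q) (fun d hd => H_raw (hq d hd))]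
    rw [h.hUF]
    refine ⟨num_lt _ _ _, fun o ho => ?_⟩
    rw [← num_sub ho]; exact hF _ _
  by_cases hex : ∃ (i : ℤ) (o : ℕ), |i| ≤ n + P.Q ∧ o < P.ell ∧ P.act ((P.H F e)^[T] x) (i - o) ≠ 0
  · obtain ⟨i, o, hi, ho, hact⟩ := hex
    refine ⟨i - o, fun m hm1 hm2 => ?_⟩
    by_cases hq : ∀ d : ℕ, d < P.Q → ∀ o' : ℕ, o' < P.ell →
        P.act ((P.H F e)^[T] x) (i - o + P.Q * m + d - o') = 0
    · exact hraw _ hq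
    · push Not at hq
      obtain ⟨d, hd, o', ho', h0⟩ := hq
      have hi' : |i - o + P.Q * m + d| ≤ n + P.Q := by rw [abs_le]; constructor <;> omega
      have h1 := hone _ o' ho' hi' h0
      have hcb := (act_coded h0).2.1
      have hcp := (act_coded hact).2.1
      rw [← Nat.zero_add T] at hcb hcp
      obtain ⟨k, hk, hb⟩ := phase h (K := T) (fun k hk => coded_back h hF hcp hk) (coded_back0 h hF hcb) (by
        have hTl : (2 * (n + P.Q) : ℤ) + P.ell ≤ T * P.ell := by
          have : (2 * (n + P.Q) + 1 : ℤ) ≤ T := by exact_mod_cast hT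
          nlinarith
        rw [abs_le] at hi hi' ⊢
        constructor <;> omega)
      set c := o' / P.Q with hc
      have e1 : P.Q * c + o' % P.Q = o' := Nat.div_add_mod _ _
      have e2 := Nat.mod_lt o' (show 0 < P.Q by omega)
      have hct : c < P.t := Nat.div_lt_of_lt_mul ho'
      have h6 := fired_piece (F := F) (e := e) h h1 hct
      have heq : i - o + P.Q * m + d - o' + ((P.Q * c : ℕ):ℤ) = i - o + P.Q * m := by
        have hell : (P.ell:ℤ) = P.Q * P.t := by unfold ell; push_cast; ring
        rw [hell] at hb
        have e3 : (P.Q:ℤ) * m + d - o' = P.Q * (k * P.t) := by linarith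
        have e4 : (P.Q:ℤ) * (m - k * P.t - c) = (o' % P.Q : ℕ) - d := by
          zify at e1; push_cast; linarith
        have e5 : m - k * P.t - c = 0 := by
          have a1 : ((o' % P.Q : ℕ):ℤ) < P.Q := by exact_mod_cast e2
          have a2 : (d:ℤ) < P.Q := by exact_mod_cast hd
          have a3 : (0:ℤ) ≤ (o' % P.Q : ℕ) := Int.natCast_nonneg _
          have a4 : (0:ℤ) ≤ d := Int.natCast_nonneg _
          generalize m - k * P.t - c = w at e4
          by_contra hw
          rcases lt_or_gt_of_ne hw with hw | hw <;> nlinarith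
        rw [e5] at e4
        push_cast
        zify at e1; push_cast at e1 e4
        linarith
      rw [heq] at h6
      rw [h6]
      exact pay_mem (act_coded h0).2.1 hct
  · push Not at hex
    refine ⟨0, fun m hm1 hm2 => hraw _ fun d hd o ho => hex _ o ?_ ho⟩
    rw [abs_le]; constructor <;> omega

theorem rebuild (h : P.OK) (hF : ∀ x i, num (F x) i P.L ≠ P.un) (hN4 : N4' P) (s n : ℕ) (y : ℤ → Bool) (p : ℤ)
    (hp : ∀ m : ℤ, -(n + P.Q : ℤ) ≤ p + P.Q * m → p + P.Q * m + P.Q ≤ n + P.Q + 1 →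
      num y (p + P.Q * m) P.Q ∈ P.UF) : ∃ z, ∀ i : ℤ, |i| ≤ n → (P.H F e)^[s+1] z i = y i := by
  classical
  have hQ2 := h.hQ2
  have hl : (1:ℤ) ≤ P.ell := by exact_mod_cast ell_pos h
  obtain ⟨c, hv, hc⟩ := hN4 s (n + p.natAbs)
  let g : ℤ → ℕ → ℕ := fun k b => if num y (p + P.Q * (k * P.t + b)) P.Q ∈ P.UF then
    P.UF.idxOf (num y (p + P.Q * (k * P.t + b)) P.Q) else 0
  have hg : ∀ k, ∀ b < P.t, g k b < P.UF.length := by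
    intro k b _
    simp only [g]
    split_ifs with hm
    · exact List.idxOf_lt_length_iff.2 hm
    · exact h.hW0
  refine ⟨P.conf p c g, fun i hi => ?_⟩
  rw [Function.iterate_succ_apply']
  obtain ⟨k, o, ho, hk⟩ := in_block h p i
  have hK := block_bd (K := n + p.natAbs) h ho hk (by
    have h1 : |i - p| ≤ |i| + |p| := abs_sub _ _
    push_cast
    nlinarith [abs_nonneg p, Int.natCast_nonneg n])
  have hf := hc k hK
  have hst := conf_stC h p c g hv hg
  rw [← hst, ← stC_iter (e := e) h hF, stC_fires] at hf
  have hct : o / P.Q < P.t := Nat.div_lt_of_lt_mul ho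
  have e1 : P.Q * (o / P.Q) + o % P.Q = o := Nat.div_add_mod _ _
  have e2 := Nat.mod_lt o (show 0 < P.Q by omega)
  have h6 := fired_piece (F := F) (e := e) h hf hct
  have hcod := (act_coded (P := P) (x := (P.H F e)^[s] (P.conf p c g)) (j := p + k * P.ell) (by omega)).2.1
  have hcod0 : P.Coded (P.conf p c g) (p + k * P.ell) := by
    rw [← Nat.zero_add s] at hcod
    exact coded_back0 h hF hcod
  have h7 : P.pay ((P.H F e)^[s] (P.conf p c g)) (p + k * P.ell) (o / P.Q) =
      P.pay (P.conf p c g) (p + k * P.ell) (o / P.Q) :=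
    pay_congr h (fun o h1 h2 => content h hF s hcod h2 (by omega)) hct
  have hsome : ∃ st, c k = some st := by
    rw [← hst]; exact ⟨_, stC_some.2 ⟨hcod0, rfl⟩⟩
  obtain ⟨σ, hσ⟩ := hsome
  have h8 := blk_chunk h (x := P.conf p c g) (j := p + k * P.ell) (s := σ) (hg k)
    (fun o ho => by rw [conf_at h p c g k ho, hσ]) hct
  have hell : (P.ell:ℤ) = P.Q * P.t := by unfold ell; push_cast; ring
  have hstart : p + k * P.ell + ((P.Q * (o / P.Q) : ℕ):ℤ) = p + P.Q * (k * P.t + ((o / P.Q : ℕ):ℤ)) := by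
    rw [hell]; push_cast; ring
  have hi2 : i = p + P.Q * (k * P.t + ((o / P.Q : ℕ):ℤ)) + ((o % P.Q : ℕ):ℤ) := by
    rw [← hstart, hk, add_assoc (p + k * P.ell), ← Nat.cast_add, e1]
  have hmem := hp (k * P.t + ((o / P.Q : ℕ):ℤ)) (by rw [abs_le] at hi; omega) (by rw [abs_le] at hi; omega)
  have h9 : P.pay (P.conf p c g) (p + k * P.ell) (o / P.Q) = num y (p + P.Q * (k * P.t + ((o / P.Q : ℕ):ℤ))) P.Q := by
    unfold pay
    rw [h8]
    simp only [g]
    rw [if_pos hmem, List.getD_eq_getElem _ _ (List.idxOf_lt_length_iff.2 hmem), List.getElem_idxOf]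
  rw [h7, h9, hstart] at h6
  have h10 := congrArg (fun v => Nat.testBit v (o % P.Q)) h6
  simp only [num_testBit, e2, decide_true, Bool.true_and] at h10
  rw [hi2]; exact h10

/-- the non-dying case -/
theorem limit_sub (h : P.OK) (hF : ∀ x i, num (F x) i P.L ≠ P.un) (hF' : ∀ x i, num (F' x) i P.L ≠ P.un)
    {r : ℕ} (hl : Loc r F) (hl' : Loc r F') (hq : ∀ i, F (fun _ => e) i = e) (hq' : ∀ i, F' (fun _ => e) i = e)
    (hr : r < P.ell) (hN4 : N4' P) (hN5 : N5' P) :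
    (⋂ j : ℕ, Set.range (P.H F e)^[j]) ⊆ ⋂ j : ℕ, Set.range (P.H F' e)^[j] := by
  intro y hy
  rw [Set.mem_iInter] at hy ⊢
  intro s
  apply (H_loc h hl').mem_range
  intro n
  by_cases hex : ∃ (b : ℤ) (o : ℕ), o < P.ell ∧ |b + o| ≤ n + P.Q ∧ P.Coded y b
  · obtain ⟨j, o, ho, hjo, hc⟩ := hex
    let N : ℕ := 2 * n + P.Q + 2 * P.ell
    obtain ⟨T0, hT0⟩ := hN5 N
    obtain ⟨x, hx⟩ := hy (T0 + s + N)
    have hx2 := hc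
    rw [← hx] at hx2
    have key : ∀ i : ℤ, |i| ≤ n → (P.H F' e)^[T0 + s + N] x i = y i := by
      intro i hi
      by_cases hcov : ∃ o : ℕ, o < P.ell ∧ P.Coded y (i - o)
      · obtain ⟨o, ho, hco⟩ := hcov
        rw [← hx] at hco ⊢
        have := content_eq h hF hF' _ hco ho
        rw [sub_add_cancel] at this
        exact this.symm
      · have hbd : |i - j| + r * N + P.ell ≤ N * P.ell := by
          have a1 : |i - j| ≤ 2 * n + P.Q + P.ell := by
            rw [abs_le] at hi hjo ⊢; constructor <;> omega
          have a2 : (r:ℤ) + 1 ≤ P.ell := by exact_mod_cast hr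
          have a3 : (N:ℤ) = 2 * n + P.Q + 2 * P.ell := by simp [N]
          have a4 : (0:ℤ) ≤ N := Int.natCast_nonneg _
          nlinarith
        have q1 := quiet h hF hl hq hx2 (fun c t k hv ht => hT0 c t k hv (by omega)) N le_rfl i hbd (by
          intro o ho hco; rw [hx] at hco; exact hcov ⟨o, ho, hco⟩)
        have q2 := quiet h hF' hl' hq' ((coded_other h hF hF' _ _).1 hx2)
          (fun c t k hv ht => hT0 c t k hv (by omega)) N le_rfl i hbd (by
          intro o ho hco
          rw [← coded_other h hF hF', hx] at hco; exact hcov ⟨o, ho, hco⟩)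
        rw [q2, ← hx, q1]
    obtain ⟨z, hz⟩ : (P.H F' e)^[T0 + s + N] x ∈ Set.range (P.H F' e)^[s] :=
      range_iterate_anti (by omega) ⟨x, rfl⟩
    exact ⟨z, fun i hi => by rw [hz]; exact key i hi⟩
  · push Not at hex
    obtain ⟨x, hx⟩ := hy ((2 * (n + P.Q) + 1) + 1)
    obtain ⟨p, hp⟩ := pieces h hF (T := 2 * (n + P.Q) + 1) (n := n) (x := x) (e := e) le_rfl (by
      intro b o ho hb; rw [hx]; exact hex b o ho hb)
    rw [hx] at hp
    obtain ⟨z, hz⟩ := rebuild (e := e) h hF' hN4 s n y p hp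
    obtain ⟨z', hz'⟩ : (P.H F' e)^[s+1] z ∈ Set.range (P.H F' e)^[s] :=
      range_iterate_anti (by omega) ⟨z, rfl⟩
    exact ⟨z', fun i hi => by rw [hz']; exact hz i hi⟩

end RP


/-! ## Stack machines and label systems -/

/-- abstract stack machine -/
structure SM (K Γ Q : Type) where
  ins : Q → Option (K × Option (Option Γ) × (Option Γ → Q))

namespace SM
variable {K Γ Q : Type} [DecidableEq K] (M : SM K Γ Q)

def opL (o : Option (Option Γ)) (l : List Γ) : List Γ :=
  match o with
  | none => l
  | some none => l.tail
  | some (some x) => x :: l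

def step (p : Q × (K → List Γ)) : Option (Q × (K → List Γ)) :=
  match M.ins p.1 with
  | none => none
  | some (k, o, nx) => some (nx (p.2 k).head?, Function.update p.2 k (opL o (p.2 k)))

/-- per-cell label -/
structure Y (K Γ : Type) (Rq : Type) where
  c : K → Option Γ
  lft : K → Option Γ
  rgt : K → Option Γ
  β : K → Option Γ
  q : Rq
  za : Bool
  ini : Bool

variable (R : Set Q)

def ValY (q0 : Q) (k0 : K) (z2 z3 : Bool) (sy : Option Γ) (jz : Bool) (y : Y K Γ R) : Prop :=
  M.ins y.q ≠ none ∧ y.za = z2 ∧ y.ini = z3 ∧ (z2 = true → y.β = y.c) ∧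
  (z3 = true → (y.q : Q) = q0 ∧ (z2 = true → jz = true) ∧ y.c = fun k => if k = k0 then sy else none)

def HY (y y' : Y K Γ R) : Prop := y'.q = y.q ∧ y'.β = y.β ∧ y.rgt = y'.c ∧ y'.lft = y.c

def opC (o : Option (Option Γ)) (za : Bool) (c lft rgt : Option Γ) : Option Γ :=
  match o with
  | none => c
  | some none => rgt
  | some (some x) => if za then some x else lft

def VY (y y' : Y K Γ R) : Prop := ∃ k o nx, M.ins y.q = some (k, o, nx) ∧ (y'.q : Q) = nx (y.β k) ∧
  y'.c = Function.update y.c k (opC o y.za (y.c k) (y.lft k) (y.rgt k))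

/-- the label system of the machine on an input `v` -/
def lsys (q0 : Q) (k0 : K) (sym : ℕ → Option Γ) (v : ℕ) : Lsys (Y K Γ R × Fin (v+2)) where
  H y y' := HY R y.1 y'.1 ∧ (y.1.ini = true → (y'.2 : ℕ) = min ((y.2 : ℕ)+1) (v+1))
  V y y' := M.VY R y.1 y'.1
  Val z2 z3 y := M.ValY R q0 k0 z2 z3 (sym y.2) (decide ((y.2:ℕ) = 0)) y.1

/-- runs -/
def run (p : Q × (K → List Γ)) : ℕ → Option (Q × (K → List Γ))
  | 0 => some p
  | n+1 => (run p n).bind M.step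

theorem run_prefix {p : Q × (K → List Γ)} {B : ℕ} (h : (M.run p B).isSome) : ∀ b ≤ B, (M.run p b).isSome := by
  induction B with
  | zero => intro b hb; rw [Nat.le_zero.1 hb]; rfl
  | succ B ih =>
    intro b hb
    rcases Nat.le_succ_iff.1 hb with hb | rfl
    · apply ih _ _ hb
      rw [run] at h
      cases hr : M.run p B with
      | none => rw [hr] at h; cases h
      | some _ => rfl
    · exact h

theorem opC_opL (o : Option (Option Γ)) (l : List Γ) (a : ℕ) :
    (opL o l)[a]? = opC o (decide (a = 0)) l[a]? (if a = 0 then none else l[a-1]?) l[a+1]? := by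
  rcases o with _ | _ | x
  · rfl
  · simp [opL, opC]
  · cases a <;> simp [opL, opC]

variable {M R} {q0 : Q} {k0 : K} {sym : ℕ → Option Γ} {v : ℕ}

/-- halting gives no labelled box -/
theorem no_box {inp : List Γ} (hsym : ∀ a, inp[a]? = sym (min a (v+1))) {B : ℕ} {p : Q × (K → List Γ)}
    (hB : M.run (q0, fun k => if k = k0 then inp else []) B = some p) (hh : M.ins p.1 = none) :
    ¬ ∃ lab, boxLab (M.lsys R q0 k0 sym v) (B+1) lab := by
  rintro ⟨lab, hlab⟩
  have key : ∀ b, ∀ a, a + b ≤ B → ∀ p, M.run (q0, fun k => if k = k0 then inp else []) b = some p →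
      ((lab a b).1.q : Q) = p.1 ∧ (lab a b).1.c = (fun k => (p.2 k)[a]?) := by
    intro b
    induction b with
    | zero =>
      intro a ha p hp
      have hj : ∀ a ≤ B, ((lab a 0).2 : ℕ) = min a (v+1) := by
        intro a
        induction a with
        | zero =>
          intro _
          have := (hlab 0 (by omega) 0 (by omega)).1.2.2.2.2 (by simp)
          have h2 := this.2.1 (by simp)
          rw [decide_eq_true_iff] at h2
          rw [h2]; simp
        | succ a iha =>
          intro ha
          have h1 := (hlab a (by omega) 0 (by omega))
          have h2 := (h1.2.1 (by omega)).2 (by rw [h1.1.2.2.1]; simp)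
          rw [h2, iha (by omega)]; omega
      simp only [run, Option.some.injEq] at hp
      subst hp
      have h1 := (hlab a (by omega) 0 (by omega)).1.2.2.2.2 (by simp)
      refine ⟨h1.1, ?_⟩
      rw [h1.2.2]
      funext k
      rw [hj a (by omega), ← hsym]
      by_cases hk : k = k0 <;> simp [hk]
    | succ b ih =>
      intro a ha p' hp'
      rw [run] at hp'
      obtain ⟨p, hp, hst⟩ := Option.bind_eq_some_iff.1 hp'
      have h0 := ih a (by omega) p hp
      have h1 := ih (a+1) (by omega) p hp
      obtain ⟨k, o, nx, hi, hq, hc⟩ := (hlab a (by omega) b (by omega)).2.2 (by omega)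
      have hβ : ∀ a, a + b ≤ B → (lab a b).1.β = fun k => (p.2 k).head? := by
        intro a
        induction a with
        | zero =>
          intro hb
          rw [(hlab 0 (by omega) b (by omega)).1.2.2.2.1 (by simp), (ih 0 (by omega) p hp).2]
          funext k; rw [List.head?_eq_getElem?]
        | succ a iha =>
          intro hb
          rw [((hlab a (by omega) b (by omega)).2.1 (by omega)).1.2.1, iha (by omega)]
      have hza : (lab a b).1.za = decide (a = 0) := (hlab a (by omega) b (by omega)).1.2.1
      have hrgt : (lab a b).1.rgt = fun k => (p.2 k)[a+1]? := by
        rw [((hlab a (by omega) b (by omega)).2.1 (by omega)).1.2.2.1, h1.2]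
      rw [h0.1] at hi
      unfold step at hst
      rw [hi] at hst
      simp only [Option.some.injEq] at hst
      subst hst
      refine ⟨?_, ?_⟩
      · rw [hq, hβ a (by omega)]
      · rw [hc, hza, hrgt, h0.2]
        funext k'
        by_cases hk : k' = k
        · subst hk
          simp only [Function.update_self]
          rw [opC_opL]
          cases a with
          | zero => rcases o with _ | _ | x <;> simp [opC]
          | succ a =>
            have hlft : (lab (a+1) b).1.lft = fun k => (p.2 k)[a]? := by
              rw [((hlab a (by omega) b (by omega)).2.1 (by omega)).1.2.2.2, (ih a (by omega) p hp).2]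
            rw [hlft]; simp
        · simp [Function.update_of_ne hk]
  have h1 := (key B 0 (by omega) p hB).1
  have h2 := (hlab 0 (by omega) B (by omega)).1.1
  rw [h1] at h2
  exact h2 hh

/-- non-halting gives a labelled quadrant -/
theorem quadrant {inp : List Γ} (hsym : ∀ a, inp[a]? = sym (min a (v+1)))
    (hrun : ∀ B, (M.run (q0, fun k => if k = k0 then inp else []) B).isSome)
    (h0 : q0 ∈ R) (hR : ∀ q ∈ R, ∀ k o nx, M.ins q = some (k, o, nx) → ∀ s, nx s ∈ R) :
    ∃ Lab : ℕ → ℕ → Y K Γ R × Fin (v+2),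
      (∀ a b, (M.lsys R q0 k0 sym v).Val (decide (a = 0)) (decide (b = 0)) (Lab a b)) ∧
      (∀ a b, (M.lsys R q0 k0 sym v).H (Lab a b) (Lab (a+1) b)) ∧
      (∀ a b, (M.lsys R q0 k0 sym v).V (Lab a b) (Lab a (b+1))) := by
  choose p hp using fun B => Option.isSome_iff_exists.1 (hrun B)
  have hstep : ∀ b, M.step (p b) = some (p (b+1)) := by
    intro b
    have := hp (b+1)
    rw [run, hp b] at this
    exact this
  have hins : ∀ b, ∃ k o nx, M.ins (p b).1 = some (k, o, nx) ∧ (p (b+1)).1 = nx ((p b).2 k).head? ∧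
      (p (b+1)).2 = Function.update (p b).2 k (opL o ((p b).2 k)) := by
    intro b
    have := hstep b
    unfold step at this
    rcases hi : M.ins (p b).1 with _ | ⟨k, o, nx⟩
    · rw [hi] at this; cases this
    · rw [hi] at this
      simp only [Option.some.injEq] at this
      exact ⟨k, o, nx, rfl, by rw [← this], by rw [← this]⟩
  have hp0 : p 0 = (q0, fun k => if k = k0 then inp else []) := by
    have := hp 0; simp only [run, Option.some.injEq] at this; exact this.symm
  have hmem : ∀ b, (p b).1 ∈ R := by
    intro b
    induction b with
    | zero => rw [hp0]; exact h0
    | succ b ih =>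
      obtain ⟨k, o, nx, h1, h2, -⟩ := hins b
      rw [h2]; exact hR _ ih _ _ _ h1 _
  let Lab : ℕ → ℕ → Y K Γ R × Fin (v+2) := fun a b =>
    (⟨fun k => ((p b).2 k)[a]?, fun k => if a = 0 then none else ((p b).2 k)[a-1]?, fun k => ((p b).2 k)[a+1]?,
      fun k => ((p b).2 k).head?, ⟨(p b).1, hmem b⟩, decide (a = 0), decide (b = 0)⟩,
      ⟨min a (v+1), by omega⟩)
  refine ⟨Lab, ?_, ?_, ?_⟩
  · intro a b
    refine ⟨?_, rfl, rfl, ?_, ?_⟩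
    · obtain ⟨k, o, nx, h1, -⟩ := hins b
      simp only [Lab]; rw [h1]; simp
    · intro ha
      rw [decide_eq_true_iff] at ha
      subst ha
      funext k; simp [Lab, List.head?_eq_getElem?]
    · intro hb
      rw [decide_eq_true_iff] at hb
      subst hb
      refine ⟨by simp only [Lab, hp0], ?_, ?_⟩
      · intro ha
        rw [decide_eq_true_iff] at ha
        subst ha
        simp [Lab]
      · funext k
        simp only [Lab, hp0, ← hsym]
        by_cases hk : k = k0 <;> simp [hk]
  · intro a b
    refine ⟨⟨rfl, rfl, rfl, ?_⟩, ?_⟩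
    · funext k; simp [Lab]
    · intro _; simp only [Lab]; omega
  · intro a b
    obtain ⟨k, o, nx, h1, h2, h3⟩ := hins b
    refine ⟨k, o, nx, h1, h2, ?_⟩
    simp only [Lab, h3]
    funext k'
    by_cases hk : k' = k
    · subst hk
      simp only [Function.update_self]
      rw [opC_opL]
    · simp [Function.update_of_ne hk]

end SM


/-! ## From Mathlib's TM2 machines to abstract stack machines -/

namespace TS
open Turing

section
variable {K Γ Λ σ : Type} [DecidableEq K]

abbrev St (K Γ Λ σ : Type) := TM2.Stmt (fun _ : K => Γ) Λ σ

def ins (k0 : K) (M : Λ → St K Γ Λ σ) :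
    Option (St K Γ Λ σ) × σ → Option (K × Option (Option Γ) × (Option Γ → Option (St K Γ Λ σ) × σ))
  | (none, _) => none
  | (some (TM2.Stmt.push k f q), s) => some (k, some (some (f s)), fun _ => (some q, s))
  | (some (TM2.Stmt.peek k f q), s) => some (k, none, fun o => (some q, f s o))
  | (some (TM2.Stmt.pop k f q), s) => some (k, some none, fun o => (some q, f s o))
  | (some (TM2.Stmt.load f q), s) => some (k0, none, fun _ => (some q, f s))
  | (some (TM2.Stmt.branch f q1 q2), s) => some (k0, none, fun _ => (some (cond (f s) q1 q2), s))
  | (some (TM2.Stmt.goto l), s) => some (k0, none, fun _ => (some (M (l s)), s))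
  | (some TM2.Stmt.halt, s) => some (k0, none, fun _ => (none, s))

def sm (k0 : K) (M : Λ → St K Γ Λ σ) : SM K Γ (Option (St K Γ Λ σ) × σ) := ⟨ins k0 M⟩

def cf (M : Λ → St K Γ Λ σ) (c : TM2.Cfg (fun _ : K => Γ) Λ σ) :
    (Option (St K Γ Λ σ) × σ) × (K → List Γ) := ((c.l.map M, c.var), c.stk)

theorem aux (k0 : K) (M : Λ → St K Γ Λ σ) (q : St K Γ Λ σ) (v : σ) (S : K → List Γ) :
    StateTransition.Reaches₁ (sm k0 M).step ((some q, v), S) (cf M (TM2.stepAux q v S)) := by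
  induction q generalizing v S with
  | push k f q ih =>
    exact Relation.TransGen.head (by rfl) (ih v _)
  | peek k f q ih =>
    refine Relation.TransGen.head ?_ (ih _ _)
    simp [SM.step, sm, ins, SM.opL]
  | pop k f q ih =>
    exact Relation.TransGen.head (by rfl) (ih _ _)
  | load f q ih =>
    refine Relation.TransGen.head ?_ (ih _ _)
    simp [SM.step, sm, ins, SM.opL]
  | branch f q1 q2 ih1 ih2 =>
    simp only [TM2.stepAux]
    cases h : f v
    · refine Relation.TransGen.head ?_ (ih2 _ _)
      simp [SM.step, sm, ins, SM.opL, h]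
    · refine Relation.TransGen.head ?_ (ih1 _ _)
      simp [SM.step, sm, ins, SM.opL, h]
  | goto l =>
    refine Relation.TransGen.single ?_
    simp [SM.step, sm, ins, SM.opL, cf]
  | halt =>
    refine Relation.TransGen.single ?_
    simp [SM.step, sm, ins, SM.opL, cf]

theorem resp (k0 : K) (M : Λ → St K Γ Λ σ) :
    StateTransition.Respects (TM2.step M) (sm k0 M).step (fun c d => d = cf M c) := by
  rintro ⟨l, v, S⟩ _ rfl
  cases l with
  | none => rfl
  | some l => exact ⟨_, rfl, aux k0 M (M l) v S⟩

theorem closed [Inhabited Λ] (k0 : K) (M : Λ → St K Γ Λ σ) (S : Finset Λ) (hS : TM2.Supports M S)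
    (q : Option (St K Γ Λ σ) × σ) (hq : q.1 ∈ TM2.stmts M S) (k o nx) (h : (sm k0 M).ins q = some (k, o, nx))
    (s : Option Γ) : (nx s).1 ∈ TM2.stmts M S := by
  classical
  have hn : (none : Option (St K Γ Λ σ)) ∈ TM2.stmts M S := by
    simp [TM2.stmts]
  rcases q with ⟨_ | q, v⟩
  · cases h
  have hsup := TM2.stmts_supportsStmt hS hq
  cases q with
  | goto l =>
    simp only [sm, ins, Option.some.injEq, Prod.mk.injEq] at h
    obtain ⟨rfl, rfl, rfl⟩ := h
    simp only [TM2.stmts, Finset.mem_insertNone, Finset.mem_biUnion]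
    intro a ha
    cases ha
    exact ⟨l v, hsup v, TM2.stmts₁_self⟩
  | halt =>
    simp only [sm, ins, Option.some.injEq, Prod.mk.injEq] at h
    obtain ⟨rfl, rfl, rfl⟩ := h
    exact hn
  | branch f q1 q2 =>
    simp only [sm, ins, Option.some.injEq, Prod.mk.injEq] at h
    obtain ⟨rfl, rfl, rfl⟩ := h
    refine TM2.stmts_trans ?_ hq
    cases f v <;> simp [TM2.stmts₁, TM2.stmts₁_self]
  | _ =>
    simp only [sm, ins, Option.some.injEq, Prod.mk.injEq] at h
    obtain ⟨rfl, rfl, rfl⟩ := h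
    refine TM2.stmts_trans ?_ hq
    simp [TM2.stmts₁, TM2.stmts₁_self]
end

theorem run_reaches {K Γ Q : Type} [DecidableEq K] (M : SM K Γ Q) (p d : Q × (K → List Γ)) :
    StateTransition.Reaches M.step p d ↔ ∃ B, M.run p B = some d := by
  constructor
  · intro h
    induction h with
    | refl => exact ⟨0, rfl⟩
    | tail _ h2 ih =>
      obtain ⟨B, hB⟩ := ih
      exact ⟨B+1, by rw [SM.run, hB]; exact h2⟩
  · rintro ⟨B, hB⟩
    induction B generalizing d with
    | zero => cases hB; exact Relation.ReflTransGen.refl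
    | succ B ih =>
      rw [SM.run] at hB
      obtain ⟨d', h1, h2⟩ := Option.bind_eq_some_iff.1 hB
      exact Relation.ReflTransGen.tail (ih d' h1) h2

theorem halts_iff {K Γ Q : Type} [DecidableEq K] (M : SM K Γ Q) (p : Q × (K → List Γ)) :
    (StateTransition.eval M.step p).Dom ↔ ∃ B d, M.run p B = some d ∧ M.ins d.1 = none := by
  have hs : ∀ d : Q × (K → List Γ), M.step d = none ↔ M.ins d.1 = none := by
    intro d
    rw [SM.step]
    cases h : M.ins d.1 <;> simp
  rw [Part.dom_iff_mem]
  simp only [StateTransition.mem_eval, run_reaches, hs]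
  constructor
  · rintro ⟨d, ⟨B, h⟩, h'⟩; exact ⟨B, d, h, h'⟩
  · rintro ⟨B, d, h, h'⟩; exact ⟨d, ⟨B, h⟩, h'⟩

theorem not_halts {K Γ Q : Type} [DecidableEq K] (M : SM K Γ Q) (p : Q × (K → List Γ))
    (h : ¬ ∃ B d, M.run p B = some d ∧ M.ins d.1 = none) (B : ℕ) : (M.run p B).isSome := by
  induction B with
  | zero => rfl
  | succ B ih =>
    obtain ⟨d, hd⟩ := Option.isSome_iff_exists.1 ih
    rw [SM.run, hd, Option.bind_some, SM.step]
    cases h' : M.ins d.1 with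
    | none => exact absurd ⟨B, d, hd, h'⟩ h
    | some _ => rfl

/-- class of the `j`-th input symbol: 0 none, 1 cons, 2 bit0, 3 bit1 -/
def sc (n j : ℕ) : ℕ := if 0 < j ∧ n / 2^(j-1) = 0 then 0 else if n / 2^j = 0 then 1 else 2 + n / 2^j % 2

open PartrecToTM2 in
def syg : ℕ → Option Γ'
  | 0 => none
  | 1 => some Γ'.cons
  | 2 => some Γ'.bit0
  | _ => some Γ'.bit1

theorem sc_succ (n j : ℕ) (h : n ≠ 0) : sc n (j+1) = sc (n/2) j := by
  have e : ∀ j, n / 2^(j+1) = n / 2 / 2^j := fun j => by rw [pow_succ', Nat.div_div_eq_div_mul]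
  unfold sc
  rw [e]
  cases j with
  | zero => simp [h]
  | succ j => simp [e]

open PartrecToTM2 in
theorem sc_pos (p : PosNum) (a : ℕ) : (trPosNum p ++ [Γ'.cons])[a]? = syg (sc (p : ℕ) a) := by
  induction p generalizing a with
  | one =>
    match a with
    | 0 => simp [trPosNum, sc, syg]
    | 1 => simp [trPosNum, sc, syg]
    | a+2 => simp [trPosNum, sc, syg]
  | bit0 p ih =>
    have hp := PosNum.cast_pos (α := ℕ) p
    have : ((PosNum.bit0 p : PosNum) : ℕ) = 2 * (p:ℕ) := by rw [PosNum.cast_bit0]; omega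
    rw [this]
    cases a with
    | zero =>
      have : ¬ ((p:ℕ) = 0) := by omega
      simp [trPosNum, sc, syg, this]
    | succ a =>
      rw [sc_succ _ _ (by omega), show 2 * (p:ℕ) / 2 = p by omega, ← ih]
      simp [trPosNum]
  | bit1 p ih =>
    have hp := PosNum.cast_pos (α := ℕ) p
    have : ((PosNum.bit1 p : PosNum) : ℕ) = 2 * (p:ℕ) + 1 := by rw [PosNum.cast_bit1]; omega
    rw [this]
    cases a with
    | zero =>
      have : (2 * (p:ℕ) + 1) % 2 = 1 := by omega
      simp [trPosNum, sc, syg, this]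
    | succ a =>
      rw [sc_succ _ _ (by omega), show (2 * (p:ℕ) + 1) / 2 = p by omega, ← ih]
      simp [trPosNum]

open PartrecToTM2 in
theorem sc_list (n a : ℕ) : (trList [n])[a]? = syg (sc n a) := by
  simp only [trList, trNat]
  have h : ∀ m : Num, (trNum m ++ [Γ'.cons])[a]? = syg (sc (m:ℕ) a) := by
    intro m
    cases m with
    | zero => cases a <;> simp [trNum, sc, syg]
    | pos p => exact sc_pos p a
  rw [h, Num.to_of_nat]

theorem sc_min (n a : ℕ) : sc n a = sc n (min a (n+1)) := by
  rcases le_total a (n+1) with h | h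
  · rw [min_eq_left h]
  · rw [min_eq_right h]
    have e : ∀ j, n + 1 ≤ j → sc n j = 0 := by
      intro j hj
      have : n / 2^(j-1) = 0 := by
        apply Nat.div_eq_of_lt
        exact lt_of_lt_of_le Nat.lt_two_pow_self (Nat.pow_le_pow_right (by norm_num) (by omega))
      simp [sc, this]; omega
    rw [e _ h, e _ le_rfl]

/-- the halting predicate used -/
def Hlt (n : ℕ) : Prop := ((Denumerable.ofNat Nat.Partrec.Code n).eval 0).Dom

theorem Hlt_undec : ¬ ComputablePred Hlt := by
  intro h
  apply ComputablePred.halting_problem 0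
  have : ComputablePred (fun c : Nat.Partrec.Code => Hlt (Encodable.encode c)) := by
    obtain ⟨_, h⟩ := h
    exact ⟨fun _ => inferInstance, h.comp Computable.encode⟩
  simpa [Hlt] using this

open PartrecToTM2 in
theorem machine : ∃ (Q : Type) (M : SM K' Γ' Q) (R : Set Q) (q0 : Q), R.Finite ∧ q0 ∈ R ∧
    (∀ q ∈ R, ∀ k o nx, M.ins q = some (k, o, nx) → ∀ s, nx s ∈ R) ∧
    ∀ n, Hlt n ↔ ∃ B d, M.run (q0, fun k => if k = K'.main then trList [n] else []) B = some d ∧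
      M.ins d.1 = none := by
  have hp : Partrec (fun n : ℕ => (Denumerable.ofNat Nat.Partrec.Code n).eval 0) := by
    refine Partrec₂.comp Nat.Partrec.Code.eval_part (Computable.ofNat _) (Computable.const 0)
  have hp' := Nat.Partrec'.part_iff₁.2 hp
  obtain ⟨c, hc⟩ := Turing.ToPartrec.Code.exists_code hp'
  let _ : Inhabited Λ' := ⟨trNormal c Cont'.halt⟩
  have hs : TM2.Supports tr (codeSupp c Cont'.halt) := tr_supports c Cont'.halt
  refine ⟨_, sm K'.main tr, {p | p.1 ∈ TM2.stmts tr (codeSupp c Cont'.halt)},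
    (some (tr (trNormal c Cont'.halt)), none), ?_, ?_, ?_, ?_⟩
  · have : {p : Option (St K' Γ' Λ' (Option Γ')) × (Option Γ') | p.1 ∈ TM2.stmts tr (codeSupp c Cont'.halt)}
      = (TM2.stmts tr (codeSupp c Cont'.halt) : Set _) ×ˢ Set.univ := by ext; simp
    rw [this]
    exact (Finset.finite_toSet _).prod Set.finite_univ
  · simp only [Set.mem_ofPred_eq, TM2.stmts, Finset.mem_insertNone, Finset.mem_biUnion]
    intro a ha
    cases ha
    exact ⟨_, hs.1, TM2.stmts₁_self⟩
  · intro q hq k o nx h s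
    exact closed K'.main tr _ hs q hq k o nx h s
  · intro n
    rw [← halts_iff]
    have e : ((some (tr (trNormal c Cont'.halt)), none), fun k => if k = K'.main then trList [n] else [])
       = cf tr (⟨some (trNormal c Cont'.halt), none, K'.elim (trList [n]) [] [] []⟩ : Cfg') := by
      simp only [cf, Option.map]
      congr 1
      funext k
      cases k <;> rfl
    refine Iff.trans ?_ (StateTransition.tr_eval_dom (resp K'.main tr) e).symm
    have := tr_eval c [n]
    have h2 := hc (n ::ᵥ List.Vector.nil)
    change c.eval [n] = _ at h2
    rw [h2] at this
    erw [this]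
    rfl

/-- label systems, abstractly -/
def LS {Y : Type} (H0 V0 : Y → Y → Prop) (Val0 : Bool → Bool → ℕ → Bool → Y → Prop) (ini : Y → Bool) (n : ℕ) :
    Lsys (Y × Fin (n+2)) where
  H y y' := H0 y.1 y'.1 ∧ (ini y.1 = true → (y'.2 : ℕ) = min ((y.2 : ℕ)+1) (n+1))
  V y y' := V0 y.1 y'.1
  Val z2 z3 y := Val0 z2 z3 (sc n y.2) (decide ((y.2:ℕ) = 0)) y.1

open PartrecToTM2 in
theorem labels : ∃ (Y : Type) (_ : Finite Y) (_ : Nonempty Y) (H0 V0 : Y → Y → Prop)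
    (Val0 : Bool → Bool → ℕ → Bool → Y → Prop) (ini : Y → Bool), ∀ n,
    (Hlt n → ∃ B, ¬ ∃ lab, boxLab (LS H0 V0 Val0 ini n) B lab) ∧
    (¬ Hlt n → ∃ Lab : ℕ → ℕ → Y × Fin (n+2),
      (∀ a b, (LS H0 V0 Val0 ini n).Val (decide (a = 0)) (decide (b = 0)) (Lab a b)) ∧
      (∀ a b, (LS H0 V0 Val0 ini n).H (Lab a b) (Lab (a+1) b)) ∧
      (∀ a b, (LS H0 V0 Val0 ini n).V (Lab a b) (Lab a (b+1)))) := by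
  obtain ⟨Q, M, R, q0, hRf, h0, hcl, hh⟩ := machine
  have : Finite R := hRf
  refine ⟨SM.Y K' Γ' R, ?_, ⟨⟨fun _ => none, fun _ => none, fun _ => none, fun _ => none, ⟨q0, h0⟩, true, true⟩⟩,
    SM.HY R, M.VY R, fun z2 z3 s jz y => M.ValY R q0 K'.main z2 z3 (syg s) jz y, fun y => y.ini, fun n => ?_⟩
  · let f : SM.Y K' Γ' R → (K' → Option Γ') × (K' → Option Γ') × (K' → Option Γ') × (K' → Option Γ') × R × Bool × Bool :=
      fun y => (y.c, y.lft, y.rgt, y.β, y.q, y.za, y.ini)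
    have : Finite K' := Finite.of_injective (β := Fin 4) (fun k => match k with | .main => 0 | .rev => 1 | .aux => 2 | .stack => 3)
      (by intro a b h; cases a <;> cases b <;> first | rfl | (revert h; decide))
    apply Finite.of_injective f
    rintro ⟨⟩ ⟨⟩ h
    simp only [f, Prod.mk.injEq] at h
    obtain ⟨rfl, rfl, rfl, rfl, rfl, rfl, rfl⟩ := h
    rfl
  · have hsym : ∀ a, (trList [n])[a]? = (fun j => syg (sc n j)) (min a (n+1)) := by
      intro a
      show _ = syg (sc n (min a (n+1)))
      rw [← sc_min, sc_list]
    constructor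
    · intro h
      obtain ⟨B, d, h1, h2⟩ := (hh n).1 h
      exact ⟨B+1, M.no_box (R := R) (sym := fun j => syg (sc n j)) (v := n) hsym h1 h2⟩
    · intro h
      rw [hh n] at h
      exact M.quadrant (R := R) (sym := fun j => syg (sc n j)) (v := n) hsym (not_halts M _ h) h0 hcl

end TS


/-! ## Transfer of the interface along an enumeration of the states -/

def Res.mp {A B : Type*} (f : A → B) : Res A → Res B
  | .die => .die
  | .fire => .fire
  | .alive a => .alive (f a)

theorem stp_map {A B : Type*} {ν : A → A → Res A} {μ : B → B → Res B} {f : A → B}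
    (h : ∀ a b, μ (f a) (f b) = (ν a b).mp f) (c : ℤ → Option A) :
    stp μ (fun i => (c i).map f) = fun i => (stp ν c i).map f := by
  funext i
  unfold stp
  beta_reduce
  generalize c (i-1) = p
  generalize c i = q
  generalize c (i+1) = r
  rcases p with _ | a <;> rcases q with _ | b <;> rcases r with _ | d <;> simp
  rw [h]
  cases ν a b <;> simp [Res.mp]

theorem stp_map_iter {A B : Type*} {ν : A → A → Res A} {μ : B → B → Res B} {f : A → B}
    (h : ∀ a b, μ (f a) (f b) = (ν a b).mp f) (T : ℕ) (c : ℤ → Option A) :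
    (stp μ)^[T] (fun i => (c i).map f) = fun i => ((stp ν)^[T] c i).map f := by
  induction T with
  | zero => rfl
  | succ T ih => rw [Function.iterate_succ_apply', ih, stp_map h, Function.iterate_succ_apply']

theorem fires_map {A B : Type*} {ν : A → A → Res A} {μ : B → B → Res B} {f : A → B}
    (h : ∀ a b, μ (f a) (f b) = (ν a b).mp f) (c : ℤ → Option A) (i : ℤ) :
    fires μ (fun i => (c i).map f) i ↔ fires ν c i := by
  unfold fires
  constructor
  · rintro ⟨_, _, _, h1, h2, h3, h4⟩
    obtain ⟨a, ha, rfl⟩ := Option.map_eq_some_iff.1 h1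
    obtain ⟨b, hb, rfl⟩ := Option.map_eq_some_iff.1 h2
    obtain ⟨d, hd, rfl⟩ := Option.map_eq_some_iff.1 h3
    refine ⟨a, b, d, ha, hb, hd, ?_⟩
    rw [h] at h4
    revert h4
    cases ν a b <;> simp [Res.mp]
  · rintro ⟨a, b, d, h1, h2, h3, h4⟩
    exact ⟨f a, f b, f d, by simp [h1], by simp [h2], by simp [h3], by rw [h, h4]; rfl⟩

namespace RP
variable {P : RP} {A : Type*} {ν : A → A → Res A} {enc : A → ℕ}

theorem valid_lift (hr : ∀ s, s < P.S → ∃ a, enc a = s) {c : ℤ → Option ℕ} (hc : P.valid c) :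
    ∃ d : ℤ → Option A, c = fun i => (d i).map enc := by
  have : ∀ i, ∃ o : Option A, c i = o.map enc := by
    intro i
    cases h : c i with
    | none => exact ⟨none, rfl⟩
    | some s =>
      obtain ⟨a, rfl⟩ := hr s (hc i s h)
      exact ⟨some a, rfl⟩
  choose d hd using this
  exact ⟨d, funext hd⟩

theorem tr_dying (hr : ∀ s, s < P.S → ∃ a, enc a = s) (h : ∀ a b, P.nu (enc a) (enc b) = (ν a b).mp enc)
    (hd : ∃ T : ℕ, ∀ c : ℤ → Option A, (stp ν)^[T] c 0 = none) :
    ∃ T : ℕ, ∀ c, P.valid c → (stp P.nu)^[T] c 0 = none := by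
  obtain ⟨T, hT⟩ := hd
  refine ⟨T, fun c hc => ?_⟩
  obtain ⟨d, rfl⟩ := valid_lift hr hc
  rw [stp_map_iter h]
  simp [hT]

theorem tr_N4 (hv : ∀ a, enc a < P.S) (h : ∀ a b, P.nu (enc a) (enc b) = (ν a b).mp enc)
    (hd : ∀ T J : ℕ, ∃ c : ℤ → Option A, ∀ i : ℤ, |i| ≤ J → fires ν ((stp ν)^[T] c) i) : N4' P := by
  intro T J
  obtain ⟨c, hc⟩ := hd T J
  refine ⟨fun i => (c i).map enc, ?_, fun i hi => ?_⟩
  · intro i s hs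
    obtain ⟨a, -, rfl⟩ := Option.map_eq_some_iff.1 hs
    exact hv a
  · rw [stp_map_iter h, fires_map h]
    exact hc i hi

theorem tr_N5 (hr : ∀ s, s < P.S → ∃ a, enc a = s) (h : ∀ a b, P.nu (enc a) (enc b) = (ν a b).mp enc)
    (hd : ∀ n : ℕ, ∃ T0 : ℕ, ∀ (c : ℤ → Option A) (t : ℕ) (k : ℤ),
    T0 ≤ t → |k| ≤ n → fires ν ((stp ν)^[t] c) k → (stp ν)^[t+1] c 0 = none) : N5' P := by
  intro n
  obtain ⟨T0, hT⟩ := hd n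
  refine ⟨T0, fun c t k hc ht hk hf => ?_⟩
  obtain ⟨d, rfl⟩ := valid_lift hr hc
  rw [stp_map_iter h, fires_map h] at hf
  rw [stp_map_iter h]
  simp [hT d t k ht hk hf]

end RP


/-! ## The transition function as an arithmetic function -/

namespace TS

/-- transition code, from tables -/
def nuT (κ res : ℕ → ℕ → ℕ) (zb : ℕ → ℕ) (valT hT vT : ℕ → ℕ → ℕ) (iT : ℕ → ℕ) (s0 y0 n s s' : ℕ) : ℕ :=
  if κ (s%s0) (s'%s0) = 1 then 1 else
  if κ (s%s0) (s'%s0) = 0 then 0 else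
  if valT ((zb (s'%s0) % 4 + 4 * (sc n (s'/s0/(y0*(n+2))/y0) + 4 * (if s'/s0/(y0*(n+2))/y0 = 0 then 1 else 0))) % 32)
      (s'/s0/(y0*(n+2)) % y0) = 1 ∧
    (κ (s%s0) (s'%s0) = 3 → s/s0%(y0*(n+2)) = s'/s0/(y0*(n+2))) ∧
    (κ (s%s0) (s'%s0) = 4 → hT (s'/s0/(y0*(n+2)) % y0) (s/s0%(y0*(n+2)) % y0) = 1 ∧
      (iT (s'/s0/(y0*(n+2)) % y0) = 1 → s/s0%(y0*(n+2))/y0 = min (s'/s0/(y0*(n+2))/y0 + 1) (n+1))) ∧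
    (κ (s%s0) (s'%s0) = 5 → vT (s'/s0/(y0*(n+2)) % y0) (s/s0%(y0*(n+2)) % y0) = 1)
  then res (s%s0) (s'%s0) + s0 * (s/s0%(y0*(n+2)) + y0*(n+2) * (s'/s0/(y0*(n+2)))) + 2 else 0

theorem sc_lt (n j : ℕ) : sc n j < 4 := by
  unfold sc
  split_ifs <;> omega

section
variable {Y : Type} {s0 y0 : ℕ} (eF : Fst ≃ Fin s0) (eY : Y ≃ Fin y0)

def lab (n : ℕ) (l : Y × Fin (n+2)) : ℕ := eY l.1 + y0 * l.2

def enc (n : ℕ) (x : FA (Y × Fin (n+2))) : ℕ := eF x.1 + s0 * (lab eY n x.2.1 + y0 * (n+2) * lab eY n x.2.2)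

theorem lab_mod (n : ℕ) (l : Y × Fin (n+2)) : lab eY n l % y0 = eY l.1 := by
  rw [lab, Nat.add_mul_mod_self_left, Nat.mod_eq_of_lt (eY l.1).2]

theorem lab_div (n : ℕ) (l : Y × Fin (n+2)) : lab eY n l / y0 = l.2 := by
  have h := (eY l.1).2
  rw [lab, Nat.add_mul_div_left _ _ (by omega), Nat.div_eq_of_lt h, zero_add]

theorem lab_lt (n : ℕ) (l : Y × Fin (n+2)) : lab eY n l < y0 * (n+2) := by
  have h := (eY l.1).2
  have h2 := l.2.2
  unfold lab
  calc _ < y0 + y0 * (l.2:ℕ) := by omega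
    _ = y0 * (l.2 + 1) := by ring
    _ ≤ _ := Nat.mul_le_mul_left _ (by omega)

theorem lab_inj (n : ℕ) {l l' : Y × Fin (n+2)} (h : lab eY n l = lab eY n l') : l = l' := by
  have h1 := lab_mod eY n l
  have h2 := lab_div eY n l
  rw [h, lab_mod] at h1
  rw [h, lab_div] at h2
  exact Prod.ext (eY.injective (Fin.ext h1.symm)) (Fin.ext h2.symm)

theorem lab_surj (n s : ℕ) (h : s < y0 * (n+2)) : ∃ l : Y × Fin (n+2), lab eY n l = s := by
  have hy : 0 < y0 := by
    rcases Nat.eq_zero_or_pos y0 with rfl | h'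
    · simp at h
    · exact h'
  refine ⟨(eY.symm ⟨s % y0, Nat.mod_lt _ hy⟩, ⟨s / y0, Nat.div_lt_of_lt_mul h⟩), ?_⟩
  simp [lab, Nat.mod_add_div]

theorem enc_mod (n : ℕ) (x : FA (Y × Fin (n+2))) : enc eF eY n x % s0 = eF x.1 := by
  rw [enc, Nat.add_mul_mod_self_left, Nat.mod_eq_of_lt (eF x.1).2]

theorem enc_div (n : ℕ) (x : FA (Y × Fin (n+2))) :
    enc eF eY n x / s0 = lab eY n x.2.1 + y0 * (n+2) * lab eY n x.2.2 := by
  have h := (eF x.1).2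
  rw [enc, Nat.add_mul_div_left _ _ (by omega), Nat.div_eq_of_lt h, zero_add]

theorem enc_l (n : ℕ) (x : FA (Y × Fin (n+2))) : enc eF eY n x / s0 % (y0 * (n+2)) = lab eY n x.2.1 := by
  rw [enc_div, Nat.add_mul_mod_self_left, Nat.mod_eq_of_lt (lab_lt eY n _)]

theorem enc_m (n : ℕ) (x : FA (Y × Fin (n+2))) : enc eF eY n x / s0 / (y0 * (n+2)) = lab eY n x.2.2 := by
  have h := lab_lt eY n x.2.1
  rw [enc_div, Nat.add_mul_div_left _ _ (by omega), Nat.div_eq_of_lt h, zero_add]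

def Sz (s0 y0 n : ℕ) : ℕ := s0 * (y0 * (n+2) * (y0 * (n+2)))

theorem enc_lt (n : ℕ) (x : FA (Y × Fin (n+2))) : enc eF eY n x < Sz s0 y0 n := by
  have h := (eF x.1).2
  have h1 := lab_lt eY n x.2.1
  have h2 := lab_lt eY n x.2.2
  unfold enc Sz
  generalize lab eY n x.2.1 = l at *
  generalize lab eY n x.2.2 = m at *
  generalize y0 * (n+2) = X at *
  have h3 : l + X * m + 1 ≤ X * X := by
    calc l + X * m + 1 ≤ X + X * m := by omega
      _ = X * (m+1) := by ring
      _ ≤ _ := Nat.mul_le_mul_left _ (by omega)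
  calc _ < s0 + s0 * (l + X * m) := by omega
    _ = s0 * (l + X * m + 1) := by ring
    _ ≤ _ := Nat.mul_le_mul_left _ h3

theorem enc_surj (n s : ℕ) (h : s < Sz s0 y0 n) : ∃ x : FA (Y × Fin (n+2)), enc eF eY n x = s := by
  unfold Sz at h
  have hs : 0 < s0 := by
    rcases Nat.eq_zero_or_pos s0 with rfl | h'
    · simp at h
    · exact h'
  have hX : 0 < y0 * (n+2) := by
    rcases Nat.eq_zero_or_pos (y0 * (n+2)) with h0 | h'
    · rw [h0] at h; simp at h
    · exact h'
  have h1 : s / s0 < y0 * (n+2) * (y0 * (n+2)) := Nat.div_lt_of_lt_mul h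
  obtain ⟨l, hl⟩ := lab_surj eY n (s / s0 % (y0 * (n+2))) (Nat.mod_lt _ hX)
  obtain ⟨m, hm⟩ := lab_surj eY n (s / s0 / (y0 * (n+2))) (Nat.div_lt_of_lt_mul h1)
  refine ⟨(eF.symm ⟨s % s0, Nat.mod_lt _ hs⟩, l, m), ?_⟩
  simp [enc, hl, hm, Nat.mod_add_div]

variable (H0 V0 : Y → Y → Prop) (Val0 : Bool → Bool → ℕ → Bool → Y → Prop) (ini : Y → Bool)

theorem bit_eq (b c : Bool) (v : ℕ) (hv : v < 4) (d : Bool) :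
    ((b.toNat + 2 * c.toNat) % 4 + 4 * (v + 4 * d.toNat)) % 32 = b.toNat + 2 * c.toNat + 4 * (v + 4 * d.toNat) := by
  have := b.toNat_le; have := c.toNat_le; have := d.toNat_le
  omega

theorem bit_dec (b c : Bool) (v : ℕ) (hv : v < 4) (d : Bool) :
    decide ((b.toNat + 2 * c.toNat + 4 * (v + 4 * d.toNat)) % 2 = 1) = b ∧
    decide ((b.toNat + 2 * c.toNat + 4 * (v + 4 * d.toNat)) / 2 % 2 = 1) = c ∧
    ((b.toNat + 2 * c.toNat + 4 * (v + 4 * d.toNat)) / 4 % 4) = v ∧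
    decide ((b.toNat + 2 * c.toNat + 4 * (v + 4 * d.toNat)) / 16 = 1) = d := by
  refine ⟨?_, ?_, ?_, ?_⟩
  · cases b <;> cases c <;> cases d <;> simp <;> omega
  · cases b <;> cases c <;> cases d <;> simp <;> omega
  · cases b <;> cases c <;> cases d <;> simp <;> omega
  · cases b <;> cases c <;> cases d <;> simp <;> omega

open Classical in
theorem nuT_spec [Nonempty Y] : ∃ (κ res : ℕ → ℕ → ℕ) (zb : ℕ → ℕ) (valT hT vT : ℕ → ℕ → ℕ) (iT : ℕ → ℕ),
    ∀ n a b, RP.resOf (nuT κ res zb valT hT vT iT s0 y0 n (enc eF eY n a) (enc eF eY n b)) =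
      (fnu (LS H0 V0 Val0 ini n) a b).mp (enc eF eY n) := by
  have : Nonempty Fst := ⟨⟨⟨0,0,0,true⟩,⟨0,0,0,true⟩,true,true,⟨0,0,0,true⟩,⟨0,0,0,true⟩,true,true,true,true,true,true,true,true,true⟩⟩
  obtain ⟨dF, hdF⟩ := Function.Injective.hasLeftInverse (f := fun f => (eF f : ℕ))
    (fun a b h => eF.injective (Fin.ext h))
  obtain ⟨dY, hdY⟩ := Function.Injective.hasLeftInverse (f := fun f => (eY f : ℕ))
    (fun a b h => eY.injective (Fin.ext h))
  have hdF : ∀ f, dF (eF f) = f := hdF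
  have hdY : ∀ f, dY (eY f) = f := hdY
  have ht : ∀ W N : Fst, ∃ t : Ty × Ty, (∃ t : Ty × Ty, fC W N t.1 t.2) → fC W N t.1 t.2 := by
    intro W N
    by_cases h : ∃ t : Ty × Ty, fC W N t.1 t.2
    · exact ⟨h.choose, fun _ => h.choose_spec⟩
    · exact ⟨(.zero, .zero), fun h' => absurd h' h⟩
  choose ty hty using ht
  let kk : Ty × Ty → ℕ := fun t => if t = (.zero, .zero) then 3 else if t = (.neg1, .zero) then 4 else
    if t = (.zero, .neg1) then 5 else 2
  have k3 : ∀ t, kk t = 3 ↔ t.1 = .zero ∧ t.2 = .zero := by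
    rintro ⟨t, u⟩; cases t <;> cases u <;> simp [kk]
  have k4 : ∀ t, kk t = 4 ↔ t.1 = .neg1 ∧ t.2 = .zero := by
    rintro ⟨t, u⟩; cases t <;> cases u <;> simp [kk]
  have k5 : ∀ t, kk t = 5 ↔ t.1 = .zero ∧ t.2 = .neg1 := by
    rintro ⟨t, u⟩; cases t <;> cases u <;> simp [kk]
  have k0 : ∀ t, kk t ≠ 0 := by
    rintro ⟨t, u⟩; cases t <;> cases u <;> simp [kk]
  have k1 : ∀ t, kk t ≠ 1 := by
    rintro ⟨t, u⟩; cases t <;> cases u <;> simp [kk]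
  let κ : ℕ → ℕ → ℕ := fun k k' => if (dF k).boom = true ∨ (dF k').boom = true then 1 else
    if ∃ t : Ty × Ty, fC (dF k) (dF k') t.1 t.2 then kk (ty (dF k) (dF k')) else 0
  let res : ℕ → ℕ → ℕ := fun k k' => eF (fX (dF k) (dF k') (ty (dF k) (dF k')).1 (ty (dF k) (dF k')).2)
  let zb : ℕ → ℕ := fun k => (decide ((dF k).C2.c ≠ 0)).toNat + 2 * (decide ((dF k).C3.c ≠ 0)).toNat
  let valT : ℕ → ℕ → ℕ := fun z y => if Val0 (decide (z % 2 = 1)) (decide (z / 2 % 2 = 1)) (z / 4 % 4)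
    (decide (z / 16 = 1)) (dY y) then 1 else 0
  let hT : ℕ → ℕ → ℕ := fun y y' => if H0 (dY y) (dY y') then 1 else 0
  let vT : ℕ → ℕ → ℕ := fun y y' => if V0 (dY y) (dY y') then 1 else 0
  let iT : ℕ → ℕ := fun y => (ini (dY y)).toNat
  refine ⟨κ, res, zb, valT, hT, vT, iT, fun n a b => ?_⟩
  unfold nuT
  simp only [enc_mod, enc_l, enc_m, lab_mod, lab_div]
  obtain ⟨W, l, l'⟩ := a
  obtain ⟨N, m', m⟩ := b
  have eκ : κ (eF W) (eF N) = if W.boom = true ∨ N.boom = true then 1 else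
    if ∃ t : Ty × Ty, fC W N t.1 t.2 then kk (ty W N) else 0 := by simp only [κ, hdF]
  have er : res (eF W) (eF N) = eF (fX W N (ty W N).1 (ty W N).2) := by simp only [res, hdF]
  have ez : zb (eF N) = (decide (N.C2.c ≠ 0)).toNat + 2 * (decide (N.C3.c ≠ 0)).toNat := by
    simp only [zb, hdF]
  simp only [eκ, er, ez]
  by_cases hb : W.boom = true ∨ N.boom = true
  · rw [if_pos hb, if_pos rfl, fnu_fire.2 hb]; rfl
  simp only [if_neg hb]
  by_cases hf : ∃ t : Ty × Ty, fC W N t.1 t.2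
  swap
  · simp only [if_neg hf]
    have : fnu (LS H0 V0 Val0 ini n) (W, l, l') (N, m', m) = .die := by
      cases h : fnu (LS H0 V0 Val0 ini n) (W, l, l') (N, m', m) with
      | die => rfl
      | fire => exact absurd (fnu_fire.1 h) hb
      | alive X =>
        obtain ⟨-, -, t2, t3, h1, -⟩ := fnu_alive.1 h
        exact absurd ⟨(t2, t3), h1⟩ hf
    rw [this]; rfl
  simp only [if_pos hf, k0, k1, if_false, k3, k4, k5]
  have hty' := hty W N hf
  set t := ty W N with htdef
  have hd : (if ((m.2 : Fin (n+2)) : ℕ) = 0 then 1 else 0) = (decide (((m.2 : Fin (n+2)) : ℕ) = 0)).toNat := by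
    split_ifs with h <;> simp [h]
  rw [hd, bit_eq _ _ _ (sc_lt _ _)]
  obtain ⟨e1, e2, e3, e4⟩ := bit_dec (decide (N.C2.c ≠ 0)) (decide (N.C3.c ≠ 0)) (sc n m.2) (sc_lt _ _)
    (decide (((m.2 : Fin (n+2)) : ℕ) = 0))
  have hcond : ∀ (p : Prop) [Decidable p], ((if p then 1 else 0) = 1) ↔ p := by
    intro p _; split_ifs with h <;> simp [h]
  have hiT : ∀ y, iT (eY y) = 1 ↔ ini y = true := by
    intro y
    simp only [iT, hdY]
    cases ini y <;> simp
  have hlab : labOK (LS H0 V0 Val0 ini n) N t.1 t.2 l m ↔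
      (valT ((decide (N.C2.c ≠ 0)).toNat + 2 * (decide (N.C3.c ≠ 0)).toNat + 4 * (sc n m.2 + 4 * (decide (((m.2 : Fin (n+2)) : ℕ) = 0)).toNat)) (eY m.1) = 1 ∧
      (t.1 = .zero ∧ t.2 = .zero → lab eY n l = lab eY n m) ∧
      (t.1 = .neg1 ∧ t.2 = .zero → hT (eY m.1) (eY l.1) = 1 ∧
        (iT (eY m.1) = 1 → (l.2 : ℕ) = min ((m.2:ℕ) + 1) (n+1))) ∧
      (t.1 = .zero ∧ t.2 = .neg1 → vT (eY m.1) (eY l.1) = 1)) := by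
    simp only [valT, hT, vT, e1, e2, e3, e4, hdY, hiT, labOK, LS, and_imp]
    have : ∀ l m, lab eY n l = lab eY n m ↔ l = m := fun l m => ⟨lab_inj eY n, fun h => h ▸ rfl⟩
    simp only [this, hcond]
  by_cases hl : labOK (LS H0 V0 Val0 ini n) N t.1 t.2 l m
  · rw [if_pos (hlab.1 hl)]
    have : fnu (LS H0 V0 Val0 ini n) (W, l, l') (N, m', m) = .alive (fX W N t.1 t.2, l, m) := by
      rw [fnu_alive]
      simp only [not_or, Bool.not_eq_true] at hb
      exact ⟨hb.1, hb.2, t.1, t.2, hty', hl, rfl⟩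
    rw [this]
    rfl
  · rw [if_neg (fun h => hl (hlab.2 h))]
    have : fnu (LS H0 V0 Val0 ini n) (W, l, l') (N, m', m) = .die := by
      cases h : fnu (LS H0 V0 Val0 ini n) (W, l, l') (N, m', m) with
      | die => rfl
      | fire => exact absurd (fnu_fire.1 h) hb
      | alive X =>
        obtain ⟨-, -, t2, t3, h1, h2, -⟩ := fnu_alive.1 h
        obtain ⟨rfl, rfl⟩ := fC_unique hty' h1
        exact absurd h2 hl
    rw [this]; rfl
end
end TS


/-! ## The local rule, arithmetically -/

/-- configuration from a window number -/
def xof (R K : ℕ) : ℤ → Bool := fun i => decide (0 ≤ i + R) && K.testBit (i + R).toNat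

theorem xof_sub (R K j : ℕ) : xof R K (j - R) = K.testBit j := by simp [xof]

theorem num_xof (R K j len : ℕ) : num (xof R K) (j - R) len = K / 2^j % 2^len := by
  apply Nat.eq_of_testBit_eq
  intro o
  rw [num_testBit, Nat.testBit_mod_two_pow, Nat.testBit_div_two_pow]
  congr 1
  have : (j:ℤ) - R + o = ((o + j : ℕ) : ℤ) - R := by push_cast; ring
  rw [this, xof_sub]

namespace RP
variable (P : RP)

def CodedN (K j : ℕ) : Prop := K / 2^j % 2^P.pos = P.HP ∧ K / 2^(j + P.pos) % 2^P.w < P.S ∧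
  ∀ b < P.t, K / 2^(j + (P.t + (P.Q-1) * b)) % 2^(P.Q-1) < P.UF.length

open Classical in
noncomputable def actN (K j : ℕ) : ℕ :=
  if P.CodedN K (j - P.ell) ∧ P.CodedN K j ∧ P.CodedN K (j + P.ell) then
    P.nuN (K / 2^(j - P.ell + P.pos) % 2^P.w) (K / 2^(j + P.pos) % 2^P.w) else 0

def outN (K j o : ℕ) : Prop :=
  (P.actN K j = 1 ∧ (P.UF.getD (K / 2^(j + (P.t + (P.Q-1) * (o / P.Q))) % 2^(P.Q-1)) 0).testBit (o % P.Q) = true) ∨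
  (P.actN K j ≠ 1 ∧ (P.pos ≤ o ∧ o < P.t) ∧ (P.actN K j - 2).testBit (o - P.pos) = true) ∨
  (P.actN K j ≠ 1 ∧ ¬ (P.pos ≤ o ∧ o < P.t) ∧ K.testBit (j + o) = true)

def hatN (e : Bool) (K j : ℕ) : Prop :=
  ((∃ o < P.ell, P.CodedN K (j - o)) ∧ e = true) ∨ (¬ (∃ o < P.ell, P.CodedN K (j - o)) ∧ K.testBit j = true)

def ruleN (gF : ℕ → Bool) (r : ℕ) (e : Bool) (K : ℕ) : Prop :=
  (∃ o < P.ell, P.actN K (4 * P.ell - o) ≠ 0 ∧ P.outN K (4 * P.ell - o) o) ∨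
  (¬ (∃ o < P.ell, P.actN K (4 * P.ell - o) ≠ 0) ∧
    ∃ k < 2^(2*r+1), gF k = true ∧ ∀ j < 2*r+1, (P.hatN e K (4 * P.ell - r + j) ↔ k.testBit j = true))

variable {P}

theorem coded_xof (R K j : ℕ) : P.Coded (xof R K) (j - R) ↔ P.CodedN K j := by
  unfold Coded CodedN
  have e1 : (j:ℤ) - R + P.pos = ((j + P.pos : ℕ):ℤ) - R := by push_cast; ring
  have e2 : ∀ m : ℕ, (j:ℤ) - R + m = ((j + m : ℕ):ℤ) - R := fun m => by push_cast; ring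
  simp only [e1, e2, num_xof]

theorem act_xof (R K j : ℕ) (hj : P.ell ≤ j) : P.act (xof R K) (j - R) = P.actN K j := by
  classical
  unfold act actN st
  have e0 : (j:ℤ) - R - P.ell = ((j - P.ell : ℕ):ℤ) - R := by rw [Nat.cast_sub hj]; ring
  have e2 : ∀ j m : ℕ, (j:ℤ) - R + m = ((j + m : ℕ):ℤ) - R := fun j m => by push_cast; ring
  apply if_congr
  · rw [e0, e2, coded_xof, coded_xof, coded_xof]
  · simp only [e0, e2, num_xof]
  · rfl

theorem out_xof (R K j o : ℕ) (hj : P.ell ≤ j) : P.out (xof R K) (j - R) o = true ↔ P.outN K j o := by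
  unfold out outN pay
  have e2 : ∀ j m : ℕ, (j:ℤ) - R + m = ((j + m : ℕ):ℤ) - R := fun j m => by push_cast; ring
  simp only [e2, num_xof, act_xof R K j hj, xof_sub]
  by_cases h1 : P.actN K j = 1
  · simp [h1]
  · by_cases h2 : P.pos ≤ o ∧ o < P.t
    · rw [if_neg h1, if_pos h2]; simp [h1, h2]
    · rw [if_neg h1, if_neg h2]
      constructor
      · intro h; exact Or.inr (Or.inr ⟨h1, h2, h⟩)
      · rintro (⟨h, -⟩ | ⟨-, h, -⟩ | ⟨-, -, h⟩)
        · exact absurd h h1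
        · exact absurd h h2
        · exact h

theorem hat_xof (R K j : ℕ) (e : Bool) (hj : P.ell ≤ j) : P.hat e (xof R K) (j - R) = true ↔ P.hatN e K j := by
  unfold hat hatN
  have : (∃ o : ℕ, o < P.ell ∧ P.Coded (xof R K) ((j:ℤ) - R - o)) ↔ ∃ o < P.ell, P.CodedN K (j - o) := by
    apply exists_congr
    intro o
    apply and_congr_right
    intro ho
    rw [show (j:ℤ) - R - o = ((j - o : ℕ):ℤ) - R by rw [Nat.cast_sub (by omega)]; ring, coded_xof]
  rw [xof_sub, ← this]
  split_ifs with h <;> simp [h]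

theorem rule_iff {F : (ℤ → Bool) → (ℤ → Bool)} {e : Bool} {gF : ℕ → Bool} {r : ℕ} (hr : r < P.ell)
    (hF : ∀ y, F y 0 = gF (num y (-r) (2*r+1))) (K : ℕ) :
    P.H F e (xof (4 * P.ell) K) 0 = true ↔ P.ruleN gF r e K := by
  unfold H ruleN
  have e0 : ∀ o < P.ell, (0:ℤ) - o = ((4 * P.ell - o : ℕ) : ℤ) - (4 * P.ell : ℕ) := by
    intro o ho; rw [Nat.cast_sub (by omega)]; ring
  have ea : ∀ o < P.ell, P.act (xof (4 * P.ell) K) (0 - o) = P.actN K (4 * P.ell - o) := by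
    intro o ho; rw [e0 o ho, act_xof _ _ _ (by omega)]
  have eb : ∀ o < P.ell, (P.out (xof (4 * P.ell) K) (0 - o) o = true ↔ P.outN K (4 * P.ell - o) o) := by
    intro o ho; rw [e0 o ho, out_xof _ _ _ _ (by omega)]
  have h1 : (∃ o : ℕ, o < P.ell ∧ P.act (xof (4 * P.ell) K) (0 - o) ≠ 0) ↔
      ∃ o < P.ell, P.actN K (4 * P.ell - o) ≠ 0 := by
    apply exists_congr; intro o; apply and_congr_right; intro ho; rw [ea o ho]
  have h2 : (∃ o : ℕ, o < P.ell ∧ P.act (xof (4 * P.ell) K) (0 - o) ≠ 0 ∧ P.out (xof (4 * P.ell) K) (0 - o) o = true) ↔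
      ∃ o < P.ell, P.actN K (4 * P.ell - o) ≠ 0 ∧ P.outN K (4 * P.ell - o) o := by
    apply exists_congr; intro o; apply and_congr_right; intro ho; rw [ea o ho, eb o ho]
  have h3 : F (P.hat e (xof (4 * P.ell) K)) 0 = true ↔ ∃ k < 2^(2*r+1), gF k = true ∧
      ∀ j < 2*r+1, (P.hatN e K (4 * P.ell - r + j) ↔ k.testBit j = true) := by
    have e5 : ∀ j < 2*r+1, (P.hatN e K (4 * P.ell - r + j) ↔ P.hat e (xof (4 * P.ell) K) (-r + j) = true) := by
      intro j hj
      rw [← hat_xof (4 * P.ell) K _ e (by omega), show ((4 * P.ell - r + j : ℕ):ℤ) - (4 * P.ell : ℕ) = -r + j by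
        rw [Nat.cast_add, Nat.cast_sub (by omega)]; ring]
    rw [hF]
    constructor
    · intro h
      refine ⟨_, num_lt _ _ _, h, fun j hj => ?_⟩
      rw [e5 j hj, num_testBit]; simp [hj]
    · rintro ⟨k, hk, hg, hh⟩
      have : num (P.hat e (xof (4 * P.ell) K)) (-r) (2*r+1) = k := by
        rw [num_eq_iff hk]
        intro o ho
        rw [Bool.eq_iff_iff, ← e5 o ho, hh o ho]
      rw [this, hg]
  split_ifs with h
  · rw [decide_eq_true_iff, h2]
    rw [h1] at h
    simp [h]
  · rw [h3]
    rw [h1] at h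
    constructor
    · intro h'; exact Or.inr ⟨h, h'⟩
    · rintro (⟨o, ho, h', -⟩ | ⟨-, h'⟩)
      · exact absurd ⟨o, ho, h'⟩ h
      · exact h'

theorem num_shift (x : ℤ → Bool) (i j : ℤ) (len : ℕ) : num (fun k => x (k + i)) j len = num x (j + i) len := by
  apply num_congr
  intro o _
  congr 1; ring

theorem coded_shift (x : ℤ → Bool) (i j : ℤ) : P.Coded (fun k => x (k + i)) j ↔ P.Coded x (j + i) := by
  unfold Coded
  simp only [num_shift, add_right_comm]

theorem act_shift (x : ℤ → Bool) (i j : ℤ) : P.act (fun k => x (k + i)) j = P.act x (j + i) := by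
  classical
  unfold act st
  apply if_congr
  · simp only [coded_shift, add_right_comm, add_sub_right_comm]
  · simp only [num_shift, add_right_comm, add_sub_right_comm]
  · rfl

theorem out_shift (x : ℤ → Bool) (i j : ℤ) (o : ℕ) : P.out (fun k => x (k + i)) j o = P.out x (j + i) o := by
  unfold out pay
  simp only [num_shift, act_shift, add_right_comm]

theorem hat_shift (x : ℤ → Bool) (e : Bool) (i : ℤ) :
    P.hat e (fun k => x (k + i)) = fun k => P.hat e x (k + i) := by
  funext j
  classical
  unfold hat
  apply if_congr
  · simp only [coded_shift, add_sub_right_comm]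
  · rfl
  · rfl

theorem H_shift {F : (ℤ → Bool) → (ℤ → Bool)} {e : Bool}
    (hF : ∀ y i, F (fun k => y (k + i)) 0 = F y i) (x : ℤ → Bool) (i : ℤ) :
    P.H F e (fun k => x (k + i)) 0 = P.H F e x i := by
  unfold H
  simp only [act_shift, out_shift, hat_shift, hF, zero_sub, neg_add_eq_sub]
end RP


/-! ## Primitive recursiveness of the local rule -/

section toolbox
variable {α : Type} [Primcodable α] {f g h : α → ℕ} {p q : α → Prop}

theorem pr_add (hf : Primrec f) (hg : Primrec g) : Primrec fun a => f a + g a := Primrec.nat_add.comp hf hg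
theorem pr_sub (hf : Primrec f) (hg : Primrec g) : Primrec fun a => f a - g a := Primrec.nat_sub.comp hf hg
theorem pr_mul (hf : Primrec f) (hg : Primrec g) : Primrec fun a => f a * g a := Primrec.nat_mul.comp hf hg
theorem pr_div (hf : Primrec f) (hg : Primrec g) : Primrec fun a => f a / g a := Primrec.nat_div.comp hf hg
theorem pr_mod (hf : Primrec f) (hg : Primrec g) : Primrec fun a => f a % g a := Primrec.nat_mod.comp hf hg
theorem pr_min (hf : Primrec f) (hg : Primrec g) : Primrec fun a => min (f a) (g a) := Primrec.nat_min.comp hf hg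
theorem pr_pow (hf : Primrec f) (hg : Primrec g) : Primrec fun a => f a ^ g a :=
  (Primrec₂.unpaired'.1 Nat.Primrec.pow).comp hf hg
theorem pr_lt (hf : Primrec f) (hg : Primrec g) : PrimrecPred fun a => f a < g a := Primrec.nat_lt.comp hf hg
theorem pr_le (hf : Primrec f) (hg : Primrec g) : PrimrecPred fun a => f a ≤ g a := Primrec.nat_le.comp hf hg
theorem pr_eq (hf : Primrec f) (hg : Primrec g) : PrimrecPred fun a => f a = g a := Primrec.eq.comp hf hg
theorem pr_and (hp : PrimrecPred p) (hq : PrimrecPred q) : PrimrecPred fun a => p a ∧ q a := hp.and hq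
theorem pr_or (hp : PrimrecPred p) (hq : PrimrecPred q) : PrimrecPred fun a => p a ∨ q a := hp.or hq
theorem pr_not (hp : PrimrecPred p) : PrimrecPred fun a => ¬ p a := hp.not
theorem pr_imp (hp : PrimrecPred p) (hq : PrimrecPred q) : PrimrecPred fun a => p a → q a :=
  (hp.not.or hq).of_eq fun a => by by_cases h : p a <;> simp [h]
theorem pr_iff (hp : PrimrecPred p) (hq : PrimrecPred q) : PrimrecPred fun a => (p a ↔ q a) :=
  ((pr_imp hp hq).and (pr_imp hq hp)).of_eq fun a => iff_def.symm
theorem pr_ne (hf : Primrec f) (hg : Primrec g) : PrimrecPred fun a => f a ≠ g a := (pr_eq hf hg).not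
theorem pr_ite [DecidablePred p] (hp : PrimrecPred p) (hf : Primrec f) (hg : Primrec g) :
    Primrec fun a => if p a then f a else g a := Primrec.ite hp hf hg
theorem pr_prop (c : Prop) : PrimrecPred fun _ : α => c := by
  by_cases h : c
  · exact (pr_eq (Primrec.const 0) (Primrec.const 0)).of_eq fun _ => by simp [h]
  · exact (pr_eq (Primrec.const 0) (Primrec.const 1)).of_eq fun _ => by simp [h]
theorem pr_tb (hf : Primrec f) (hg : Primrec g) : PrimrecPred fun a => (f a).testBit (g a) = true :=
  (pr_eq (pr_mod (pr_div hf (pr_pow (Primrec.const 2) hg)) (Primrec.const 2)) (Primrec.const 1)).of_eq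
    fun a => by simp [Nat.testBit_eq_decide_div_mod_eq]
theorem pr_getD (l : List ℕ) (hf : Primrec f) : Primrec fun a => l.getD (f a) 0 :=
  (Primrec.list_getD 0).comp (Primrec.const l) hf
theorem pr_tab (T : ℕ → ℕ) {c : ℕ} (hc : 0 < c) (hf : Primrec f) : Primrec fun a => T (f a % c) :=
  (pr_getD ((List.range c).map T) (pr_mod hf (Primrec.const c))).of_eq fun a => by
    have := Nat.mod_lt (f a) hc
    simp [List.getD, this]
theorem pr_tab2 (T : ℕ → ℕ → ℕ) {c d : ℕ} (hc : 0 < c) (hd : 0 < d) (hf : Primrec f) (hg : Primrec g) :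
    Primrec fun a => T (f a % c) (g a % d) :=
  (pr_tab (fun x => T (x % c) (x / c)) (c := c * d) (Nat.mul_pos hc hd)
    (pr_add (pr_mod hf (Primrec.const c)) (pr_mul (Primrec.const c) (pr_mod hg (Primrec.const d))))).of_eq fun a => by
    have h1 := Nat.mod_lt (f a) hc
    have h2 := Nat.mod_lt (g a) hd
    have h3 : f a % c + c * (g a % d) < c * d := by
      calc _ < c + c * (g a % d) := by omega
        _ = c * (g a % d + 1) := by ring
        _ ≤ _ := Nat.mul_le_mul_left _ h2
    rw [Nat.mod_eq_of_lt h3, Nat.add_mul_mod_self_left, Nat.mod_mod, Nat.add_mul_div_left _ _ hc,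
      Nat.div_eq_of_lt h1, zero_add]
theorem pr_ex {b : α → ℕ} {r : α → ℕ → Prop} (hb : Primrec b) (hr : PrimrecPred fun x : α × ℕ => r x.1 x.2) :
    PrimrecPred fun a => ∃ o < b a, r a o := by
  have h1 : PrimrecRel fun (o : ℕ) (a : α) => r a o := hr.comp (Primrec.pair Primrec.snd Primrec.fst)
  exact ((PrimrecRel.exists_mem_list h1).comp (Primrec.list_range.comp hb) Primrec.id).of_eq fun a => by simp
theorem pr_all {b : α → ℕ} {r : α → ℕ → Prop} (hb : Primrec b) (hr : PrimrecPred fun x : α × ℕ => r x.1 x.2) :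
    PrimrecPred fun a => ∀ o < b a, r a o := by
  have h1 : PrimrecRel fun (o : ℕ) (a : α) => r a o := hr.comp (Primrec.pair Primrec.snd Primrec.fst)
  exact ((PrimrecRel.forall_mem_list h1).comp (Primrec.list_range.comp hb) Primrec.id).of_eq fun a => by simp
end toolbox

namespace TS
variable {α : Type} [Primcodable α]

theorem pr_sc {n j : α → ℕ} (hn : Primrec n) (hj : Primrec j) : Primrec fun a => sc (n a) (j a) := by
  unfold sc
  repeat' first
    | assumption
    | exact Primrec.const _
    | with_reducible apply pr_ite
    | with_reducible apply pr_and
    | with_reducible apply pr_lt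
    | with_reducible apply pr_eq
    | with_reducible apply pr_add
    | with_reducible apply pr_sub
    | with_reducible apply pr_mod
    | with_reducible apply pr_div
    | with_reducible apply pr_pow

theorem pr_nuT (κ res : ℕ → ℕ → ℕ) (zb : ℕ → ℕ) (valT hT vT : ℕ → ℕ → ℕ) (iT : ℕ → ℕ) {s0 y0 : ℕ}
    (hs : 0 < s0) (hy : 0 < y0) {n s s' : α → ℕ} (hn : Primrec n) (h1 : Primrec s) (h2 : Primrec s') :
    Primrec fun a => nuT κ res zb valT hT vT iT s0 y0 (n a) (s a) (s' a) := by
  unfold nuT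
  have hk : Primrec fun a => κ (s a % s0) (s' a % s0) := pr_tab2 κ hs hs h1 h2
  have hr : Primrec fun a => res (s a % s0) (s' a % s0) := pr_tab2 res hs hs h1 h2
  have hX : Primrec fun a => y0 * (n a + 2) := pr_mul (.const _) (pr_add hn (.const _))
  have hm : Primrec fun a => s' a / s0 / (y0 * (n a + 2)) := pr_div (pr_div h2 (.const _)) hX
  have hl : Primrec fun a => s a / s0 % (y0 * (n a + 2)) := pr_mod (pr_div h1 (.const _)) hX
  have hmy : Primrec fun a => s' a / s0 / (y0 * (n a + 2)) / y0 := pr_div hm (.const _)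
  have hly : Primrec fun a => s a / s0 % (y0 * (n a + 2)) / y0 := pr_div hl (.const _)
  have hsc := pr_sc hn hmy
  have hz : Primrec fun a => zb (s' a % s0) := pr_tab zb hs h2
  have hi : Primrec fun a => iT (s' a / s0 / (y0 * (n a + 2)) % y0) := pr_tab iT hy hm
  have hh : Primrec fun a => hT (s' a / s0 / (y0 * (n a + 2)) % y0) (s a / s0 % (y0 * (n a + 2)) % y0) :=
    pr_tab2 hT hy hy hm hl
  have hv : Primrec fun a => vT (s' a / s0 / (y0 * (n a + 2)) % y0) (s a / s0 % (y0 * (n a + 2)) % y0) :=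
    pr_tab2 vT hy hy hm hl
  have hval : Primrec fun a => valT ((zb (s' a % s0) % 4 + 4 * (sc (n a) (s' a / s0 / (y0 * (n a + 2)) / y0) +
      4 * (if s' a / s0 / (y0 * (n a + 2)) / y0 = 0 then 1 else 0))) % 32) (s' a / s0 / (y0 * (n a + 2)) % y0) := by
    refine pr_tab2 valT (by norm_num) hy ?_ hm
    exact pr_add (pr_mod hz (.const _)) (pr_mul (.const _) (pr_add hsc (pr_mul (.const _)
      (pr_ite (pr_eq hmy (.const _)) (.const _) (.const _)))))
  repeat' first
    | assumption
    | exact Primrec.const _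
    | with_reducible apply pr_ite
    | with_reducible apply pr_and
    | with_reducible apply pr_imp
    | with_reducible apply pr_lt
    | with_reducible apply pr_eq
    | with_reducible apply pr_min
    | with_reducible apply pr_add
    | with_reducible apply pr_mul
    | with_reducible apply pr_sub
    | with_reducible apply pr_mod
    | with_reducible apply pr_div
    | with_reducible apply pr_pow
end TS


namespace RP

/-- the family of coding parameters -/
def PN (L un Q : ℕ) (UF : List ℕ) (C : ℕ) (S : ℕ → ℕ) (nu : ℕ → ℕ → ℕ → ℕ) (n : ℕ) : RP :=
  { L := L, un := un, Q := Q, UF := UF, w := S n, a := S n + C, S := S n, nuN := nu n }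

section
variable {α : Type} [Primcodable α] {L un Q : ℕ} {UF : List ℕ} {C : ℕ} {S : ℕ → ℕ} {nu : ℕ → ℕ → ℕ → ℕ}

theorem pr_pos (hS : Primrec S) {n : α → ℕ} (hn : Primrec n) :
    Primrec fun a => (PN L un Q UF C S nu (n a)).pos :=
  pr_add (pr_add (pr_add (hS.comp hn) (.const C)) (.const 1)) (.const (3*Q*L))

theorem pr_t (hS : Primrec S) {n : α → ℕ} (hn : Primrec n) :
    Primrec fun a => (PN L un Q UF C S nu (n a)).t :=
  pr_add (pr_pos hS hn) (hS.comp hn)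

theorem pr_ell (hS : Primrec S) {n : α → ℕ} (hn : Primrec n) :
    Primrec fun a => (PN L un Q UF C S nu (n a)).ell :=
  pr_mul (.const Q) (pr_t hS hn)

theorem pr_HP (hS : Primrec S) {n : α → ℕ} (hn : Primrec n) :
    Primrec fun a => (PN L un Q UF C S nu (n a)).HP := by
  have h : Primrec fun a => S (n a) + C := pr_add (hS.comp hn) (.const C)
  exact pr_add (pr_sub (pr_pow (.const 2) h) (.const 1)) (pr_mul (pr_pow (.const 2) (pr_add h (.const 1)))
    (.const (rep L un (3*Q))))

theorem pr_nm {K j l : α → ℕ} (hK : Primrec K) (hj : Primrec j) (hl : Primrec l) :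
    Primrec fun a => K a / 2 ^ j a % 2 ^ l a :=
  pr_mod (pr_div hK (pr_pow (.const 2) hj)) (pr_pow (.const 2) hl)

theorem pr_coded (hS : Primrec S) {n K j : α → ℕ} (hn : Primrec n) (hK : Primrec K) (hj : Primrec j) :
    PrimrecPred fun a => (PN L un Q UF C S nu (n a)).CodedN (K a) (j a) := by
  unfold CodedN
  have hSn : Primrec fun a => S (n a) := hS.comp hn
  refine pr_and (pr_eq (pr_nm hK hj (pr_pos hS hn)) (pr_HP hS hn)) (pr_and (pr_lt
    (pr_nm hK (pr_add hj (pr_pos hS hn)) hSn) hSn) (pr_all (pr_t hS hn) ?_))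
  have h1 := hn.comp (Primrec.fst (α := α) (β := ℕ))
  exact pr_lt (pr_nm (hK.comp .fst) (pr_add (hj.comp .fst) (pr_add (pr_t hS h1) (pr_mul (.const (Q-1)) .snd)))
    (.const (Q-1))) (.const UF.length)

theorem pr_act (hS : Primrec S) (hnu : Primrec fun x : ℕ × ℕ × ℕ => nu x.1 x.2.1 x.2.2)
    {n K j : α → ℕ} (hn : Primrec n) (hK : Primrec K) (hj : Primrec j) :
    Primrec fun a => (PN L un Q UF C S nu (n a)).actN (K a) (j a) := by
  classical
  unfold actN
  have hSn : Primrec fun a => S (n a) := hS.comp hn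
  have he := pr_ell (L := L) (un := un) (Q := Q) (UF := UF) (C := C) (nu := nu) hS hn
  have hp := pr_pos (L := L) (un := un) (Q := Q) (UF := UF) (C := C) (nu := nu) hS hn
  refine pr_ite (pr_and (pr_coded hS hn hK (pr_sub hj he)) (pr_and (pr_coded hS hn hK hj)
    (pr_coded hS hn hK (pr_add hj he)))) ?_ (.const 0)
  exact hnu.comp (Primrec.pair hn (Primrec.pair (pr_nm hK (pr_add (pr_sub hj he) hp) hSn)
    (pr_nm hK (pr_add hj hp) hSn)))

theorem pr_out (hS : Primrec S) (hnu : Primrec fun x : ℕ × ℕ × ℕ => nu x.1 x.2.1 x.2.2)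
    {n K j o : α → ℕ} (hn : Primrec n) (hK : Primrec K) (hj : Primrec j) (ho : Primrec o) :
    PrimrecPred fun a => (PN L un Q UF C S nu (n a)).outN (K a) (j a) (o a) := by
  unfold outN
  have hA := pr_act (L := L) (un := un) (Q := Q) (UF := UF) (C := C) hS hnu hn hK hj
  have ht := pr_t (L := L) (un := un) (Q := Q) (UF := UF) (C := C) (nu := nu) hS hn
  have hp := pr_pos (L := L) (un := un) (Q := Q) (UF := UF) (C := C) (nu := nu) hS hn
  refine pr_or (pr_and (pr_eq hA (.const 1)) (pr_tb (pr_getD UF ?_) (pr_mod ho (.const Q))))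
    (pr_or (pr_and (pr_ne hA (.const 1)) (pr_and (pr_and (pr_le hp ho) (pr_lt ho ht))
      (pr_tb (pr_sub hA (.const 2)) (pr_sub ho hp)))) (pr_and (pr_ne hA (.const 1))
      (pr_and (pr_not (pr_and (pr_le hp ho) (pr_lt ho ht))) (pr_tb hK (pr_add hj ho)))))
  exact pr_nm hK (pr_add hj (pr_add ht (pr_mul (.const (Q-1)) (pr_div ho (.const Q))))) (.const (Q-1))

theorem pr_hat (hS : Primrec S) (e : Bool)
    {n K j : α → ℕ} (hn : Primrec n) (hK : Primrec K) (hj : Primrec j) :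
    PrimrecPred fun a => (PN L un Q UF C S nu (n a)).hatN e (K a) (j a) := by
  unfold hatN
  have he : PrimrecPred fun a => ∃ o < (PN L un Q UF C S nu (n a)).ell,
      (PN L un Q UF C S nu (n a)).CodedN (K a) (j a - o) :=
    pr_ex (pr_ell hS hn) (pr_coded hS (hn.comp .fst) (hK.comp .fst) (pr_sub (hj.comp .fst) .snd))
  exact pr_or (pr_and he (pr_prop _)) (pr_and (pr_not he) (pr_tb hK hj))

theorem pr_rule (hS : Primrec S) (hnu : Primrec fun x : ℕ × ℕ × ℕ => nu x.1 x.2.1 x.2.2) (gF : ℕ → Bool) (r : ℕ)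
    (hg : ∀ k, gF k = gF (k % 2^(2*r+1))) (e : Bool) {n K : α → ℕ} (hn : Primrec n) (hK : Primrec K) :
    PrimrecPred fun a => (PN L un Q UF C S nu (n a)).ruleN gF r e (K a) := by
  unfold ruleN
  have h1 := hn.comp (Primrec.fst (α := α) (β := ℕ))
  have hK1 := hK.comp (Primrec.fst (α := α) (β := ℕ))
  have he := pr_ell (L := L) (un := un) (Q := Q) (UF := UF) (C := C) (nu := nu) hS hn
  have he1 := pr_ell (L := L) (un := un) (Q := Q) (UF := UF) (C := C) (nu := nu) hS h1
  have hA : PrimrecPred fun x : α × ℕ => (PN L un Q UF C S nu (n x.1)).actN (K x.1)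
      (4 * (PN L un Q UF C S nu (n x.1)).ell - x.2) ≠ 0 :=
    pr_ne (pr_act hS hnu h1 hK1 (pr_sub (pr_mul (.const 4) he1) .snd)) (.const 0)
  refine pr_or (pr_ex he (pr_and hA (pr_out hS hnu h1 hK1 (pr_sub (pr_mul (.const 4) he1) .snd) .snd)))
    (pr_and (pr_not (pr_ex he hA)) (pr_ex (.const _) (pr_and ?_ (pr_all (.const _) (pr_iff ?_ ?_)))))
  · refine (pr_eq (pr_tab (fun k => if gF k = true then 1 else 0)
      (c := 2^(2*r+1)) (by positivity) Primrec.snd) (.const 1)).of_eq fun x => ?_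
    rw [hg x.2]
    simp
  · have h2 := h1.comp (Primrec.fst (α := α × ℕ) (β := ℕ))
    have he2 := pr_ell (L := L) (un := un) (Q := Q) (UF := UF) (C := C) (nu := nu) hS h2
    exact pr_hat hS e h2 (hK1.comp .fst) (pr_add (pr_sub (pr_mul (.const 4) he2) (.const r)) .snd)
  · exact pr_tb (Primrec.snd.comp .fst) .snd
end
end RP


/-- the number of a window -/
def wEquiv (n : ℕ) : (Fin n → Bool) ≃ Fin (2^n) :=
  (Equiv.arrowCongr (Equiv.refl (Fin n)) finTwoEquiv.symm).trans finFunctionFinEquiv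

theorem wEquiv_testBit (n : ℕ) (w : Fin n → Bool) (j : Fin n) : (wEquiv n w : ℕ).testBit j = w j := by
  obtain ⟨k, rfl⟩ := (wEquiv n).symm.surjective w
  rw [Equiv.apply_symm_apply]
  have : finTwoEquiv (finFunctionFinEquiv.symm k j) = (k:ℕ).testBit j := by
    have h := finFunctionFinEquiv_symm_apply_val k j
    rw [Nat.testBit_eq_decide_div_mod_eq, ← h]
    generalize finFunctionFinEquiv.symm k j = b
    fin_cases b <;> rfl
  exact this.symm

/-- the code of a window, recursively -/
def wcode (x : ℤ → Bool) : ℕ → ℕ → ℕ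
  | _, 0 => 0
  | s, n+1 => (Nat.pair (Nat.pair s (x s).toNat) (wcode x (s+1) n)).succ

theorem pair_lt_succ (s : ℕ) (b b' : Bool) : Nat.pair s b.toNat < Nat.pair (s+1) b'.toNat := by
  have := b.toNat_le
  have := b'.toNat_le
  rcases Nat.eq_zero_or_pos s with rfl | hs
  · cases b <;> cases b' <;> decide
  · unfold Nat.pair
    rw [if_neg (by omega), if_neg (by omega)]
    nlinarith

theorem pair_lt_wcode (x x' : ℤ → Bool) (s n : ℕ) : Nat.pair s (x s).toNat < wcode x' (s+1) (n+1) := by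
  rw [wcode]
  exact (pair_lt_succ _ _ _).trans_le ((Nat.left_le_pair _ _).trans (Nat.le_succ _))

theorem wcode_congr (x x' : ℤ → Bool) : ∀ n s : ℕ, num x s n = num x' s n → wcode x s n = wcode x' s n := by
  intro n
  induction n with
  | zero => intro s _; rfl
  | succ n ih =>
    intro s h
    rw [num, num] at h
    have h1 := (x s).toNat_le
    have h2 := (x' s).toNat_le
    have e1 : num x ((s+1 : ℕ):ℤ) n = num x' ((s+1 : ℕ):ℤ) n := by push_cast; omega
    have e2 : (x s).toNat = (x' s).toNat := by omega
    rw [wcode, wcode, e2, ih _ e1]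

theorem wcode_lt (x x' : ℤ → Bool) : ∀ n s : ℕ, num x s n < num x' s n → wcode x s n < wcode x' s n := by
  intro n
  induction n with
  | zero => intro s h; simp [num] at h
  | succ n ih =>
    intro s h
    rw [num, num] at h
    have h1 := (x s).toNat_le
    have h2 := (x' s).toNat_le
    rw [wcode, wcode]
    apply Nat.succ_lt_succ
    rcases lt_or_ge (num x ((s+1 : ℕ):ℤ) n) (num x' ((s+1 : ℕ):ℤ) n) with h3 | h3
    · have h4 := ih _ h3
      rcases n with _ | n
      · simp [num] at h3
      · have h5 := pair_lt_wcode x x s n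
        have h6 := pair_lt_wcode x' x' s n
        generalize wcode x (s+1) (n+1) = t at *
        generalize wcode x' (s+1) (n+1) = t' at *
        generalize Nat.pair s (x s).toNat = u at *
        generalize Nat.pair s (x' s).toNat = u' at *
        unfold Nat.pair
        rw [if_pos h5, if_pos h6]
        nlinarith
    · have e1 : num x ((s+1 : ℕ):ℤ) n = num x' ((s+1 : ℕ):ℤ) n := by push_cast at h3 ⊢; omega
      rw [wcode_congr x x' n _ e1]
      apply Nat.pair_lt_pair_left
      apply Nat.pair_lt_pair_right
      push_cast at e1
      omega

theorem encode_list_map {α : Type*} [Encodable α] (l : List α) :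
    Encodable.encode l = Encodable.encode (l.map Encodable.encode) := by
  induction l with
  | nil => rfl
  | cons a l ih => rw [List.map_cons, Encodable.encode_list_cons, Encodable.encode_list_cons, ih]; rfl

theorem encode_ofFn (x : ℤ → Bool) : ∀ n s : ℕ,
    Encodable.encode (List.ofFn fun i : Fin n => Nat.pair (s + i) (x (s + i : ℕ)).toNat) = wcode x s n := by
  intro n
  induction n with
  | zero => intro s; rfl
  | succ n ih =>
    intro s
    rw [List.ofFn_succ, Encodable.encode_list_cons, wcode, ← ih]
    congr 1
    congr 1
    · congr 2
      funext i
      simp only [Fin.val_succ, add_assoc, add_comm 1]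

theorem encode_window (n : ℕ) (w : Fin n → Bool) :
    Encodable.encode w = wcode (xof 0 (wEquiv n w)) 0 n := by
  rw [← encode_ofFn]
  have h1 : Encodable.encode w = Encodable.encode (List.Vector.ofFn fun i : Fin n => (⟨i, w i⟩ : Σ _ : Fin n, Bool)) := rfl
  rw [h1, show ∀ v : List.Vector (Σ _ : Fin n, Bool) n, Encodable.encode v = Encodable.encode v.toList from fun v => rfl,
    List.Vector.toList_ofFn, encode_list_map, List.map_ofFn]
  congr 2
  funext i
  have h2 := wEquiv_testBit n w i
  have h3 := xof_sub 0 (wEquiv n w) i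
  simp only [Function.comp, Encodable.encode_sigma_val, zero_add]
  simp only [Nat.cast_zero, sub_zero] at h3
  rw [h3, h2]
  cases w i <;> rfl

theorem encode_window_lt (n : ℕ) (w w' : Fin n → Bool) (h : wEquiv n w < wEquiv n w') :
    Encodable.encode w < Encodable.encode w' := by
  rw [encode_window, encode_window]
  apply wcode_lt
  have e : ∀ w, num (xof 0 (wEquiv n w)) (0:ℕ) n = wEquiv n w := by
    intro w
    have := num_xof 0 (wEquiv n w) 0 n
    simp only [Nat.cast_zero, sub_zero, pow_zero, Nat.div_one] at this
    rw [Nat.cast_zero, this, Nat.mod_eq_of_lt (wEquiv n w).2]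
  rw [e, e]
  exact h

theorem sortedUniv_window (n : ℕ) : Encodable.sortedUniv (Fin n → Bool) = List.ofFn (wEquiv n).symm := by
  have : Std.Antisymm (Encodable.encode' (Fin n → Bool) ⁻¹'o (· ≤ ·)) :=
    ⟨fun a b h1 h2 => Encodable.encode_injective (le_antisymm h1 h2)⟩
  refine List.Perm.eq_of_pairwise' (r := Encodable.encode' (Fin n → Bool) ⁻¹'o (· ≤ ·)) ?_ ?_ ?_
  · exact Finset.pairwise_sort _ _
  · rw [List.pairwise_ofFn]
    intro i j hij
    apply le_of_lt
    apply encode_window_lt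
    simpa using hij
  · rw [List.perm_ext_iff_of_nodup (Encodable.sortedUniv_nodup _) (List.nodup_ofFn.2 (wEquiv n).symm.injective)]
    intro a
    simp only [Encodable.mem_sortedUniv, List.mem_ofFn, true_iff]
    exact (wEquiv n).symm.surjective a

theorem cast_val {m n : ℕ} (h : m = n) (x : Fin m) : (Equiv.cast (congrArg Fin h) x).val = x.val := by
  subst h; rfl

theorem fintypeEquivFin_symm {α : Type} [Fintype α] [Encodable α] (k : Fin (Fintype.card α))
    (hk : (k:ℕ) < (Encodable.sortedUniv α).length) :
    Encodable.fintypeEquivFin.symm k = (Encodable.sortedUniv α)[(k:ℕ)] := by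
  letI : DecidableEq α := Encodable.decidableEqOfEncodable α
  rw [Equiv.symm_apply_eq]
  unfold Encodable.fintypeEquivFin
  apply Fin.ext
  rw [Equiv.trans_apply, cast_val (Encodable.length_sortedUniv α)]
  simp only [List.Nodup.getEquivOfForallMemList_symm_apply_val]
  exact ((Encodable.sortedUniv_nodup α).idxOf_getElem _ _).symm

theorem encode_rule (n : ℕ) (f : (Fin n → Bool) → Bool) :
    Encodable.encode f =
      Encodable.encode (List.ofFn fun k : Fin (2^n) => Nat.pair k (f ((wEquiv n).symm k)).toNat) := by
  rw [show Encodable.encode f = Encodable.encode (List.Vector.ofFn fun k =>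
    (⟨k, f (Encodable.fintypeEquivFin.symm k)⟩ : Σ _ : Fin (Fintype.card (Fin n → Bool)), Bool)) from rfl]
  rw [show ∀ v : List.Vector (Σ _ : Fin (Fintype.card (Fin n → Bool)), Bool) (Fintype.card (Fin n → Bool)),
    Encodable.encode v = Encodable.encode v.toList from fun v => rfl,
    List.Vector.toList_ofFn, encode_list_map, List.map_ofFn]
  congr 1
  have h := sortedUniv_window n
  apply List.ext_getElem
  · simp
  · intro i h1 h2
    simp only [List.getElem_ofFn, Function.comp, Encodable.encode_sigma_val]
    rw [fintypeEquivFin_symm _ (by simpa [Encodable.length_sortedUniv] using h1)]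
    have e : ∀ b : Bool, Encodable.encode b = b.toNat := by intro b; cases b <;> rfl
    simp only [h, List.getElem_ofFn, e]
    rfl

open Classical in
noncomputable def mkCode (R : ℕ → ℕ) (p : ℕ → ℕ → Prop) (n : ℕ) : CACode :=
  ⟨R n, fun w => decide (p n (wEquiv _ w))⟩

theorem mkCode_computable {R : ℕ → ℕ} {p : ℕ → ℕ → Prop} (hR : Primrec R)
    (hp : PrimrecPred fun x : ℕ × ℕ => p x.1 x.2) : Primrec fun n => Encodable.encode (mkCode R p n) := by
  classical
  have h1 : ∀ n, Encodable.encode (mkCode R p n) = Nat.pair (R n)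
      (Encodable.encode ((List.range (2^(2 * R n + 1))).map fun K => Nat.pair K (if p n K then 1 else 0))) := by
    intro n
    rw [mkCode, Encodable.encode_sigma_val, encode_rule]
    congr 2
    apply List.ext_getElem
    · simp
    · intro i _ _
      simp only [List.getElem_ofFn, List.getElem_map, List.getElem_range, Equiv.apply_symm_apply]
      by_cases h : p n i <;> simp [h]
  simp only [h1]
  have h2 : Primrec fun n => 2^(2 * R n + 1) := pr_pow (.const 2) (pr_add (pr_mul (.const 2) hR) (.const 1))
  refine Primrec₂.natPair.comp hR (Primrec.encode.comp ?_)
  refine Primrec.list_map (Primrec.list_range.comp h2) ?_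
  exact Primrec₂.natPair.comp Primrec.snd (Primrec.ite hp (.const 1) (.const 0))


/-! ## Cellular automata and forbidden words -/

/-- `F` is a CA of radius `r` -/
def CAr (r : ℕ) (F : (ℤ → Bool) → (ℤ → Bool)) : Prop :=
  Loc r F ∧ ∀ y i, F (fun k => y (k + i)) 0 = F y i

theorem CAr.mono {r r' : ℕ} {F : (ℤ → Bool) → (ℤ → Bool)} (h : CAr r F) (hr : r ≤ r') : CAr r' F :=
  ⟨fun x x' i hx => h.1 x x' i fun k hk => hx k (hk.trans (by exact_mod_cast hr)), h.2⟩

theorem CAr.shift {r : ℕ} {F : (ℤ → Bool) → (ℤ → Bool)} (h : CAr r F) (y : ℤ → Bool) (i j : ℤ) :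
    F (fun k => y (k + i)) j = F y (j + i) := by
  rw [← h.2, ← h.2 y]
  congr 1
  funext k
  simp only [add_assoc]

theorem CAr.sq {r : ℕ} {F : (ℤ → Bool) → (ℤ → Bool)} (h : CAr r F) : CAr (2 * r) (F ∘ F) := by
  refine ⟨fun x x' i hx => ?_, fun y i => ?_⟩
  · apply h.1
    intro k hk
    apply h.1
    intro l hl
    apply hx
    rw [abs_le] at *
    push_cast
    omega
  · have : F (fun k => y (k + i)) = fun k => F y (k + i) := funext fun j => h.shift y i j
    rw [Function.comp_apply, this, h.2]
    rfl

theorem CAr_caMap (r : ℕ) (f : (Fin (2 * r + 1) → Bool) → Bool) : CAr r (caMap r f) := by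
  refine ⟨fun x x' i hx => ?_, fun y i => ?_⟩
  · unfold caMap
    congr 1
    funext j
    apply hx
    have := j.2
    rw [abs_le]
    omega
  · unfold caMap
    congr 1
    funext j
    ring_nf

/-- local rule on numbers -/
def gF (F : (ℤ → Bool) → (ℤ → Bool)) (r k : ℕ) : Bool := F (xof r (k % 2^(2*r+1))) 0

theorem gF_mod (F : (ℤ → Bool) → (ℤ → Bool)) (r k : ℕ) : gF F r k = gF F r (k % 2^(2*r+1)) := by
  unfold gF; rw [Nat.mod_mod]

theorem xof_num (R : ℕ) (y : ℤ → Bool) (k : ℤ) (hk : |k| ≤ R) : xof R (num y (-R) (2*R+1)) k = y k := by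
  rw [abs_le] at hk
  have := xof_sub R (num y (-R) (2*R+1)) (k + R).toNat
  rw [Int.toNat_of_nonneg (by omega), add_sub_cancel_right] at this
  rw [this, num_testBit]
  rw [show -(R:ℤ) + ((k + R).toNat : ℤ) = k by omega]
  have : (k + R).toNat < 2 * R + 1 := by omega
  simp [this]

theorem CAr.gF_spec {r : ℕ} {F : (ℤ → Bool) → (ℤ → Bool)} (h : CAr r F) (y : ℤ → Bool) :
    F y 0 = gF F r (num y (-r) (2*r+1)) := by
  unfold gF
  rw [Nat.mod_eq_of_lt (num_lt _ _ _)]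
  apply h.1
  intro k hk
  rw [sub_zero] at hk
  rw [xof_num r y k hk]

theorem mkCode_spec {R : ℕ → ℕ} {p : ℕ → ℕ → Prop} {n : ℕ} {G : (ℤ → Bool) → (ℤ → Bool)} (hG : CAr (R n) G)
    (hp : ∀ K, G (xof (R n) K) 0 = true ↔ p n K) :
    caMap (mkCode R p n).1 (mkCode R p n).2 = G := by
  classical
  funext x i
  rw [← hG.2]
  unfold caMap mkCode
  rw [Bool.eq_iff_iff, decide_eq_true_iff, ← hp, ← Bool.eq_iff_iff]
  apply hG.1
  intro k hk
  rw [sub_zero, abs_le] at hk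
  have e := xof_sub (R n) (wEquiv (2 * R n + 1) fun j => x (i - (R n : ℤ) + ((j : ℕ) : ℤ))) (k + R n).toNat
  rw [Int.toNat_of_nonneg (by omega), add_sub_cancel_right] at e
  rw [e]
  have e2 := wEquiv_testBit (2 * R n + 1) (fun j => x (i - (R n : ℤ) + ((j : ℕ) : ℤ))) ⟨(k + R n).toNat, by omega⟩
  simp only at e2
  rw [e2]
  congr 1
  omega

theorem forbidden {r : ℕ} {F : (ℤ → Bool) → (ℤ → Bool)} (h : CAr r F) (hs : ¬ Function.Surjective F) :
    ∃ len u : ℕ, u < 2^len ∧ ∀ x i, num (F x) i len ≠ u := by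
  unfold Function.Surjective at hs
  push Not at hs
  obtain ⟨y, hy⟩ := hs
  have h1 : ¬ ∀ n : ℕ, ∃ z, ∀ i : ℤ, |i| ≤ n → F^[1] z i = y i := by
    intro h2
    obtain ⟨z, hz⟩ := h.1.mem_range 1 y h2
    exact hy z hz
  push Not at h1
  obtain ⟨n, hn⟩ := h1
  refine ⟨2*n+1, num y (-n) (2*n+1), num_lt _ _ _, fun x i he => ?_⟩
  obtain ⟨j, hj, hne⟩ := hn (fun k => x (k + (i + n)))
  apply hne
  rw [Function.iterate_one, h.shift, ← xof_num n y j hj, ← he]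
  rw [abs_le] at hj
  have e := xof_sub n (num (F x) i (2*n+1)) (j + n).toNat
  rw [Int.toNat_of_nonneg (by omega), add_sub_cancel_right] at e
  rw [e, num_testBit, show i + ((j + n).toNat : ℤ) = j + (i + n) by omega]
  have : (j + n).toNat < 2 * n + 1 := by omega
  simp [this]

theorem forbidden2 {r : ℕ} {F F' : (ℤ → Bool) → (ℤ → Bool)} (h : CAr r F) (hs : ¬ Function.Surjective F)
    (h' : CAr r F') (hs' : ¬ Function.Surjective F') :
    ∃ L un : ℕ, 0 < L ∧ un < 2^(L-1) ∧ (∀ x i, num (F x) i L ≠ un) ∧ (∀ x i, num (F' x) i L ≠ un) := by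
  obtain ⟨l, u, hu, hf⟩ := forbidden h hs
  obtain ⟨l', u', hu', hf'⟩ := forbidden h' hs'
  refine ⟨l + l' + 1, u + 2^l * u', by omega, ?_, fun x i he => ?_, fun x i he => ?_⟩
  · rw [show l + l' + 1 - 1 = l + l' by omega, pow_add]
    calc _ < 2^l + 2^l * u' := by omega
      _ = 2^l * (u' + 1) := by ring
      _ ≤ _ := Nat.mul_le_mul_left _ hu'
  · apply hf x i
    have e := num_sub (x := F x) (i := i) (len := l + l' + 1) (p := 0) (q := l) (by omega)
    rw [he] at e
    simpa [Nat.mod_eq_of_lt hu] using e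
  · apply hf' x (i + l)
    have e := num_sub (x := F' x) (i := i) (len := l + l' + 1) (p := l) (q := l') (by omega)
    rw [he, Nat.add_mul_div_left _ _ (by positivity), Nat.div_eq_of_lt hu, zero_add, Nat.mod_eq_of_lt hu'] at e
    exact e

namespace RP
open Classical in
theorem count (L un : ℕ) (hun : un < 2^L) (m : ℕ) :
    ((Finset.range (2^(L*m))).filter (ufree L un (L*m))).card ≤ (2^L - 1)^m := by
  induction m with
  | zero =>
    refine (Finset.card_filter_le _ _).trans ?_
    simp
  | succ m ih =>
    have h : ((Finset.range (2^(L*(m+1)))).filter (ufree L un (L*(m+1)))).card ≤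
        (((Finset.range (2^L)).erase un) ×ˢ ((Finset.range (2^(L*m))).filter (ufree L un (L*m)))).card := by
      apply Finset.card_le_card_of_injOn (fun v => (v % 2^L, v / 2^L))
      · intro v hv
        simp only [Finset.coe_filter, Finset.mem_range, Set.mem_setOf_eq] at hv
        simp only [Finset.coe_product, Set.mem_prod, Finset.mem_coe, Finset.mem_erase, Finset.mem_range,
          Finset.mem_filter]
        refine ⟨⟨?_, Nat.mod_lt _ (by positivity)⟩, ?_, ?_⟩
        · have := hv.2 0 (by rw [mul_add]; omega)
          simpa using this
        · apply Nat.div_lt_of_lt_mul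
          rw [← pow_add, show L + L * m = L * (m+1) by ring]
          exact hv.1
        · intro o ho
          have := hv.2 (L + o) (by rw [mul_add]; omega)
          rwa [pow_add, ← Nat.div_div_eq_div_mul] at this
      · intro v _ v' _ hvv
        simp only [Prod.mk.injEq] at hvv
        rw [← Nat.mod_add_div v (2^L), ← Nat.mod_add_div v' (2^L), hvv.1, hvv.2]
    refine h.trans ?_
    rw [Finset.card_product, Finset.card_erase_of_mem (Finset.mem_range.2 hun), Finset.card_range, pow_succ, mul_comm]
    exact Nat.mul_le_mul_right _ ih

theorem exists_m (A : ℕ) (hA : 0 < A) : ∃ m, 2 ≤ m ∧ 4 * (A-1)^m ≤ A^m := by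
  have hA' : (0:ℝ) < A := by exact_mod_cast hA
  obtain ⟨m, hm⟩ := exists_pow_lt_of_lt_one (show (0:ℝ) < 1/4 by norm_num)
    (show ((A-1 : ℕ):ℝ) / A < 1 by rw [div_lt_one hA']; exact_mod_cast (by omega))
  rw [div_pow, div_lt_div_iff₀ (by positivity) (by norm_num)] at hm
  have hm' : 4 * (A-1)^m ≤ A^m := by
    have : ((4 * (A-1)^m : ℕ) : ℝ) ≤ (A^m : ℕ) := by push_cast at hm ⊢; linarith
    exact_mod_cast this
  refine ⟨m + 2, by omega, ?_⟩
  calc 4 * (A-1)^(m+2) = 4 * (A-1)^m * (A-1)^2 := by ring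
    _ ≤ A^m * A^2 := Nat.mul_le_mul hm' (Nat.pow_le_pow_left (by omega) 2)
    _ = _ := by ring

theorem exists_params (L un : ℕ) (hL : 0 < L) (hun : un < 2^(L-1)) : ∃ (Q : ℕ) (UF : List ℕ), 2 * L ≤ Q ∧
    (∀ v, v ∈ UF ↔ v < 2^Q ∧ ufree L un Q v) ∧ UF.length ≤ 2^(Q-2) ∧ 0 < UF.length := by
  classical
  have hun' : un < 2^L := hun.trans_le (Nat.pow_le_pow_right (by norm_num) (by omega))
  obtain ⟨m, hm, h4⟩ := exists_m (2^L) (by positivity)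
  have hQ : 2 * L ≤ L * m := by nlinarith
  have hmem : ∀ v, v ∈ ((Finset.range (2^(L*m))).filter (ufree L un (L*m))).toList ↔ v < 2^(L*m) ∧ ufree L un (L*m) v := by
    intro v; simp
  refine ⟨L * m, ((Finset.range (2^(L*m))).filter (ufree L un (L*m))).toList, hQ, hmem, ?_, ?_⟩
  · rw [Finset.length_toList]
    have := count L un hun' m
    have e : 2^(L*m) = 4 * 2^(L*m-2) := by
      rw [show L * m = (L*m-2) + 2 by omega, pow_add]
      simp [mul_comm]
    rw [← pow_mul, e] at h4
    omega
  · apply List.length_pos_of_mem (a := 2^(L*m) - 1)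
    rw [hmem]
    refine ⟨Nat.sub_lt (by positivity) (by norm_num), fun o ho he => ?_⟩
    have h1 := Nat.testBit_lt_two_pow hun
    rw [← he, Nat.testBit_mod_two_pow, Nat.testBit_div_two_pow, Nat.testBit_two_pow_sub_one] at h1
    simp at h1
    omega
end RP


/-! ## The reduction -/

theorem rice_core (P : Set (Set (Config Bool))) {r : ℕ} {F0 F1 : (ℤ → Bool) → (ℤ → Bool)} {e : Bool}
    (h0 : CAr r F0) (h1 : CAr r F1) (s0 : ¬ Function.Surjective F0) (s1 : ¬ Function.Surjective F1)
    (q0 : ∀ i, F0 (fun _ => e) i = e) (q1 : ∀ i, F1 (fun _ => e) i = e)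
    (hP : ¬ (limitSet F0 ∈ P ↔ limitSet F1 ∈ P)) :
    ¬ ∃ g : ℕ → Bool, Computable g ∧
        ∀ c : CACode, (g (Encodable.encode c) = true ↔ limitSet (caMap c.1 c.2) ∈ P) := by
  rintro ⟨g, hg, hgc⟩
  obtain ⟨L, un, hL, hun, f0, f1⟩ := forbidden2 h0 s0 h1 s1
  obtain ⟨Q, UF, hQ, hUF, hW, hW0⟩ := RP.exists_params L un hL hun
  obtain ⟨Y, hYf, hYn, H0, V0, Val0, ini, hlab⟩ := TS.labels
  have hFf := Fst.finite
  obtain ⟨m, ⟨eF⟩⟩ := Finite.exists_equiv_fin Fst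
  obtain ⟨y, ⟨eY⟩⟩ := Finite.exists_equiv_fin Y
  have hm : 0 < m := by
    have z : Fst := ⟨⟨0,0,0,true⟩,⟨0,0,0,true⟩,true,true,⟨0,0,0,true⟩,⟨0,0,0,true⟩,true,true,true,true,true,true,true,true,true⟩
    exact lt_of_le_of_lt (Nat.zero_le _) (eF z).2
  have hy : 0 < y := lt_of_le_of_lt (Nat.zero_le _) (eY (Classical.arbitrary Y)).2
  obtain ⟨κ, res, zb, valT, hT, vT, iT, hspec⟩ := TS.nuT_spec eF eY H0 V0 Val0 ini
  let S : ℕ → ℕ := TS.Sz m y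
  let nu : ℕ → ℕ → ℕ → ℕ := fun n s s' => TS.nuT κ res zb valT hT vT iT m y n s s'
  let C : ℕ := Q + 3 * Q * L + r + 1
  let PP : ℕ → RP := fun n => RP.PN L un Q UF C S nu n
  have hS : Primrec S := pr_mul (.const m) (pr_mul (pr_mul (.const y) (pr_add .id (.const 2)))
    (pr_mul (.const y) (pr_add .id (.const 2))))
  have hnu : Primrec fun x : ℕ × ℕ × ℕ => nu x.1 x.2.1 x.2.2 :=
    TS.pr_nuT κ res zb valT hT vT iT hm hy .fst (Primrec.fst.comp .snd) (Primrec.snd.comp .snd)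
  have hsp : ∀ n a b, (PP n).nu (TS.enc eF eY n a) (TS.enc eF eY n b) =
      (fnu (TS.LS H0 V0 Val0 ini n) a b).mp (TS.enc eF eY n) := fun n a b => hspec n a b
  have hsur : ∀ n s, s < (PP n).S → ∃ a, TS.enc eF eY n a = s := fun n s hs => TS.enc_surj eF eY n s hs
  have hlt : ∀ n a, TS.enc eF eY n a < (PP n).S := fun n a => TS.enc_lt eF eY n a
  have hOK : ∀ n, (PP n).OK := by
    intro n
    refine ⟨hL, hun, hQ, hUF, hW, hW0, Nat.lt_two_pow_self.le, ?_, ?_⟩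
    · show S n + Q + 3 * Q * L < S n + (Q + 3 * Q * L + r + 1)
      omega
    · intro s s' k hs hs' hk
      obtain ⟨a, rfl⟩ := hsur n s hs
      obtain ⟨b, rfl⟩ := hsur n s' hs'
      have h2 : (PP n).nu (TS.enc eF eY n a) (TS.enc eF eY n b) = .alive k := RP.resOf_alive.2 hk
      rw [hsp] at h2
      cases hc : fnu (TS.LS H0 V0 Val0 ini n) a b with
      | die => rw [hc] at h2; cases h2
      | fire => rw [hc] at h2; cases h2
      | alive d =>
        rw [hc] at h2
        cases h2
        exact hlt n d
  have hell : ∀ n, r < (PP n).ell := by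
    intro n
    show r < Q * (S n + (Q + 3 * Q * L + r + 1) + 1 + 3 * Q * L + S n)
    have : 1 ≤ Q := by omega
    nlinarith [Nat.zero_le (3 * Q * L), Nat.zero_le (S n)]
  let R : ℕ → ℕ := fun n => 4 * (PP n).ell
  let p : ((ℤ → Bool) → (ℤ → Bool)) → ℕ → ℕ → Prop := fun F n K => (PP n).ruleN (gF F r) r e K
  have hcode : ∀ F, CAr r F → ∀ n, caMap (mkCode R (p F) n).1 (mkCode R (p F) n).2 = (PP n).H F e := by
    intro F hF n
    apply mkCode_spec
    · refine CAr.mono (r := r + 2 * (PP n).ell) ⟨RP.H_loc (hOK n) hF.1, RP.H_shift hF.2⟩ ?_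
      have := hell n
      show r + 2 * (PP n).ell ≤ 4 * (PP n).ell
      omega
    · exact RP.rule_iff (hell n) hF.gF_spec
  have hcomp : ∀ F, Computable fun n => g (Encodable.encode (mkCode R (p F) n)) := by
    intro F
    refine hg.comp (Primrec.to_comp (mkCode_computable ?_ ?_))
    · exact pr_mul (.const 4) (RP.pr_ell hS .id)
    · exact RP.pr_rule hS hnu (gF F r) r (gF_mod F r) e .fst .snd
  have key : ∀ n, TS.Hlt n ↔ (xor (g (Encodable.encode (mkCode R (p F0) n)))
      (g (Encodable.encode (mkCode R (p F1) n)))) = true := by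
    intro n
    have e0 := hgc (mkCode R (p F0) n)
    have e1 := hgc (mkCode R (p F1) n)
    rw [hcode F0 h0] at e0
    rw [hcode F1 h1] at e1
    constructor
    · intro hh
      obtain ⟨B, hB⟩ := (hlab n).1 hh
      have hd := RP.tr_dying (hsur n) (hsp n) (N3 _ B hB)
      have l0 : limitSet ((PP n).H F0 e) = limitSet F0 := RP.limit_dying (hOK n) f0 hd
      have l1 : limitSet ((PP n).H F1 e) = limitSet F1 := RP.limit_dying (hOK n) f1 hd
      rw [l0] at e0
      rw [l1] at e1
      rw [← e0, ← e1] at hP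
      revert hP
      cases g (Encodable.encode (mkCode R (p F0) n)) <;>
        cases g (Encodable.encode (mkCode R (p F1) n)) <;> simp
    · intro hx
      by_contra hh
      obtain ⟨Lab, hV, hH, hW'⟩ := (hlab n).2 hh
      have n4 := RP.tr_N4 (hlt n) (hsp n) (N4 hV hH hW')
      have n5 := RP.tr_N5 (hsur n) (hsp n) (N5 _)
      have l : limitSet ((PP n).H F0 e) = limitSet ((PP n).H F1 e) :=
        Set.Subset.antisymm
          (RP.limit_sub (hOK n) f0 f1 h0.1 h1.1 q0 q1 (hell n) n4 n5)
          (RP.limit_sub (hOK n) f1 f0 h1.1 h0.1 q1 q0 (hell n) n4 n5)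
      rw [l, ← e1] at e0
      revert e0 hx
      cases g (Encodable.encode (mkCode R (p F0) n)) <;>
        cases g (Encodable.encode (mkCode R (p F1) n)) <;> simp
  apply TS.Hlt_undec
  rw [ComputablePred.computable_iff]
  refine ⟨fun n => xor (g (Encodable.encode (mkCode R (p F0) n)))
      (g (Encodable.encode (mkCode R (p F1) n))), ?_, funext fun n => propext (key n)⟩
  exact (Primrec.dom_bool₂ xor).to_comp.comp (hcomp F0) (hcomp F1)

/-- the AND automaton -/
def Aand (x : ℤ → Bool) (i : ℤ) : Bool := x i && x (i + 1)

theorem Aand_CAr : CAr 1 Aand := by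
  refine ⟨fun x x' i hx => ?_, fun y i => ?_⟩
  · unfold Aand
    rw [hx i (by simp), hx (i+1) (by simp)]
  · unfold Aand
    simp [add_comm]

theorem Aand_not_surj : ¬ Function.Surjective Aand := by
  intro h
  obtain ⟨x, hx⟩ := h (fun k => decide (k ≠ 1))
  have a := congrFun hx 0
  have b := congrFun hx 1
  have c := congrFun hx 2
  simp [Aand] at a b c
  simp_all

theorem limitSet_sq (F : Config Bool → Config Bool) : limitSet (F ∘ F) = limitSet F := by
  have e : ∀ j, (F ∘ F)^[j] = F^[2 * j] := fun j => by
    rw [Function.iterate_mul]; rfl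
  unfold limitSet
  apply Set.Subset.antisymm
  · intro x hx
    rw [Set.mem_iInter] at hx ⊢
    intro j
    obtain ⟨z, hz⟩ := hx j
    rw [e, two_mul, Function.iterate_add_apply] at hz
    exact ⟨_, hz⟩
  · intro x hx
    rw [Set.mem_iInter] at hx ⊢
    intro j
    rw [e]
    exact hx _

theorem exists_quiescent {r : ℕ} {F : (ℤ → Bool) → (ℤ → Bool)} (h : CAr r F) :
    ∃ e : Bool, ∀ i, (F ∘ F) (fun _ => e) i = e := by
  have hc : ∀ a, F (fun _ => a) = fun _ => F (fun _ => a) 0 := by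
    intro a
    funext i
    exact (h.2 (fun _ => a) i).symm
  have h2 : ∀ a i, (F ∘ F) (fun _ => a) i = F (fun _ => F (fun _ => a) 0) 0 := by
    intro a i
    rw [Function.comp_apply, hc a, hc (F (fun _ => a) 0)]
  have key : ∀ φ : Bool → Bool, ∃ e, φ (φ e) = e := by decide
  obtain ⟨e, he⟩ := key (fun a => F (fun _ => a) 0)
  exact ⟨e, fun i => (h2 e i).trans he⟩

theorem rice_and (P : Set (Set (Config Bool))) {F : Config Bool → Config Bool} (hF : IsCA F)
    (hs : ¬ Function.Surjective F) (hP : ¬ (limitSet Aand ∈ P ↔ limitSet F ∈ P)) :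
    ¬ ∃ g : ℕ → Bool, Computable g ∧
        ∀ c : CACode, (g (Encodable.encode c) = true ↔ limitSet (caMap c.1 c.2) ∈ P) := by
  obtain ⟨r, f, rfl⟩ := hF
  have h := CAr_caMap r f
  obtain ⟨e, he⟩ := exists_quiescent h
  refine rice_core P (r := 2 * r + 1) (e := e) (Aand_CAr.mono (by omega)) (h.sq.mono (by omega))
    Aand_not_surj (fun hh => hs hh.of_comp) (fun i => by simp [Aand]) he ?_
  rw [limitSet_sq]
  exact hP

theorem rice_limitSet_binary_undecidable (P : Set (Set (Config Bool)))
    (h0 : ∃ F : Config Bool → Config Bool, IsCA F ∧ ¬ Function.Surjective F ∧ limitSet F ∈ P)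
    (h1 : ∃ F : Config Bool → Config Bool, IsCA F ∧ ¬ Function.Surjective F ∧ limitSet F ∉ P) :
    ¬ ∃ g : ℕ → Bool, Computable g ∧
        ∀ c : CACode, (g (Encodable.encode c) = true ↔ limitSet (caMap c.1 c.2) ∈ P) := by
  obtain ⟨F0, a0, b0, c0⟩ := h0
  obtain ⟨F1, a1, b1, c1⟩ := h1
  by_cases hA : limitSet Aand ∈ P
  · exact rice_and P a1 b1 (by simp [hA, c1])
  · exact rice_and P a0 b0 (by simp [hA, c0])
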